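/- Let f be a smooth positive function on the closed unit disc and j a smooth positive function on the unit circle, and fix smooth initial data u₀ : closure B → ℝ and ρ₀ ∈ (0, π). Then there exist numbers 0 < ρ₁ ≤ ρ₂ < π, depending only on f, j, u₀, ρ₀ and not on T, such that for every T ∈ (0, ∞] and every smooth solution (u, ρ) of the prescribed curvature flow on [0, T) with u(·,0) = u₀ and ρ(0) = ρ₀, there holds ρ₁ ≤ ρ(t) ≤ ρ₂ for all 0 < t < T. -/

import Mathlib

open MeasureTheory Metric Set Filter
open scoped Real Topology ENNReal

noncomputable section

/-- The closed unit disc in `ℂ ≅ ℝ²`. -/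
def cdisc : Set ℂ := Metric.closedBall 0 1

/-- The open unit disc `B`. -/
def odisc : Set ℂ := Metric.ball 0 1

/-- The unit circle `∂B`. -/
def bdry : Set ℂ := Metric.sphere 0 1

/-- The boundary point with angle `θ`. -/
def bpt (θ : ℝ) : ℂ := Complex.exp ((θ : ℂ) * Complex.I)

/-- Boundary integral with respect to arclength `ds₀`. -/
def circInt (φ : ℂ → ℝ) : ℝ := ∫ θ in (0:ℝ)..(2 * Real.pi), φ (bpt θ)

/-- Integral over the open unit disc with respect to Lebesgue measure. -/
def ballInt (φ : ℂ → ℝ) : ℝ := ∫ z in odisc, φ z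

/-- Outward normal derivative `∂w/∂ν₀(z) = z·∇w(z)` for `z ∈ ∂B`. -/
def nder (w : ℂ → ℝ) (z : ℂ) : ℝ := fderivWithin ℝ w cdisc z z

/-- The Euclidean Laplacian, computed with derivatives within the closed disc. -/
def lapW (w : ℂ → ℝ) (z : ℂ) : ℝ :=
  fderivWithin ℝ (fun x => fderivWithin ℝ w cdisc x 1) cdisc z 1 +
  fderivWithin ℝ (fun x => fderivWithin ℝ w cdisc x Complex.I) cdisc z Complex.I

/-- The coefficient `α(t) = 2ρ(t)/∫_B f e^{2u(·,t)} dz`. -/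
def alphaC (f : ℂ → ℝ) (u : ℂ → ℝ → ℝ) (ρ : ℝ → ℝ) (t : ℝ) : ℝ :=
  2 * ρ t / ballInt fun z => f z * Real.exp (2 * u z t)

/-- The coefficient `β(t) = 2(π − ρ(t))/∫_{∂B} j e^{u(·,t)} ds₀`. -/
def betaC (j : ℂ → ℝ) (u : ℂ → ℝ → ℝ) (ρ : ℝ → ℝ) (t : ℝ) : ℝ :=
  2 * (Real.pi - ρ t) / circInt fun z => j z * Real.exp (u z t)

/-- The time domain `[0, T)` (with `T ∈ (0, ∞]`). -/
def flowDom (T : ℝ≥0∞) : Set ℝ := {t : ℝ | 0 ≤ t ∧ ENNReal.ofReal t < T}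

/-- `(u, ρ)` is a smooth solution of the prescribed curvature flow on `[0, T)`:
`∂u/∂t = α f + e^{−2u} Δu` in `B`, `∂u/∂t = β j − e^{−u}(∂u/∂ν₀ + 1)` on `∂B`,
and `dρ/dt = log (β²/α)`, with `u` smooth on `closure B × [0,T)` and `ρ` C¹ with
values in `(0, π)`. -/
def IsFlow (f j : ℂ → ℝ) (T : ℝ≥0∞) (u : ℂ → ℝ → ℝ) (ρ : ℝ → ℝ) : Prop :=
  ContDiffOn ℝ (⊤ : ℕ∞) (fun p : ℂ × ℝ => u p.1 p.2) (cdisc ×ˢ flowDom T) ∧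
  ContDiffOn ℝ 1 ρ (flowDom T) ∧
  (∀ t ∈ flowDom T, ρ t ∈ Set.Ioo 0 Real.pi) ∧
  (∀ t ∈ flowDom T, 0 < t → ∀ z ∈ odisc,
    deriv (u z) t = alphaC f u ρ t * f z + Real.exp (-(2 * u z t)) * lapW (fun w => u w t) z) ∧
  (∀ t ∈ flowDom T, 0 < t → ∀ z ∈ bdry,
    deriv (u z) t = betaC j u ρ t * j z - Real.exp (-(u z t)) * (nder (fun w => u w t) z + 1)) ∧
  (∀ t ∈ flowDom T, 0 < t →
    deriv ρ t = Real.log (betaC j u ρ t ^ 2 / alphaC f u ρ t))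

lemma norm_bpt (θ : ℝ) : ‖bpt θ‖ = 1 := by
  simp [bpt, Complex.norm_exp_ofReal_mul_I]

lemma bpt_eq (θ : ℝ) : bpt θ = Real.cos θ + Real.sin θ * Complex.I := by
  simp [bpt, Complex.exp_mul_I]

lemma bpt_re (θ : ℝ) : (bpt θ).re = Real.cos θ := by
  simp [bpt_eq, Complex.cos_ofReal_re, Complex.sin_ofReal_im]

lemma bpt_im (θ : ℝ) : (bpt θ).im = Real.sin θ := by
  simp [bpt_eq, Complex.cos_ofReal_im, Complex.sin_ofReal_re]

lemma hasDerivAt_bpt (θ : ℝ) : HasDerivAt bpt (Complex.I * bpt θ) θ := by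
  have h : HasDerivAt (fun t : ℝ => (t : ℂ) * Complex.I) (1 * Complex.I) θ :=
    (Complex.ofRealCLM.hasDerivAt (x := θ)).mul_const Complex.I
  have := h.cexp
  rw [one_mul, mul_comm] at this
  exact this

lemma contDiff_bpt : ContDiff ℝ (⊤ : ℕ∞) bpt := by
  unfold bpt
  have : ContDiff ℝ (⊤ : ℕ∞) (fun t : ℝ => (t : ℂ)) := Complex.ofRealCLM.contDiff
  fun_prop

lemma continuous_bpt : Continuous bpt := contDiff_bpt.continuous

lemma bpt_periodic : Function.Periodic bpt (2 * Real.pi) := by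
  intro θ
  simp only [bpt]
  push_cast
  rw [add_mul]
  exact Complex.exp_periodic _

lemma bpt_mem_bdry (θ : ℝ) : bpt θ ∈ bdry := by simp [bdry, norm_bpt]

lemma bdry_subset_cdisc : bdry ⊆ cdisc := sphere_subset_closedBall

lemma odisc_subset_cdisc : odisc ⊆ cdisc := ball_subset_closedBall

lemma bpt_mem_cdisc (θ : ℝ) : bpt θ ∈ cdisc := bdry_subset_cdisc (bpt_mem_bdry θ)

lemma smul_bpt_mem_ball {R r : ℝ} (x : ℂ) (hr0 : 0 ≤ r) (hr : r < R) (θ : ℝ) :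
    x + r * bpt θ ∈ ball x R := by
  simp [norm_bpt, abs_of_nonneg hr0, hr]

lemma smul_bpt_mem_cdisc {r : ℝ} (hr0 : 0 ≤ r) (hr : r ≤ 1) (θ : ℝ) :
    (r : ℂ) * bpt θ ∈ cdisc := by
  simp [cdisc, norm_bpt, abs_of_nonneg hr0, hr]

lemma smul_bpt_mem_odisc {r : ℝ} (hr0 : 0 ≤ r) (hr : r < 1) (θ : ℝ) :
    (r : ℂ) * bpt θ ∈ odisc := by
  simp [odisc, norm_bpt, abs_of_nonneg hr0, hr]

lemma circInt_eq (φ : ℂ → ℝ) : circInt φ = ∫ θ in (-π)..π, φ (bpt θ) := by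
  have hp : Function.Periodic (fun θ => φ (bpt θ)) (2 * π) := fun θ => by
    simp only [bpt_periodic θ]
  have := hp.intervalIntegral_add_eq 0 (-π)
  rw [circInt]
  convert this using 2 <;> ring

lemma integral_ball_polar (f : ℂ → ℝ) (x : ℂ) (R : ℝ) :
    ∫ y in ball x R, f y =
      ∫ p in Ioo (0 : ℝ) R ×ˢ Ioo (-π) π, p.1 * f (x + p.1 * bpt p.2) := by
  have h1 : ∫ y in ball x R, f y = ∫ y, (ball (0 : ℂ) R).indicator (fun y => f (x + y)) y := by
    rw [← integral_indicator measurableSet_ball, ← integral_add_left_eq_self _ x]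
    congr 1; ext y
    simp [indicator]
  rw [h1, ← Complex.integral_comp_polarCoord_symm]
  have ht : MeasurableSet polarCoord.target := polarCoord.open_target.measurableSet
  have hm : MeasurableSet (Ioo (0 : ℝ) R ×ˢ Ioo (-π) π) := measurableSet_Ioo.prod measurableSet_Ioo
  rw [← integral_indicator ht, ← integral_indicator hm]
  congr 1; ext p
  by_cases h1 : 0 < p.1 <;> by_cases h2 : p.2 ∈ Ioo (-π) π <;> by_cases h3 : p.1 < R <;>
    simp [indicator, polarCoord_target, mem_prod, h1, h2, h3, abs_of_pos] <;>
    simp_all [bpt_eq]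

lemma lintegral_ball_polar (f : ℂ → ℝ≥0∞) (x : ℂ) (R : ℝ) :
    ∫⁻ y in ball x R, f y =
      ∫⁻ p in Ioo (0 : ℝ) R ×ˢ Ioo (-π) π, ENNReal.ofReal p.1 * f (x + p.1 * bpt p.2) := by
  have h1 : ∫⁻ y in ball x R, f y = ∫⁻ y, (ball (0 : ℂ) R).indicator (fun y => f (x + y)) y := by
    rw [← lintegral_indicator measurableSet_ball, ← lintegral_add_left_eq_self _ x]
    congr 1; ext y
    simp [indicator]
  rw [h1, ← Complex.lintegral_comp_polarCoord_symm]
  have ht : MeasurableSet polarCoord.target := polarCoord.open_target.measurableSet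
  have hm : MeasurableSet (Ioo (0 : ℝ) R ×ˢ Ioo (-π) π) := measurableSet_Ioo.prod measurableSet_Ioo
  rw [← lintegral_indicator ht, ← lintegral_indicator hm]
  congr 1; ext p
  by_cases h1 : 0 < p.1 <;> by_cases h2 : p.2 ∈ Ioo (-π) π <;> by_cases h3 : p.1 < R <;>
    simp [indicator, polarCoord_target, mem_prod, h1, h2, h3, abs_of_pos] <;>
    simp_all [bpt_eq]


lemma integrableOn_polar {f : ℂ → ℝ} {x : ℂ} {R C : ℝ} (hc : ContinuousOn f (ball x R))
    (hb : ∀ y ∈ ball x R, |f y| ≤ C) :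
    IntegrableOn (fun p : ℝ × ℝ => p.1 * f (x + p.1 * bpt p.2)) (Ioo (0 : ℝ) R ×ˢ Ioo (-π) π)
      (volume.prod volume) := by
  have hm : MeasurableSet (Ioo (0 : ℝ) R ×ˢ Ioo (-π) π) := measurableSet_Ioo.prod measurableSet_Ioo
  have hfin : (volume.prod volume) (Ioo (0 : ℝ) R ×ˢ Ioo (-π) π) < ⊤ := by
    rw [Measure.prod_prod]
    simp only [Real.volume_Ioo]
    exact ENNReal.mul_lt_top ENNReal.ofReal_lt_top ENNReal.ofReal_lt_top
  have hmem : ∀ p ∈ Ioo (0 : ℝ) R ×ˢ Ioo (-π) π, x + (p.1 : ℂ) * bpt p.2 ∈ ball x R :=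
    fun p hp => smul_bpt_mem_ball x hp.1.1.le hp.1.2 _
  refine IntegrableOn.of_bound hfin ?_ (R * C) ?_
  · have hcb : Continuous fun p : ℝ × ℝ => x + (p.1 : ℂ) * bpt p.2 := by
      have := continuous_bpt
      fun_prop
    have hcont : ContinuousOn (fun p : ℝ × ℝ => p.1 * f (x + p.1 * bpt p.2))
        (Ioo (0 : ℝ) R ×ˢ Ioo (-π) π) :=
      continuousOn_fst.mul (hc.comp hcb.continuousOn hmem)
    exact hcont.aestronglyMeasurable hm
  · refine ae_restrict_of_forall_mem hm fun p hp => ?_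
    rw [norm_mul, Real.norm_eq_abs, Real.norm_eq_abs, abs_of_pos hp.1.1]
    exact mul_le_mul hp.1.2.le (hb _ (hmem p hp)) (abs_nonneg _) (hp.1.1.trans hp.1.2).le

lemma integral_ball_polar_r {f : ℂ → ℝ} {x : ℂ} {R C : ℝ} (hc : ContinuousOn f (ball x R))
    (hb : ∀ y ∈ ball x R, |f y| ≤ C) :
    ∫ y in ball x R, f y = ∫ r in Ioo 0 R, ∫ θ in Ioo (-π) π, r * f (x + r * bpt θ) := by
  rw [integral_ball_polar, Measure.volume_eq_prod, setIntegral_prod _ (integrableOn_polar hc hb)]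

lemma integral_ball_polar_θ {f : ℂ → ℝ} {x : ℂ} {R C : ℝ} (hc : ContinuousOn f (ball x R))
    (hb : ∀ y ∈ ball x R, |f y| ≤ C) :
    ∫ y in ball x R, f y = ∫ θ in Ioo (-π) π, ∫ r in Ioo 0 R, r * f (x + r * bpt θ) := by
  rw [integral_ball_polar, Measure.volume_eq_prod, ← Measure.prod_restrict,
    integral_prod_symm _ (by rw [Measure.prod_restrict]; exact integrableOn_polar hc hb)]

lemma isCompact_cdisc : IsCompact cdisc := isCompact_closedBall _ _

lemma uniqueDiffOn_cdisc : UniqueDiffOn ℝ cdisc :=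
  uniqueDiffOn_convex (convex_closedBall 0 1) (by
    rw [cdisc, interior_closedBall _ one_ne_zero]; exact ⟨0, by simp⟩)

lemma cdisc_mem_nhds {z : ℂ} (hz : z ∈ odisc) : cdisc ∈ 𝓝 z :=
  mem_of_superset (isOpen_ball.mem_nhds hz) ball_subset_closedBall

lemma exists_bound_cdisc {f : ℂ → ℝ} (hf : ContinuousOn f cdisc) :
    ∃ C, 0 ≤ C ∧ ∀ z ∈ cdisc, |f z| ≤ C := by
  obtain ⟨C, hC⟩ := isCompact_cdisc.exists_bound_of_continuousOn hf
  exact ⟨max C 0, le_max_right _ _, fun z hz => (hC z hz).trans (le_max_left _ _)⟩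

lemma integrableOn_odisc {f : ℂ → ℝ} (hf : ContinuousOn f cdisc) : IntegrableOn f odisc :=
  (hf.integrableOn_compact isCompact_cdisc).mono_set odisc_subset_cdisc

lemma continuousOn_dir {g : ℂ → ℝ} (hg : ContDiffOn ℝ 1 g cdisc) (v : ℂ) :
    ContinuousOn (fun z => fderivWithin ℝ g cdisc z v) cdisc :=
  (hg.continuousOn_fderivWithin uniqueDiffOn_cdisc le_rfl).clm_apply continuousOn_const

lemma hasFDerivAt_of_cdisc {g : ℂ → ℝ} (hg : ContDiffOn ℝ 1 g cdisc) {z : ℂ} (hz : z ∈ odisc) :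
    HasFDerivAt g (fderivWithin ℝ g cdisc z) z :=
  ((hg.differentiableOn one_ne_zero z (odisc_subset_cdisc hz)).hasFDerivWithinAt).hasFDerivAt
    (cdisc_mem_nhds hz)

/-- Divergence theorem on the disc for a constant direction. -/
lemma integral_dir_eq {g : ℂ → ℝ} (hg : ContDiffOn ℝ 1 g cdisc) (v : ℂ) :
    ∫ z in odisc, fderivWithin ℝ g cdisc z v
      = circInt fun z => g z * (v.re * z.re + v.im * z.im) := by
  set a : ℝ → ℝ := fun θ => v.re * Real.cos θ + v.im * Real.sin θ with ha
  set a' : ℝ → ℝ := fun θ => v.re * (-Real.sin θ) + v.im * Real.cos θ with ha'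
  have hda : ∀ θ, HasDerivAt a (a' θ) θ := fun θ =>
    ((Real.hasDerivAt_cos θ).const_mul _).add ((Real.hasDerivAt_sin θ).const_mul _)
  have hda' : ∀ θ, HasDerivAt a' (-a θ) θ := fun θ => by
    have := ((Real.hasDerivAt_sin θ).neg.const_mul v.re).add
      ((Real.hasDerivAt_cos θ).const_mul v.im)
    exact this.congr_deriv (by simp only [ha]; ring)
  have hca : Continuous a := by fun_prop
  have hca' : Continuous a' := by fun_prop
  have hdec : ∀ θ, v = (a θ : ℂ) * bpt θ + (a' θ : ℂ) * (Complex.I * bpt θ) := fun θ => by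
    have h1 := Real.sin_sq_add_cos_sq θ
    apply Complex.ext
    · simp only [Complex.add_re, Complex.mul_re, Complex.mul_im, Complex.ofReal_re,
        Complex.ofReal_im, Complex.I_re, Complex.I_im, bpt_re, bpt_im, ha, ha']
      linear_combination -v.re * h1
    · simp only [Complex.add_im, Complex.mul_re, Complex.mul_im, Complex.ofReal_re,
        Complex.ofReal_im, Complex.I_re, Complex.I_im, bpt_re, bpt_im, ha, ha']
      linear_combination -v.im * h1
  have hcont := continuousOn_dir hg v
  obtain ⟨C, hC0, hC⟩ := exists_bound_cdisc hcont
  have hgc := hg.continuousOn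
  have hDc := hg.continuousOn_fderivWithin uniqueDiffOn_cdisc le_rfl
  set D := fderivWithin ℝ g cdisc with hD
  set A : ℝ × ℝ → ℝ := fun p => a p.2 * (g (p.1 * bpt p.2) + p.1 * D (p.1 * bpt p.2) (bpt p.2))
    with hA
  set B : ℝ × ℝ → ℝ := fun p => -a p.2 * g (p.1 * bpt p.2) +
    a' p.2 * (p.1 * D (p.1 * bpt p.2) (Complex.I * bpt p.2)) with hB
  have hcb : Continuous fun p : ℝ × ℝ => (p.1 : ℂ) * bpt p.2 := by
    have := continuous_bpt
    fun_prop
  have hmaps : MapsTo (fun p : ℝ × ℝ => (p.1 : ℂ) * bpt p.2) (Icc 0 1 ×ˢ univ) cdisc :=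
    fun p hp => smul_bpt_mem_cdisc hp.1.1 hp.1.2 _
  have hgp := hgc.comp hcb.continuousOn hmaps
  have hDp := hDc.comp hcb.continuousOn hmaps
  have hb2 : Continuous fun p : ℝ × ℝ => bpt p.2 := continuous_bpt.comp continuous_snd
  have hAc : ContinuousOn A (Icc 0 1 ×ˢ univ) :=
    (hca.comp continuous_snd).continuousOn.mul
      (hgp.add (continuousOn_fst.mul (hDp.clm_apply hb2.continuousOn)))
  have hBc : ContinuousOn B (Icc 0 1 ×ˢ univ) :=
    ((hca.comp continuous_snd).neg.continuousOn.mul hgp).add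
      ((hca'.comp continuous_snd).continuousOn.mul
      (continuousOn_fst.mul (hDp.clm_apply (continuous_const.mul hb2).continuousOn)))
  have hint : ∀ F : ℝ × ℝ → ℝ, ContinuousOn F (Icc 0 1 ×ˢ univ) →
      IntegrableOn F (Ioo (0 : ℝ) 1 ×ˢ Ioo (-π) π) (volume.prod volume) := fun F hF =>
    ((hF.mono (prod_mono_right (subset_univ _))).integrableOn_compact
      (isCompact_Icc.prod (isCompact_Icc (a := -π) (b := π)))).mono_set
      (prod_mono Ioo_subset_Icc_self Ioo_subset_Icc_self)
  have hAB : ∀ p : ℝ × ℝ, p.1 * D (0 + p.1 * bpt p.2) v = A p + B p := fun p => by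
    have h1 : D (0 + p.1 * bpt p.2) v = a p.2 * D (p.1 * bpt p.2) (bpt p.2) +
        a' p.2 * D (p.1 * bpt p.2) (Complex.I * bpt p.2) := by
      rw [zero_add]
      have hv : v = (a p.2) • bpt p.2 + (a' p.2) • (Complex.I * bpt p.2) := by
        simpa only [Complex.real_smul] using hdec p.2
      conv_lhs => rw [hv]
      rw [map_add, map_smul, map_smul, smul_eq_mul, smul_eq_mul]
    rw [h1]; simp only [hA, hB]; ring
  have hpi : -π ≤ π := by linarith [Real.pi_pos]
  have hDA : ∀ z ∈ odisc, HasFDerivAt g (D z) z := fun z hz => hasFDerivAt_of_cdisc hg hz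
  have hray : ∀ (r θ : ℝ), HasDerivAt (fun r : ℝ => (r : ℂ) * bpt θ) (bpt θ) r := fun r θ => by
    simpa using (Complex.ofRealCLM.hasDerivAt (x := r)).mul_const (bpt θ)
  have hIA : ∀ θ ∈ Ioo (-π) π, ∫ r in Ioo (0 : ℝ) 1, A (r, θ) = a θ * g (bpt θ) := by
    intro θ _
    rw [← integral_Ioc_eq_integral_Ioo, ← intervalIntegral.integral_of_le zero_le_one]
    have hcA : ContinuousOn (fun r => A (r, θ)) (Icc 0 1) :=
      hAc.comp (by fun_prop) (fun r hr => ⟨hr, trivial⟩)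
    rw [intervalIntegral.integral_eq_sub_of_hasDerivAt_of_le
      (f := fun r : ℝ => a θ * (r * g (r * bpt θ))) zero_le_one]
    · simp
    · have : ContinuousOn (fun r : ℝ => g (r * bpt θ)) (Icc 0 1) :=
        hgp.comp (f := fun r : ℝ => (r, θ)) (by fun_prop) (fun r hr => ⟨hr, trivial⟩)
      exact continuousOn_const.mul (continuousOn_id.mul this)
    · intro r hr
      have h1 : HasDerivAt (fun r : ℝ => g (r * bpt θ)) (D (r * bpt θ) (bpt θ)) r :=
        (hDA _ (smul_bpt_mem_odisc hr.1.le hr.2 θ)).comp_hasDerivAt r (hray r θ)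
      have := ((hasDerivAt_id r).mul h1).const_mul (a θ)
      exact this.congr_deriv (by simp [hA])
    · exact (hcA.mono (by rw [uIcc_of_le zero_le_one])).intervalIntegrable
  have hIB : ∀ r ∈ Ioo (0 : ℝ) 1, ∫ θ in Ioo (-π) π, B (r, θ) = 0 := by
    intro r hr
    rw [← integral_Ioc_eq_integral_Ioo, ← intervalIntegral.integral_of_le hpi]
    have hcB : Continuous (fun θ => B (r, θ)) := by
      rw [← continuousOn_univ]
      exact hBc.comp (by fun_prop) (fun θ _ => ⟨⟨hr.1.le, hr.2.le⟩, trivial⟩)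
    rw [intervalIntegral.integral_eq_sub_of_hasDerivAt
      (f := fun θ : ℝ => a' θ * g (r * bpt θ))]
    · have : bpt (-π) = bpt π := by
        rw [← bpt_periodic (-π)]; congr 1; ring
      simp [this, ha']
    · intro θ _
      have h0 : HasDerivAt (fun θ : ℝ => (r : ℂ) * bpt θ) (r * (Complex.I * bpt θ)) θ :=
        (hasDerivAt_bpt θ).const_mul _
      have h1 : HasDerivAt (fun θ : ℝ => g (r * bpt θ)) (D (r * bpt θ) (r * (Complex.I * bpt θ))) θ :=
        (hDA _ (smul_bpt_mem_odisc hr.1.le hr.2 θ)).comp_hasDerivAt θ h0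
      have := (hda' θ).mul h1
      have e : (r : ℂ) * (Complex.I * bpt θ) = r • (Complex.I * bpt θ) :=
        (Complex.real_smul ..).symm
      refine this.congr_deriv ?_
      rw [e, map_smul]
      simp only [hB, smul_eq_mul]
    · exact hcB.intervalIntegrable _ _
  rw [odisc, integral_ball_polar]
  simp_rw [hAB]
  rw [Measure.volume_eq_prod, integral_add (hint A hAc) (hint B hBc),
    setIntegral_prod _ (hint B hBc), ← Measure.prod_restrict,
    integral_prod_symm _ (by rw [Measure.prod_restrict]; exact hint A hAc),
    setIntegral_congr_fun measurableSet_Ioo hIA, setIntegral_congr_fun measurableSet_Ioo hIB,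
    circInt_eq, intervalIntegral.integral_of_le hpi, integral_Ioc_eq_integral_Ioo]
  simp only [integral_zero, add_zero]
  refine setIntegral_congr_fun measurableSet_Ioo fun θ _ => ?_
  simp only [bpt_re, bpt_im, ha]
  ring

/-- Green's identity on the disc. -/
lemma green_disc {v w : ℂ → ℝ} (hv : ContDiffOn ℝ 1 v cdisc) (hw : ContDiffOn ℝ 2 w cdisc) :
    ∫ z in odisc, (fderivWithin ℝ v cdisc z 1 * fderivWithin ℝ w cdisc z 1 +
      fderivWithin ℝ v cdisc z Complex.I * fderivWithin ℝ w cdisc z Complex.I + v z * lapW w z)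
      = circInt fun z => v z * nder w z := by
  have hd : ∀ e : ℂ, ContDiffOn ℝ 1 (fun z => fderivWithin ℝ w cdisc z e) cdisc := fun e =>
    (hw.fderivWithin uniqueDiffOn_cdisc (m := 1) (by norm_num)).clm_apply contDiffOn_const
  have hp : ∀ e : ℂ, ContDiffOn ℝ 1 (fun z => v z * fderivWithin ℝ w cdisc z e) cdisc := fun e =>
    hv.mul (hd e)
  have hprod : ∀ e : ℂ, ∀ z ∈ odisc,
      fderivWithin ℝ (fun z => v z * fderivWithin ℝ w cdisc z e) cdisc z e =
      fderivWithin ℝ v cdisc z e * fderivWithin ℝ w cdisc z e +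
        v z * fderivWithin ℝ (fun z => fderivWithin ℝ w cdisc z e) cdisc z e := fun e z hz => by
    have hz' := odisc_subset_cdisc hz
    rw [fderivWithin_fun_mul (uniqueDiffOn_cdisc z hz') (hv.differentiableOn one_ne_zero z hz')
      ((hd e).differentiableOn one_ne_zero z hz')]
    simp; ring
  have h1 := integral_dir_eq (hp 1) 1
  have h2 := integral_dir_eq (hp Complex.I) Complex.I
  have hi : ∀ e : ℂ, IntegrableOn
      (fun z => fderivWithin ℝ (fun z => v z * fderivWithin ℝ w cdisc z e) cdisc z e) odisc :=
    fun e => integrableOn_odisc (continuousOn_dir (hp e) e)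
  have hcirc : ∀ φ : ℂ → ℝ, ContinuousOn φ cdisc →
      IntervalIntegrable (fun θ => φ (bpt θ)) volume 0 (2 * π) := fun φ hφ =>
    (hφ.comp_continuous continuous_bpt bpt_mem_cdisc).intervalIntegrable _ _
  have hre : ContinuousOn (fun z : ℂ => z.re) cdisc := Complex.continuous_re.continuousOn
  have him : ContinuousOn (fun z : ℂ => z.im) cdisc := Complex.continuous_im.continuousOn
  calc _ = ∫ z in odisc, (fderivWithin ℝ (fun z => v z * fderivWithin ℝ w cdisc z 1) cdisc z 1 +
      fderivWithin ℝ (fun z => v z * fderivWithin ℝ w cdisc z Complex.I) cdisc z Complex.I) := by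
        refine setIntegral_congr_fun measurableSet_ball fun z hz => ?_
        simp only [hprod 1 z hz, hprod Complex.I z hz, lapW]
        ring
    _ = _ := by
        rw [integral_add (hi 1) (hi Complex.I), h1, h2, circInt, circInt, circInt,
          ← intervalIntegral.integral_add]
        · refine intervalIntegral.integral_congr fun θ _ => ?_
          simp only [nder]
          have : fderivWithin ℝ w cdisc (bpt θ) (bpt θ) =
              Real.cos θ * fderivWithin ℝ w cdisc (bpt θ) 1 +
              Real.sin θ * fderivWithin ℝ w cdisc (bpt θ) Complex.I := by
            have e : bpt θ = (Real.cos θ) • (1 : ℂ) + (Real.sin θ) • Complex.I := by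
              rw [bpt_eq]; simp
            conv_lhs => arg 2; rw [e]
            rw [map_add, map_smul, map_smul]; simp
          rw [this]
          simp [bpt_re, bpt_im]; ring
        · exact hcirc (fun z => v z * fderivWithin ℝ w cdisc z 1 *
              ((1 : ℂ).re * z.re + (1 : ℂ).im * z.im))
            ((hp 1).continuousOn.mul ((continuousOn_const.mul hre).add
              (continuousOn_const.mul him)))
        · exact hcirc (fun z => v z * fderivWithin ℝ w cdisc z Complex.I *
              (Complex.I.re * z.re + Complex.I.im * z.im))
            ((hp Complex.I).continuousOn.mul ((continuousOn_const.mul hre).add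
              (continuousOn_const.mul him)))

/-- The `n`-th Taylor coefficient at the origin. -/
def tc (g : ℂ → ℂ) (n : ℕ) : ℂ := iteratedDeriv n g 0 / (n.factorial : ℂ)

lemma hasSum_tc {g : ℂ → ℂ} (hg : Differentiable ℂ g) (z : ℂ) :
    HasSum (fun n => tc g n * z ^ n) (g z) := by
  have := Complex.hasSum_taylorSeries_of_entire hg 0 z
  refine this.congr_fun fun n => ?_
  simp only [tc, smul_eq_mul, sub_zero]
  ring

lemma summable_norm_tc {g : ℂ → ℂ} (hg : Differentiable ℂ g) (r : ℝ) :
    Summable fun n => ‖tc g n‖ * |r| ^ n := by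
  have := (hasSum_tc hg r).summable.norm
  simpa [norm_mul, norm_pow] using this

lemma tc_mul {f g : ℂ → ℂ} (hf : Differentiable ℂ f) (hg : Differentiable ℂ g) (n : ℕ) :
    tc (fun z => f z * g z) n = ∑ i ∈ Finset.range (n + 1), tc f i * tc g (n - i) := by
  simp only [tc]
  rw [iteratedDeriv_fun_mul hf.contDiff.contDiffAt hg.contDiff.contDiffAt, Finset.sum_div]
  refine Finset.sum_congr rfl fun i hi => ?_
  have hi' : i ≤ n := Nat.lt_succ_iff.1 (Finset.mem_range.1 hi)
  have h1 : (n.choose i : ℂ) * i.factorial * (n - i).factorial = n.factorial := by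
    exact_mod_cast Nat.choose_mul_factorial_mul_factorial hi'
  have h2 : (i.factorial : ℂ) ≠ 0 := by exact_mod_cast i.factorial_ne_zero
  have h3 : ((n - i).factorial : ℂ) ≠ 0 := by exact_mod_cast (n - i).factorial_ne_zero
  have h4 : (n.factorial : ℂ) ≠ 0 := by exact_mod_cast n.factorial_ne_zero
  rw [div_mul_div_comm, div_eq_div_iff h4 (mul_ne_zero h2 h3), ← h1]
  ring

lemma tc_deriv (g : ℂ → ℂ) (n : ℕ) : tc (deriv g) n = (n + 1) * tc g (n + 1) := by
  simp only [tc]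
  rw [← iteratedDeriv_succ', Nat.factorial_succ]
  have h4 : (n.factorial : ℂ) ≠ 0 := by exact_mod_cast n.factorial_ne_zero
  have h5 : (n : ℂ) + 1 ≠ 0 := by exact_mod_cast n.succ_ne_zero
  push_cast
  field_simp

lemma tc_zero (g : ℂ → ℂ) : tc g 0 = g 0 := by simp [tc]

/-- A polynomial vanishing at the origin, given by its coefficients. -/
def pol (c : ℕ → ℂ) (N : ℕ) (z : ℂ) : ℂ := ∑ k ∈ Finset.range N, c k * z ^ (k + 1)

lemma differentiable_pol (c : ℕ → ℂ) (N : ℕ) : Differentiable ℂ (pol c N) := by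
  unfold pol; fun_prop

lemma pol_zero (c : ℕ → ℂ) (N : ℕ) : pol c N 0 = 0 := by simp [pol]

lemma tc_pol (c : ℕ → ℂ) (N n : ℕ) : tc (pol c N) (n + 1) = if n < N then c n else 0 := by
  have : tc (pol c N) (n + 1) = ∑ k ∈ Finset.range N, if k = n then c k else 0 := by
    simp only [tc]
    unfold pol
    rw [iteratedDeriv_fun_sum (fun i _ => by fun_prop), Finset.sum_div]
    refine Finset.sum_congr rfl fun k _ => ?_
    rw [iteratedDeriv_const_mul_field]
    rw [iteratedDeriv_fun_pow_zero]
    have h4 : ((n + 1).factorial : ℂ) ≠ 0 := by exact_mod_cast (n + 1).factorial_ne_zero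
    by_cases h : k = n
    · subst h; simp [h4]
    · have : n ≠ k := fun h' => h h'.symm
      simp [h, this]
  rw [this, Finset.sum_ite_eq']
  simp

lemma hasSum_circle_integral {G : ℕ → ℝ → ℂ} {b : ℕ → ℝ} (hG : ∀ n, Continuous (G n))
    (hb : Summable b) (hGb : ∀ n θ, ‖G n θ‖ ≤ b n) :
    HasSum (fun n => ∫ θ in (-π)..π, G n θ) (∫ θ in (-π)..π, ∑' n, G n θ) := by
  refine intervalIntegral.hasSum_integral_of_dominated_convergence (fun n _ => b n)
    (fun n => (hG n).aestronglyMeasurable) (fun n => .of_forall fun θ _ => hGb n θ)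
    (.of_forall fun _ _ => hb) intervalIntegrable_const
    (.of_forall fun θ _ => (Summable.of_norm_bounded hb (hGb · θ)).hasSum)

lemma conj_bpt (θ : ℝ) : (starRingEnd ℂ) (bpt θ) = bpt (-θ) := by
  simp only [bpt, ← Complex.exp_conj, map_mul, Complex.conj_ofReal, Complex.conj_I]
  push_cast; ring_nf

lemma integral_bpt_pow_mul_conj (n m : ℕ) :
    ∫ θ in (-π)..π, bpt θ ^ n * (starRingEnd ℂ) (bpt θ ^ m) = if n = m then 2 * (π : ℂ) else 0 := by
  have h : ∀ θ : ℝ, bpt θ ^ n * (starRingEnd ℂ) (bpt θ ^ m)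
      = Complex.exp ((((n : ℂ) - m) * Complex.I) * θ) := fun θ => by
    rw [map_pow, conj_bpt]
    simp only [bpt, ← Complex.exp_nat_mul, ← Complex.exp_add]
    push_cast; ring_nf
  simp_rw [h]
  split_ifs with hnm
  · subst hnm; simp; ring
  · have hne : ((n : ℂ) - m) * Complex.I ≠ 0 :=
      mul_ne_zero (sub_ne_zero.2 (by exact_mod_cast hnm)) Complex.I_ne_zero
    rw [integral_exp_mul_complex hne]
    have : Complex.exp ((((n : ℂ) - m) * Complex.I) * (π : ℝ)) =
        Complex.exp ((((n : ℂ) - m) * Complex.I) * ((-π : ℝ) : ℝ)) := by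
      rw [Complex.exp_eq_exp_iff_exists_int]
      exact ⟨(n : ℤ) - m, by push_cast; ring⟩
    rw [this, sub_self, zero_div]

/-- Parseval's identity for absolutely convergent one-sided series. -/
lemma parseval {x : ℕ → ℂ} (hx : Summable fun n => ‖x n‖) :
    ∫ θ in (-π)..π, ‖∑' n, x n * bpt θ ^ n‖ ^ 2 = 2 * π * ∑' n, ‖x n‖ ^ 2 := by
  set F : ℝ → ℂ := fun θ => ∑' n, x n * bpt θ ^ n with hF
  have hbd : ∀ n θ, ‖x n * bpt θ ^ n‖ ≤ ‖x n‖ := fun n θ => by simp [norm_bpt]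
  have hFc : Continuous F := continuous_tsum
    (fun n => continuous_const.mul (continuous_bpt.pow n)) hx hbd
  have hFb : ∀ θ, ‖F θ‖ ≤ ∑' n, ‖x n‖ := fun θ => tsum_of_norm_bounded hx.hasSum (hbd · θ)
  have hconj : Continuous fun z : ℂ => (starRingEnd ℂ) z := Complex.continuous_conj
  have hcoef : ∀ m, ∫ θ in (-π)..π, F θ * (starRingEnd ℂ) (bpt θ ^ m) = 2 * π * x m := fun m => by
    have h1 := hasSum_circle_integral (G := fun n θ => x n * bpt θ ^ n * (starRingEnd ℂ) (bpt θ ^ m))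
      (fun n => (continuous_const.mul (continuous_bpt.pow n)).mul (hconj.comp (continuous_bpt.pow m)))
      hx (fun n θ => by simp [norm_bpt])
    simp_rw [tsum_mul_right, mul_assoc, intervalIntegral.integral_const_mul,
      integral_bpt_pow_mul_conj] at h1
    have h2 := hasSum_ite_eq m (x m * (2 * π))
    have h3 := h1.unique (h2.congr_fun fun n => by
      by_cases h : n = m
      · subst h; simp
      · simp [h])
    simp only [hF]
    rw [h3]; ring
  have h1 := hasSum_circle_integral (G := fun n θ => F θ * (starRingEnd ℂ) (x n * bpt θ ^ n))
    (b := fun n => (∑' n, ‖x n‖) * ‖x n‖)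
    (fun n => hFc.mul (hconj.comp (continuous_const.mul (continuous_bpt.pow n))))
    (hx.mul_left _) (fun n θ => by
      rw [norm_mul, RCLike.norm_conj]
      exact mul_le_mul (hFb θ) (hbd n θ) (norm_nonneg _) (tsum_nonneg fun _ => norm_nonneg _))
  have h2 : ∀ θ, ∑' n, F θ * (starRingEnd ℂ) (x n * bpt θ ^ n) = ((‖F θ‖ ^ 2 : ℝ) : ℂ) := fun θ => by
    rw [tsum_mul_left, ← Complex.conj_tsum]
    have := Complex.mul_conj' (F θ)
    rw [this]; push_cast; rfl
  have h3 : ∀ n, ∫ θ in (-π)..π, F θ * (starRingEnd ℂ) (x n * bpt θ ^ n) =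
      ((2 * π * ‖x n‖ ^ 2 : ℝ) : ℂ) := fun n => by
    have : ∀ θ, F θ * (starRingEnd ℂ) (x n * bpt θ ^ n) =
        (starRingEnd ℂ) (x n) * (F θ * (starRingEnd ℂ) (bpt θ ^ n)) := fun θ => by
      rw [map_mul]; ring
    simp_rw [this]
    rw [intervalIntegral.integral_const_mul, hcoef]
    have := Complex.mul_conj' (x n)
    push_cast
    rw [← this]; ring
  simp_rw [h2, h3] at h1
  rw [intervalIntegral.integral_ofReal] at h1
  have h4 := (Complex.hasSum_ofReal.1 h1).tsum_eq
  rw [← h4, tsum_mul_left]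

lemma summable_sq_tc {g : ℂ → ℂ} (hg : Differentiable ℂ g) (r : ℝ) :
    Summable fun n => ‖tc g n‖ ^ 2 * (r ^ 2) ^ n := by
  have h := summable_norm_tc hg r
  have := h.mul_of_nonneg h (fun n => by positivity) (fun n => by positivity)
  have h2 := (this.comp_injective (i := fun n : ℕ => (n, n)) (fun a b hab => (Prod.ext_iff.1 hab).1))
  refine h2.congr fun n => ?_
  simp only [Function.comp]
  have : |r| ^ n * |r| ^ n = (r ^ 2) ^ n := by rw [← mul_pow, ← sq, sq_abs]
  rw [← this]; ring

lemma parseval_entire {g : ℂ → ℂ} (hg : Differentiable ℂ g) (r : ℝ) :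
    ∫ θ in (-π)..π, ‖g (r * bpt θ)‖ ^ 2 = 2 * π * ∑' n, ‖tc g n‖ ^ 2 * (r ^ 2) ^ n := by
  have hs : Summable fun n => ‖tc g n * (r : ℂ) ^ n‖ := by
    simpa [norm_mul, norm_pow] using summable_norm_tc hg r
  have := parseval hs
  have e1 : ∀ θ : ℝ, ∑' n, tc g n * (r : ℂ) ^ n * bpt θ ^ n = g (r * bpt θ) := fun θ => by
    rw [← (hasSum_tc hg (r * bpt θ)).tsum_eq]
    simp_rw [mul_pow, mul_assoc]
  have e2 : ∀ n, ‖tc g n * (r : ℂ) ^ n‖ ^ 2 = ‖tc g n‖ ^ 2 * (r ^ 2) ^ n := fun n => by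
    rw [norm_mul, norm_pow, mul_pow, Complex.norm_real, Real.norm_eq_abs, ← pow_mul,
      mul_comm n 2, pow_mul, sq_abs]
  simpa only [e1, e2] using this

lemma tc_exp_succ {p : ℂ → ℂ} (hp : Differentiable ℂ p) (n : ℕ) :
    ((n : ℂ) + 1) * tc (fun z => Complex.exp (p z)) (n + 1) =
      ∑ i ∈ Finset.range (n + 1), ((i : ℂ) + 1) * tc p (i + 1) *
        tc (fun z => Complex.exp (p z)) (n - i) := by
  have hd : Differentiable ℂ (deriv p) := hp.deriv
  have he : Differentiable ℂ fun z => Complex.exp (p z) := hp.cexp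
  have : deriv (fun z => Complex.exp (p z)) = fun z => deriv p z * Complex.exp (p z) := by
    ext z
    rw [((hp z).hasDerivAt.cexp).deriv, mul_comm]
  rw [← tc_deriv, this, tc_mul hd he]
  simp_rw [tc_deriv]

/-- The coefficients of `(1 - z) ^ (-1/2)`. -/
def om : ℕ → ℝ
  | 0 => 1
  | n + 1 => om n * (n + 1 / 2) / (n + 1)

lemma om_pos : ∀ n, 0 < om n
  | 0 => by simp [om]
  | n + 1 => by have := om_pos n; rw [om]; positivity

lemma om_sum (n : ℕ) : ∑ i ∈ Finset.range n, om i = 2 * n * om n := by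
  induction n with
  | zero => simp
  | succ n ih =>
    rw [Finset.sum_range_succ, ih, om]
    push_cast
    field_simp

lemma coeff_majorant {b q : ℕ → ℂ} {d : ℕ → ℝ} (hb0 : ‖b 0‖ ≤ 1) (hd0 : d 0 = 1)
    (hb : ∀ n : ℕ, ((n : ℂ) + 1) * b (n + 1) =
      ∑ i ∈ Finset.range (n + 1), ((i : ℂ) + 1) * q i * b (n - i))
    (hd : ∀ n : ℕ, ((n : ℝ) + 1) * d (n + 1) =
      ∑ i ∈ Finset.range (n + 1), 2 * ((i : ℝ) + 1) ^ 2 * ‖q i‖ ^ 2 * d (n - i)) (n : ℕ) :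
    0 ≤ d n ∧ ‖b n‖ ^ 2 ≤ om n * d n := by
  induction n using Nat.strong_induction_on with
  | _ n ih =>
    rcases n with _ | n
    · rw [hd0, om]; exact ⟨zero_le_one, by nlinarith [norm_nonneg (b 0)]⟩
    have hn : (0 : ℝ) < n + 1 := by positivity
    have ih' : ∀ i ∈ Finset.range (n + 1), 0 ≤ d (n - i) ∧ ‖b (n - i)‖ ^ 2 ≤ om (n - i) * d (n - i) :=
      fun i _ => ih (n - i) (by omega)
    have hdn : 0 ≤ ((n : ℝ) + 1) * d (n + 1) := by
      rw [hd n]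
      exact Finset.sum_nonneg fun i hi => mul_nonneg (by positivity) (ih' i hi).1
    refine ⟨nonneg_of_mul_nonneg_right hdn hn, ?_⟩
    have h1 : (n + 1 : ℝ) * ‖b (n + 1)‖ ≤
        ∑ i ∈ Finset.range (n + 1), √(om (n - i)) * ((i + 1) * ‖q i‖ * √(d (n - i))) := by
      have : ‖((n : ℂ) + 1) * b (n + 1)‖ = (n + 1 : ℝ) * ‖b (n + 1)‖ := by
        rw [norm_mul]; congr 1
        exact_mod_cast Complex.norm_natCast (n + 1)
      rw [← this, hb n]
      refine (norm_sum_le _ _).trans (Finset.sum_le_sum fun i hi => ?_)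
      have e : ‖((i : ℂ) + 1)‖ = (i : ℝ) + 1 := by exact_mod_cast Complex.norm_natCast (i + 1)
      rw [norm_mul, norm_mul, e]
      have h2 : ‖b (n - i)‖ ≤ √(om (n - i)) * √(d (n - i)) := by
        rw [← Real.sqrt_mul (om_pos _).le]
        exact Real.le_sqrt_of_sq_le (ih' i hi).2
      calc _ ≤ ((i : ℝ) + 1) * ‖q i‖ * (√(om (n - i)) * √(d (n - i))) := by gcongr
        _ = _ := by ring
    have h2 := Finset.sum_mul_sq_le_sq_mul_sq (Finset.range (n + 1)) (fun i => √(om (n - i)))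
      (fun i => (i + 1) * ‖q i‖ * √(d (n - i)))
    have h3 : ∑ i ∈ Finset.range (n + 1), √(om (n - i)) ^ 2 = 2 * (n + 1) * om (n + 1) := by
      have := om_sum (n + 1)
      push_cast at this
      rw [← this, ← Finset.sum_range_reflect]
      refine Finset.sum_congr rfl fun i hi => ?_
      rw [Real.sq_sqrt (om_pos _).le]
      have := Finset.mem_range.1 hi
      congr 1; omega
    have h4 : ∑ i ∈ Finset.range (n + 1), (((i : ℝ) + 1) * ‖q i‖ * √(d (n - i))) ^ 2 =
        (n + 1) * d (n + 1) / 2 := by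
      rw [hd n, Finset.sum_div]
      refine Finset.sum_congr rfl fun i hi => ?_
      rw [mul_pow, Real.sq_sqrt (ih' i hi).1]; ring
    rw [h3, h4] at h2
    have h5 := (pow_le_pow_left₀ (by positivity) h1 2).trans h2
    have h6 : (n + 1 : ℝ) ^ 2 * ‖b (n + 1)‖ ^ 2 ≤ (n + 1) ^ 2 * (om (n + 1) * d (n + 1)) := by
      calc _ = ((n + 1 : ℝ) * ‖b (n + 1)‖) ^ 2 := by ring
        _ ≤ _ := h5
        _ = _ := by ring
    exact le_of_mul_le_mul_left h6 (by positivity)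

lemma lebedev_milin (c : ℕ → ℂ) (N : ℕ) :
    ∃ d : ℕ → ℝ, (∀ n, 0 ≤ d n ∧ ‖tc (fun z => Complex.exp (pol c N z)) n‖ ^ 2 ≤ om n * d n) ∧
      HasSum d (Real.exp (2 * ∑ k ∈ Finset.range N, ((k : ℝ) + 1) * ‖c k‖ ^ 2)) := by
  set c2 : ℕ → ℂ := fun k => ((2 * ((k : ℝ) + 1) * ‖c k‖ ^ 2 : ℝ) : ℂ) with hc2
  have hp := differentiable_pol c N
  have hp2 := differentiable_pol c2 N
  refine ⟨fun n => (tc (fun z => Complex.exp (pol c2 N z)) n).re, ?_, ?_⟩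
  · refine coeff_majorant (q := fun i => tc (pol c N) (i + 1)) ?_ ?_ (tc_exp_succ hp) ?_
    · simp [tc_zero, pol_zero]
    · simp [tc_zero, pol_zero]
    · intro n
      have := congrArg Complex.re (tc_exp_succ hp2 n)
      have e : ((n : ℂ) + 1) = (((n : ℝ) + 1 : ℝ) : ℂ) := by push_cast; rfl
      rw [e, Complex.re_ofReal_mul] at this
      rw [this, Complex.re_sum]
      refine Finset.sum_congr rfl fun i _ => ?_
      have e2 : ((i : ℂ) + 1) * tc (pol c2 N) (i + 1) =
          ((2 * ((i : ℝ) + 1) ^ 2 * ‖tc (pol c N) (i + 1)‖ ^ 2 : ℝ) : ℂ) := by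
        rw [tc_pol, tc_pol]
        split_ifs
        · simp only [hc2]; push_cast; ring
        · simp
      rw [e2, Complex.re_ofReal_mul]
  · have := Complex.hasSum_re (hasSum_tc hp2.cexp 1)
    simp only [one_pow, mul_one] at this
    convert this using 1
    have : pol c2 N 1 = ((2 * ∑ k ∈ Finset.range N, ((k : ℝ) + 1) * ‖c k‖ ^ 2 : ℝ) : ℂ) := by
      simp only [pol, hc2, one_pow, mul_one, Finset.mul_sum]
      push_cast
      exact Finset.sum_congr rfl fun _ _ => by ring
    rw [this, Complex.exp_ofReal_re]

/-- `∫₀¹ tⁿ √(1 - t) dt`. -/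
def betaHalf (n : ℕ) : ℝ := 1 / (om (n + 1) * (n + 1) * (2 * n + 3))

lemma integral_betaHalf (n : ℕ) : ∫ t in (0:ℝ)..1, t ^ n * √(1 - t) = betaHalf n := by
  have hcs : Continuous fun t : ℝ => √(1 - t) := by fun_prop
  have hd : ∀ t ∈ Ioo (0:ℝ) 1, HasDerivAt (fun t : ℝ => (1 - t) * √(1 - t)) (-(3/2) * √(1 - t)) t := by
    intro t ht
    have h0 : (0:ℝ) < 1 - t := by linarith [ht.2]
    have h1 : HasDerivAt (fun t : ℝ => 1 - t) (-1) t := by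
      simpa using (hasDerivAt_id t).const_sub 1
    refine (h1.mul (h1.sqrt h0.ne')).congr_deriv ?_
    have h2 : √(1 - t) ≠ 0 := (Real.sqrt_pos.2 h0).ne'
    field_simp
    have := Real.sq_sqrt h0.le
    rw [this]; ring
  induction n with
  | zero =>
    rw [intervalIntegral.integral_eq_sub_of_hasDerivAt_of_le
      (f := fun t : ℝ => -(2/3) * ((1 - t) * √(1 - t))) zero_le_one]
    · simp [betaHalf, om]; norm_num
    · fun_prop
    · intro t ht
      exact ((hd t ht).const_mul _).congr_deriv (by simp; ring)
    · exact (by fun_prop : Continuous fun t : ℝ => t ^ 0 * √(1 - t)).intervalIntegrable _ _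
  | succ n ih =>
    have hi : ∀ m, IntervalIntegrable (fun t : ℝ => t ^ m * √(1 - t)) volume 0 1 := fun m =>
      (by fun_prop : Continuous fun t : ℝ => t ^ m * √(1 - t)).intervalIntegrable _ _
    have h := intervalIntegral.integral_eq_sub_of_hasDerivAt_of_le
      (f := fun t : ℝ => t ^ (n + 1) * ((1 - t) * √(1 - t)))
      (f' := fun t => (n + 1) * (t ^ n * √(1 - t)) - (n + 5 / 2) * (t ^ (n + 1) * √(1 - t)))
      zero_le_one (by fun_prop) (fun t ht => by
        refine ((hasDerivAt_pow (n + 1) t).mul (hd t ht)).congr_deriv ?_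
        simp only [Nat.add_sub_cancel]; push_cast; ring)
      (((hi n).const_mul _).sub ((hi (n + 1)).const_mul _))
    rw [intervalIntegral.integral_sub ((hi n).const_mul _) ((hi (n + 1)).const_mul _),
      intervalIntegral.integral_const_mul, intervalIntegral.integral_const_mul, ih] at h
    simp only [betaHalf] at h ⊢
    have h1 := om_pos (n + 1)
    have h2 : om (n + 1 + 1) = om (n + 1) * (n + 3 / 2) / (n + 2) := by
      rw [om]; push_cast; ring
    rw [h2]
    set J := ∫ t in (0:ℝ)..1, t ^ (n + 1) * √(1 - t)
    have h3 : (n + 5 / 2 : ℝ) * J = (n + 1) * (1 / (om (n + 1) * (n + 1) * (2 * n + 3))) := by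
      have e : (1:ℝ) ^ (n + 1) * ((1 - 1) * √(1 - 1)) - 0 ^ (n + 1) * ((1 - 0) * √(1 - 0)) = 0 := by
        simp
      rw [e] at h
      linarith
    have h4 : J = ((n + 1) * (1 / (om (n + 1) * (n + 1) * (2 * n + 3)))) / (n + 5 / 2) := by
      rw [← h3]; field_simp
    rw [h4]; push_cast; field_simp; ring

lemma sq_mul_betaHalf_le (n : ℕ) : (n + 1 : ℝ) ^ 2 * betaHalf n * om (n + 1) ≤ 1 / 2 := by
  have h1 := om_pos (n + 1)
  have : (n + 1 : ℝ) ^ 2 * betaHalf n * om (n + 1) = (n + 1) / (2 * n + 3) := by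
    simp only [betaHalf]; field_simp
  rw [this, div_le_iff₀ (by positivity)]
  linarith

lemma hasSum_integral_unit {F : ℕ → ℝ → ℝ} {b : ℕ → ℝ} (hF : ∀ n, Continuous (F n))
    (hb : Summable b) (hFb : ∀ n, ∀ t ∈ Icc (0:ℝ) 1, ‖F n t‖ ≤ b n) :
    HasSum (fun n => ∫ t in (0:ℝ)..1, F n t) (∫ t in (0:ℝ)..1, ∑' n, F n t) := by
  have hsub : ∀ t, t ∈ uIoc (0:ℝ) 1 → t ∈ Icc (0:ℝ) 1 := fun t ht => by
    rw [uIoc_of_le zero_le_one] at ht; exact ⟨ht.1.le, ht.2⟩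
  exact intervalIntegral.hasSum_integral_of_dominated_convergence (fun n _ => b n)
    (fun n => (hF n).aestronglyMeasurable) (fun n => .of_forall fun θ h => hFb n θ (hsub θ h))
    (.of_forall fun _ _ => hb) intervalIntegrable_const
    (.of_forall fun θ h => (Summable.of_norm_bounded hb (hFb · θ (hsub θ h))).hasSum)

lemma sum_sq_tc_le_of_sup {c : ℕ → ℂ} {N : ℕ} {S : ℝ}
    (hS : ∀ z : ℂ, ‖z‖ < 1 → (1 - ‖z‖ ^ 2) * ‖Complex.exp (pol c N z)‖ ^ 2 ≤ S) :
    ∑' n, ‖tc (fun z => Complex.exp (pol c N z)) n‖ ^ 2 ≤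
      5 * √S * Real.exp ((∑ k ∈ Finset.range N, ((k : ℝ) + 1) * ‖c k‖ ^ 2) / 2) := by
  set E := Real.exp ((∑ k ∈ Finset.range N, ((k : ℝ) + 1) * ‖c k‖ ^ 2) / 2) with hE
  set φ : ℂ → ℂ := fun z => Complex.exp (pol c N z) with hφ
  set ψ : ℂ → ℂ := fun z => Complex.exp (pol (fun k => c k / 2) N z) with hψ
  have hφd : Differentiable ℂ φ := (differentiable_pol c N).cexp
  have hψd : Differentiable ℂ ψ := (differentiable_pol _ N).cexp
  have hS1 : 1 ≤ S := by simpa [pol_zero] using hS 0 (by simp)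
  have hσ1 : 1 ≤ √S := by rw [← Real.sqrt_one]; exact Real.sqrt_le_sqrt hS1
  have hE1 : 1 ≤ E := Real.one_le_exp (by positivity)
  have hφψ : ∀ z, φ z = ψ z * ψ z := fun z => by
    simp only [hφ, hψ, ← Complex.exp_add]
    congr 1
    simp only [pol, ← Finset.sum_add_distrib]
    exact Finset.sum_congr rfl fun _ _ => by ring
  have hdφ : ∀ z, deriv φ z = 2 * (ψ z * deriv ψ z) := fun z => by
    have : φ = fun z => ψ z * ψ z := funext hφψ
    rw [this, deriv_fun_mul (hψd z) (hψd z)]; ring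
  obtain ⟨d, hd, hds⟩ := lebedev_milin (fun k => c k / 2) N
  have hEd : Real.exp (2 * ∑ k ∈ Finset.range N, ((k : ℝ) + 1) * ‖c k / 2‖ ^ 2) = E := by
    rw [hE, Finset.mul_sum, Finset.sum_div]
    congr 1
    refine Finset.sum_congr rfl fun k _ => ?_
    rw [norm_div]; simp; ring
  rw [hEd] at hds
  set x : ℕ → ℝ := fun n => ‖tc (deriv φ) n‖ ^ 2 with hx
  set y : ℕ → ℝ := fun n => ‖tc (deriv ψ) n‖ ^ 2 with hy
  have hxs : ∀ t, 0 ≤ t → Summable fun n => x n * t ^ n := fun t ht => by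
    simpa [Real.sq_sqrt ht] using summable_sq_tc hφd.deriv (√t)
  have hys : ∀ t, 0 ≤ t → Summable fun n => y n * t ^ n := fun t ht => by
    simpa [Real.sq_sqrt ht] using summable_sq_tc hψd.deriv (√t)
  have hc1 : Continuous ψ := hψd.continuous
  have hc2 : Continuous (deriv ψ) := hψd.deriv.continuous
  have hmean : ∀ t ∈ Ioo (0:ℝ) 1, (1 - t) * ∑' n, x n * t ^ n ≤
      4 * √S * ∑' n, y n * (t ^ n * √(1 - t)) := by
    intro t ht
    have hp1 := parseval_entire hφd.deriv (√t)
    have hp2 := parseval_entire hψd.deriv (√t)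
    rw [Real.sq_sqrt ht.1.le] at hp1 hp2
    have h1t : 0 < 1 - t := by linarith [ht.2]
    have hpt : ∀ θ, √(1 - t) * ‖deriv φ (√t * bpt θ)‖ ^ 2 ≤
        4 * √S * ‖deriv ψ (√t * bpt θ)‖ ^ 2 := fun θ => by
      have hn : ‖(√t : ℂ) * bpt θ‖ ^ 2 = t := by
        rw [norm_mul, norm_bpt, mul_one, Complex.norm_real, Real.norm_eq_abs, sq_abs,
          Real.sq_sqrt ht.1.le]
      have hS' := hS (√t * bpt θ) (by
        by_contra h
        push Not at h
        have := pow_le_pow_left₀ zero_le_one h 2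
        rw [hn] at this; linarith [ht.2])
      rw [hn] at hS'
      have h3 : √(1 - t) * ‖ψ (√t * bpt θ)‖ ^ 2 ≤ √S := by
        apply Real.le_sqrt_of_sq_le
        have : ‖φ (√t * bpt θ)‖ = ‖ψ (√t * bpt θ)‖ ^ 2 := by rw [hφψ, norm_mul, sq]
        rw [mul_pow, Real.sq_sqrt h1t.le, ← this]
        exact hS'
      rw [hdφ, norm_mul, norm_mul, mul_pow, mul_pow]
      simp only [Complex.norm_ofNat]
      nlinarith [mul_le_mul_of_nonneg_right h3 (sq_nonneg ‖deriv ψ (√t * bpt θ)‖)]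
    have hcr : Continuous fun θ : ℝ => (√t : ℂ) * bpt θ := continuous_const.mul continuous_bpt
    have hint : ∫ θ in (-π)..π, √(1 - t) * ‖deriv φ (√t * bpt θ)‖ ^ 2 ≤
        ∫ θ in (-π)..π, 4 * √S * ‖deriv ψ (√t * bpt θ)‖ ^ 2 := intervalIntegral.integral_mono (μ := volume) (a := -π) (b := π) (by linarith [Real.pi_pos])
      (Continuous.intervalIntegrable (continuous_const.mul
        ((hφd.deriv.continuous.comp hcr).norm.pow 2)) _ _)
      (Continuous.intervalIntegrable (continuous_const.mul
        ((hc2.comp hcr).norm.pow 2)) _ _) hpt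
    rw [intervalIntegral.integral_const_mul, intervalIntegral.integral_const_mul, hp1, hp2] at hint
    have hint2 : √(1 - t) * ∑' n, x n * t ^ n ≤ 4 * √S * ∑' n, y n * t ^ n := by
      have h2pi : 0 < 2 * π := by positivity
      refine le_of_mul_le_mul_left ?_ h2pi
      simp only [hx, hy]
      nlinarith [hint]
    have hsq : √(1 - t) * √(1 - t) = 1 - t := Real.mul_self_sqrt h1t.le
    calc (1 - t) * ∑' n, x n * t ^ n = √(1 - t) * (√(1 - t) * ∑' n, x n * t ^ n) := by
          rw [← mul_assoc, hsq]
      _ ≤ √(1 - t) * (4 * √S * ∑' n, y n * t ^ n) := by gcongr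
      _ = 4 * √S * ∑' n, y n * (t ^ n * √(1 - t)) := by
          simp_rw [← mul_assoc (y _), tsum_mul_right]; ring
  have hRsum := hasSum_integral_unit (F := fun n t => y n * (t ^ n * √(1 - t))) (b := y)
    (fun n => by fun_prop) (by simpa using hys 1 zero_le_one) (fun n t ht => by
      have h1 : √(1 - t) ≤ 1 := Real.sqrt_le_one.2 (by linarith [ht.1])
      have h2 : t ^ n ≤ 1 := pow_le_one₀ ht.1 ht.2
      have hy0 : 0 ≤ y n := by positivity
      have ht0 : 0 ≤ t ^ n := pow_nonneg ht.1 n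
      rw [Real.norm_of_nonneg (by positivity)]
      exact mul_le_of_le_one_right hy0 (mul_le_one₀ h2 (Real.sqrt_nonneg _) h1))
  simp_rw [intervalIntegral.integral_const_mul, integral_betaHalf] at hRsum
  have hRle : ∫ t in (0:ℝ)..1, ∑' n, y n * (t ^ n * √(1 - t)) ≤ E / 2 := by
    have hds1 : Summable fun n => d (n + 1) := (summable_nat_add_iff 1).2 hds.summable
    have hle : ∑' n, d (n + 1) ≤ E := by
      have := hds.summable.sum_add_tsum_nat_add 1
      rw [hds.tsum_eq] at this
      have h0 := (hd 0).1
      simp at this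
      linarith
    have hterm : ∀ n, y n * betaHalf n ≤ d (n + 1) / 2 := fun n => by
      have hb0 : 0 ≤ betaHalf n := by
        have := om_pos (n + 1); unfold betaHalf; positivity
      have e : y n = ((n : ℝ) + 1) ^ 2 * ‖tc ψ (n + 1)‖ ^ 2 := by
        simp only [hy]
        rw [tc_deriv, norm_mul, mul_pow]; congr 2
        exact_mod_cast Complex.norm_natCast (n + 1)
      rw [e]
      calc _ ≤ ((n : ℝ) + 1) ^ 2 * (om (n + 1) * d (n + 1)) * betaHalf n := by
            gcongr; exact (hd (n + 1)).2
        _ = ((n + 1 : ℝ) ^ 2 * betaHalf n * om (n + 1)) * d (n + 1) := by ring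
        _ ≤ 1 / 2 * d (n + 1) := by
            gcongr
            · exact (hd (n + 1)).1
            · exact sq_mul_betaHalf_le n
        _ = _ := by ring
    rw [← hRsum.tsum_eq]
    calc _ ≤ ∑' n, d (n + 1) / 2 := hRsum.summable.tsum_le_tsum hterm (hds1.div_const 2)
      _ = (∑' n, d (n + 1)) / 2 := tsum_div_const
      _ ≤ E / 2 := by linarith
  have hpart : ∀ M, ∑ n ∈ Finset.range M, ‖tc φ (n + 1)‖ ^ 2 ≤ 4 * √S * E := fun M => by
    have hcR : ContinuousOn (fun t : ℝ => ∑' n, y n * (t ^ n * √(1 - t))) (Icc 0 1) := by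
      refine continuousOn_tsum (u := y) (fun n => by fun_prop) (by simpa using hys 1 zero_le_one)
        (fun n t ht => ?_)
      have h1 : √(1 - t) ≤ 1 := Real.sqrt_le_one.2 (by linarith [ht.1])
      have h2 : t ^ n ≤ 1 := pow_le_one₀ ht.1 ht.2
      have hy0 : 0 ≤ y n := by positivity
      have ht0 : 0 ≤ t ^ n := pow_nonneg ht.1 n
      rw [Real.norm_of_nonneg (by positivity)]
      exact mul_le_of_le_one_right hy0 (mul_le_one₀ h2 (Real.sqrt_nonneg _) h1)
    have hI : ∀ n : ℕ, ∫ t in (0:ℝ)..1, (1 - t) * t ^ n = 1 / ((n + 1) * (n + 2)) := fun n => by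
      have : ∀ t : ℝ, (1 - t) * t ^ n = t ^ n - t ^ (n + 1) := fun t => by ring
      simp_rw [this]
      rw [intervalIntegral.integral_sub (by simp) (by simp), integral_pow, integral_pow]
      push_cast; simp; field_simp; ring
    have hle : ∫ t in (0:ℝ)..1, ∑ n ∈ Finset.range M, x n * ((1 - t) * t ^ n) ≤
        ∫ t in (0:ℝ)..1, 4 * √S * ∑' n, y n * (t ^ n * √(1 - t)) := by
      refine intervalIntegral.integral_mono_on_of_le_Ioo zero_le_one
        (Continuous.intervalIntegrable (by fun_prop) _ _)
        (ContinuousOn.intervalIntegrable (by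
          rw [uIcc_of_le zero_le_one]; exact continuousOn_const.mul hcR)) fun t ht => ?_
      refine le_trans ?_ (hmean t ht)
      have h1t : 0 ≤ 1 - t := by linarith [ht.2]
      calc ∑ n ∈ Finset.range M, x n * ((1 - t) * t ^ n)
          = (1 - t) * ∑ n ∈ Finset.range M, x n * t ^ n := by
            rw [Finset.mul_sum]; exact Finset.sum_congr rfl fun _ _ => by ring
        _ ≤ _ := by
            gcongr
            exact (hxs t ht.1.le).sum_le_tsum _ fun n _ => by
              have := pow_nonneg ht.1.le n; positivity
    rw [intervalIntegral.integral_finsetSum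
      (fun n _ => Continuous.intervalIntegrable (by fun_prop) _ _)] at hle
    simp_rw [intervalIntegral.integral_const_mul, hI] at hle
    have h5 : ∑ n ∈ Finset.range M, ‖tc φ (n + 1)‖ ^ 2 ≤
        2 * ∑ n ∈ Finset.range M, x n * (1 / (((n:ℝ) + 1) * (n + 2))) := by
      rw [Finset.mul_sum]
      refine Finset.sum_le_sum fun n _ => ?_
      have e : x n = ((n : ℝ) + 1) ^ 2 * ‖tc φ (n + 1)‖ ^ 2 := by
        simp only [hx]
        rw [tc_deriv, norm_mul, mul_pow]; congr 2
        exact_mod_cast Complex.norm_natCast (n + 1)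
      rw [e]
      have : 2 * (((n : ℝ) + 1) ^ 2 * ‖tc φ (n + 1)‖ ^ 2 * (1 / (((n:ℝ) + 1) * (n + 2)))) =
          (2 * (n + 1) / (n + 2)) * ‖tc φ (n + 1)‖ ^ 2 := by field_simp
      rw [this]
      refine le_mul_of_one_le_left (by positivity) ?_
      rw [le_div_iff₀ (by positivity)]
      linarith [(Nat.cast_nonneg n : (0:ℝ) ≤ n)]
    calc _ ≤ _ := h5
      _ ≤ 2 * (4 * √S * (E / 2)) := by
        have := mul_le_mul_of_nonneg_left hRle (by positivity : 0 ≤ 4 * √S)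
        linarith
      _ = _ := by ring
  have hsφ : Summable fun n => ‖tc φ n‖ ^ 2 := by simpa using summable_sq_tc hφd 1
  have hs1 : Summable fun n => ‖tc φ (n + 1)‖ ^ 2 := (summable_nat_add_iff 1).2 hsφ
  have h6 := hs1.tsum_le_of_sum_range_le hpart
  have h7 := hsφ.sum_add_tsum_nat_add 1
  have h8 : tc φ 0 = 1 := by simp [tc_zero, hφ, pol_zero]
  simp [h8] at h7
  rw [← h7]
  nlinarith [mul_le_mul hσ1 hE1 zero_le_one (by positivity)]

lemma norm_sq_mul_le_sum_sq_tc {φ : ℂ → ℂ} (hφ : Differentiable ℂ φ) {z : ℂ} (hz : ‖z‖ < 1) :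
    (1 - ‖z‖ ^ 2) * ‖φ z‖ ^ 2 ≤ ∑' n, ‖tc φ n‖ ^ 2 := by
  have hs : Summable fun n => ‖tc φ n‖ ^ 2 := by simpa using summable_sq_tc hφ 1
  have hz2 : ‖z‖ ^ 2 < 1 := by nlinarith [norm_nonneg z]
  have hg := hasSum_geometric_of_lt_one (sq_nonneg ‖z‖) hz2
  have h0 : 0 < 1 - ‖z‖ ^ 2 := by linarith
  have hM : ∀ M, ‖∑ n ∈ Finset.range M, tc φ n * z ^ n‖ ^ 2 ≤
      (∑' n, ‖tc φ n‖ ^ 2) * (1 - ‖z‖ ^ 2)⁻¹ := fun M => by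
    calc _ ≤ (∑ n ∈ Finset.range M, ‖tc φ n‖ * ‖z‖ ^ n) ^ 2 := by
          gcongr
          refine (norm_sum_le _ _).trans (Finset.sum_le_sum fun n _ => by simp)
      _ ≤ (∑ n ∈ Finset.range M, ‖tc φ n‖ ^ 2) * ∑ n ∈ Finset.range M, (‖z‖ ^ n) ^ 2 :=
          Finset.sum_mul_sq_le_sq_mul_sq _ _ _
      _ ≤ _ := by
          gcongr
          · exact hs.sum_le_tsum _ fun _ _ => by positivity
          · rw [← hg.tsum_eq]
            have : ∀ n, (‖z‖ ^ n) ^ 2 = (‖z‖ ^ 2) ^ n := fun n => by ring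
            simp_rw [this]
            exact hg.summable.sum_le_tsum _ fun _ _ => by positivity
  have ht := ((hasSum_tc hφ z).tendsto_sum_nat.norm.pow 2)
  have := le_of_tendsto' ht hM
  calc _ ≤ (1 - ‖z‖ ^ 2) * ((∑' n, ‖tc φ n‖ ^ 2) * (1 - ‖z‖ ^ 2)⁻¹) := by gcongr
    _ = _ := by field_simp

/-- The Bergman norm in terms of Taylor coefficients. -/
lemma hasSum_bergman {g : ℂ → ℂ} (hgd : Differentiable ℂ g) :
    HasSum (fun n : ℕ => π * ‖tc g n‖ ^ 2 / (n + 1)) (∫ z in odisc, ‖g z‖ ^ 2) := by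
  have hsg : Summable fun n => ‖tc g n‖ ^ 2 := by simpa using summable_sq_tc hgd 1
  have hgc : Continuous fun z => ‖g z‖ ^ 2 := hgd.continuous.norm.pow 2
  obtain ⟨C, _, hC⟩ := exists_bound_cdisc hgc.continuousOn
  have h1 : ∫ z in odisc, ‖g z‖ ^ 2 =
      ∫ r in (0:ℝ)..1, ∑' n, 2 * π * ‖tc g n‖ ^ 2 * r ^ (2 * n + 1) := by
    rw [odisc, integral_ball_polar_r hgc.continuousOn (C := C)
      (fun y hy => hC y (odisc_subset_cdisc hy)), ← integral_Ioc_eq_integral_Ioo,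
      ← intervalIntegral.integral_of_le zero_le_one]
    refine intervalIntegral.integral_congr fun r _ => ?_
    have := parseval_entire hgd r
    rw [integral_const_mul, ← integral_Ioc_eq_integral_Ioo,
      ← intervalIntegral.integral_of_le (by linarith [Real.pi_pos])]
    simp_rw [zero_add]
    rw [this, ← tsum_mul_left, ← tsum_mul_left]
    exact tsum_congr fun n => by ring
  have h2 := hasSum_integral_unit (F := fun n r => 2 * π * ‖tc g n‖ ^ 2 * r ^ (2 * n + 1))
    (b := fun n => 2 * π * ‖tc g n‖ ^ 2) (fun n => by fun_prop) (hsg.mul_left _) (fun n t ht => by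
      have ht0 := pow_nonneg ht.1 (2 * n + 1)
      rw [Real.norm_of_nonneg (by positivity)]
      exact mul_le_of_le_one_right (by positivity) (pow_le_one₀ ht.1 ht.2))
  rw [h1]
  refine h2.congr_fun fun n => ?_
  rw [intervalIntegral.integral_const_mul, integral_pow]
  push_cast
  have : (n : ℝ) + 1 ≠ 0 := by positivity
  simp only [one_pow, ne_eq, Nat.add_eq_zero_iff, one_ne_zero, and_false, not_false_eq_true,
    zero_pow, sub_zero]
  field_simp; ring

lemma hasSum_cauchy_square {e : ℕ → ℝ} (he : ∀ n, 0 ≤ e n) (hs : Summable e) :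
    HasSum (fun n => ∑ k ∈ Finset.range (n + 1), e k * e (n - k)) ((∑' n, e n) ^ 2) := by
  have hmul : Summable fun p : ℕ × ℕ => e p.1 * e p.2 := hs.mul_of_nonneg hs he he
  rw [sq, hs.tsum_mul_tsum_eq_tsum_sum_range hs hmul]
  exact (summable_sum_mul_range_of_summable_mul hmul).hasSum

/-- The isoperimetric-type inequality for squares of entire functions. -/
lemma integral_norm_pow_four_le {φ : ℂ → ℂ} (hφ : Differentiable ℂ φ) :
    ∫ z in odisc, ‖φ z‖ ^ 4 ≤ π * (∑' n, ‖tc φ n‖ ^ 2) ^ 2 := by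
  have hs : Summable fun n => ‖tc φ n‖ ^ 2 := by simpa using summable_sq_tc hφ 1
  have h2 := hasSum_bergman (g := fun z => φ z * φ z) (hφ.mul hφ)
  have e : ∀ z, ‖φ z * φ z‖ ^ 2 = ‖φ z‖ ^ 4 := fun z => by rw [norm_mul]; ring
  simp_rw [e] at h2
  have hcs := (hasSum_cauchy_square (e := fun n => ‖tc φ n‖ ^ 2) (fun _ => sq_nonneg _) hs).mul_left π
  refine hasSum_le (fun n => ?_) h2 hcs
  have h3 : ‖tc (fun z => φ z * φ z) n‖ ^ 2 ≤
      (n + 1) * ∑ k ∈ Finset.range (n + 1), ‖tc φ k‖ ^ 2 * ‖tc φ (n - k)‖ ^ 2 := by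
    rw [tc_mul hφ hφ]
    calc ‖∑ i ∈ Finset.range (n + 1), tc φ i * tc φ (n - i)‖ ^ 2
        ≤ (∑ k ∈ Finset.range (n + 1), 1 * (‖tc φ k‖ * ‖tc φ (n - k)‖)) ^ 2 := by
          gcongr
          exact (norm_sum_le _ _).trans (Finset.sum_le_sum fun n _ => by simp)
      _ ≤ _ := Finset.sum_mul_sq_le_sq_mul_sq _ _ _
      _ = _ := by simp [mul_pow]
  rw [div_le_iff₀ (by positivity)]
  calc _ ≤ π * ((n + 1) * ∑ k ∈ Finset.range (n + 1), ‖tc φ k‖ ^ 2 * ‖tc φ (n - k)‖ ^ 2) := by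
        gcongr
    _ = _ := by ring

lemma mem_cdisc {z : ℂ} : z ∈ cdisc ↔ ‖z‖ ≤ 1 := by simp [cdisc]

lemma mem_odisc {z : ℂ} : z ∈ odisc ↔ ‖z‖ < 1 := by simp [odisc]

/-- A power series vanishing at the origin. -/
def serA (c : ℕ → ℂ) (z : ℂ) : ℂ := ∑' k, c k * z ^ (k + 1)

/-- The termwise derivative of `serA`. -/
def serA' (c : ℕ → ℂ) (z : ℂ) : ℂ := ∑' k : ℕ, ((k : ℂ) + 1) * c k * z ^ k

/-- The harmonic function with the given Fourier coefficients. -/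
def harm (c₀ : ℝ) (c : ℕ → ℂ) (z : ℂ) : ℝ := c₀ + 2 * (serA c z).re

/-- The truncation of `harm`. -/
def harmN (c₀ : ℝ) (c : ℕ → ℂ) (N : ℕ) (z : ℂ) : ℝ := c₀ + 2 * (pol c N z).re

lemma norm_serA_term_le (c : ℕ → ℂ) {z : ℂ} (hz : z ∈ cdisc) (k : ℕ) : ‖c k * z ^ (k + 1)‖ ≤ ‖c k‖ := by
  rw [norm_mul, norm_pow]
  exact mul_le_of_le_one_right (norm_nonneg _) (pow_le_one₀ (norm_nonneg _) (mem_cdisc.1 hz))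

lemma norm_serA'_term_le (c : ℕ → ℂ) {z : ℂ} (hz : z ∈ cdisc) (k : ℕ) :
    ‖((k : ℂ) + 1) * c k * z ^ k‖ ≤ ((k : ℝ) + 1) * ‖c k‖ := by
  have e : ‖((k : ℂ) + 1)‖ = (k : ℝ) + 1 := by exact_mod_cast Complex.norm_natCast (k + 1)
  rw [norm_mul, norm_mul, norm_pow, e]
  exact mul_le_of_le_one_right (by positivity) (pow_le_one₀ (norm_nonneg _) (mem_cdisc.1 hz))

section
variable {c : ℕ → ℂ} (hc : Summable fun k : ℕ => ((k : ℝ) + 1) * ‖c k‖)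
include hc

lemma summable_norm_of_weighted : Summable fun k => ‖c k‖ :=
  hc.of_nonneg_of_le (fun _ => norm_nonneg _) fun k =>
    le_mul_of_one_le_left (norm_nonneg _) (by linarith [(Nat.cast_nonneg k : (0:ℝ) ≤ k)])

lemma summable_weighted_sq : Summable fun k : ℕ => ((k : ℝ) + 1) * ‖c k‖ ^ 2 := by
  have h1 := summable_norm_of_weighted hc
  refine (hc.mul_right (∑' k, ‖c k‖)).of_nonneg_of_le (fun _ => by positivity) fun k => ?_
  rw [sq, ← mul_assoc]
  exact mul_le_mul_of_nonneg_left (h1.le_tsum k fun _ _ => norm_nonneg _) (by positivity)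

lemma continuousOn_serA : ContinuousOn (serA c) cdisc :=
  continuousOn_tsum (fun k => by fun_prop) (summable_norm_of_weighted hc)
    fun k z hz => norm_serA_term_le c hz k

lemma continuousOn_serA' : ContinuousOn (serA' c) cdisc :=
  continuousOn_tsum (fun k => by fun_prop) hc fun k z hz => norm_serA'_term_le c hz k

lemma hasDerivAt_serA {z : ℂ} (hz : z ∈ odisc) : HasDerivAt (serA c) (serA' c z) z := by
  refine hasDerivAt_tsum_of_isPreconnected (𝕜 := ℂ) (g := fun (k : ℕ) (z : ℂ) => c k * z ^ (k + 1))
    (g' := fun (k : ℕ) (z : ℂ) => ((k : ℂ) + 1) * c k * z ^ k) (t := odisc) (y₀ := 0) hc isOpen_ball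
    (convex_ball (0 : ℂ) 1).isPreconnected (fun k y _ => ?_)
    (fun k y hy => norm_serA'_term_le c (odisc_subset_cdisc hy) k) (by simp [odisc])
    (by simp) hz
  refine ((hasDerivAt_pow (k + 1) y).const_mul (c k)).congr_deriv ?_
  push_cast; ring_nf

lemma continuousOn_harm (c₀ : ℝ) : ContinuousOn (harm c₀ c) cdisc :=
  continuousOn_const.add (continuousOn_const.mul
    (Complex.continuous_re.comp_continuousOn (continuousOn_serA hc)))

lemma exists_harmN_close (c₀ : ℝ) {ε : ℝ} (hε : 0 < ε) :
    ∃ N, ∀ z ∈ cdisc, |harmN c₀ c N z - harm c₀ c z| ≤ ε := by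
  have h := tendstoUniformlyOn_tsum_nat (f := fun k z => c k * z ^ (k + 1)) (s := cdisc)
    (summable_norm_of_weighted hc) (fun k z hz => norm_serA_term_le c hz k)
  rw [Metric.tendstoUniformlyOn_iff] at h
  obtain ⟨N, hN⟩ := (h (ε / 2) (by positivity)).exists
  refine ⟨N, fun z hz => ?_⟩
  have h1 := hN z hz
  rw [dist_comm, dist_eq_norm] at h1
  have h2 := (Complex.abs_re_le_norm _).trans h1.le
  have e : harmN c₀ c N z - harm c₀ c z = 2 * ((∑ k ∈ Finset.range N, c k * z ^ (k + 1)) -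
      ∑' k, c k * z ^ (k + 1)).re := by
    simp only [harmN, harm, pol, serA, Complex.sub_re]; ring
  rw [e, abs_mul, abs_two]; linarith
end

lemma le_of_forall_exp_le {X Y : ℝ} (h : ∀ ε > 0, X ≤ Real.exp ε * Y) : X ≤ Y := by
  have ht : Tendsto (fun ε => Real.exp ε * Y) (𝓝[>] 0) (𝓝 (Real.exp 0 * Y)) :=
    ((Real.continuous_exp.mul continuous_const).tendsto 0).mono_left nhdsWithin_le_nhds
  rw [Real.exp_zero, one_mul] at ht
  exact ge_of_tendsto ht (eventually_nhdsWithin_of_forall fun ε hε => h ε hε)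

lemma exp_harmN (c₀ : ℝ) (c : ℕ → ℂ) (N : ℕ) (z : ℂ) :
    Real.exp (harmN c₀ c N z) = Real.exp c₀ * ‖Complex.exp (pol c N z)‖ ^ 2 := by
  rw [harmN, Real.exp_add, Complex.norm_exp, ← Real.exp_nat_mul]; norm_num

lemma continuous_pol (c : ℕ → ℂ) (N : ℕ) : Continuous (pol c N) := (differentiable_pol c N).continuous

lemma continuous_harmN (c₀ : ℝ) (c : ℕ → ℂ) (N : ℕ) : Continuous (harmN c₀ c N) := by
  have := continuous_pol c N
  unfold harmN; fun_prop

lemma circInt_exp_harmN (c₀ : ℝ) (c : ℕ → ℂ) (N : ℕ) :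
    circInt (fun z => Real.exp (harmN c₀ c N z)) =
      Real.exp c₀ * (2 * π * ∑' n, ‖tc (fun z => Complex.exp (pol c N z)) n‖ ^ 2) := by
  rw [circInt_eq]
  simp_rw [exp_harmN]
  rw [intervalIntegral.integral_const_mul]
  have := parseval_entire (differentiable_pol c N).cexp 1
  simp only [Complex.ofReal_one, one_mul, one_pow, mul_one] at this
  rw [this]

lemma circInt_mono {φ χ : ℂ → ℝ} (hφ : ContinuousOn φ cdisc) (hχ : ContinuousOn χ cdisc)
    (h : ∀ z ∈ cdisc, φ z ≤ χ z) : circInt φ ≤ circInt χ :=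
  intervalIntegral.integral_mono (by positivity)
    ((hφ.comp_continuous continuous_bpt bpt_mem_cdisc).intervalIntegrable _ _)
    ((hχ.comp_continuous continuous_bpt bpt_mem_cdisc).intervalIntegrable _ _)
    fun θ => h _ (bpt_mem_cdisc θ)

lemma circInt_const_mul (a : ℝ) (φ : ℂ → ℝ) : circInt (fun z => a * φ z) = a * circInt φ :=
  intervalIntegral.integral_const_mul _ _

section
variable {c : ℕ → ℂ} (hc : Summable fun k : ℕ => ((k : ℝ) + 1) * ‖c k‖) (c₀ : ℝ)
include hc

lemma continuousOn_exp_harm : ContinuousOn (fun z => Real.exp (harm c₀ c z)) cdisc :=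
  (continuousOn_harm hc c₀).rexp

lemma circInt_exp_harmN_le {ε : ℝ} {N : ℕ}
    (hN : ∀ z ∈ cdisc, |harmN c₀ c N z - harm c₀ c z| ≤ ε) :
    circInt (fun z => Real.exp (harmN c₀ c N z)) ≤
      Real.exp ε * circInt (fun z => Real.exp (harm c₀ c z)) := by
  rw [← circInt_const_mul]
  refine circInt_mono (continuous_harmN c₀ c N).rexp.continuousOn
    (continuousOn_const.mul (continuousOn_exp_harm hc c₀)) fun z hz => ?_
  rw [← Real.exp_add]
  exact Real.exp_le_exp.2 (by linarith [(abs_le.1 (hN z hz)).2])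

lemma le_circInt_exp_harmN {ε : ℝ} {N : ℕ}
    (hN : ∀ z ∈ cdisc, |harmN c₀ c N z - harm c₀ c z| ≤ ε) :
    circInt (fun z => Real.exp (harm c₀ c z)) ≤
      Real.exp ε * circInt (fun z => Real.exp (harmN c₀ c N z)) := by
  rw [← circInt_const_mul]
  refine circInt_mono (continuousOn_exp_harm hc c₀)
    (continuousOn_const.mul (continuous_harmN c₀ c N).rexp.continuousOn) fun z hz => ?_
  rw [← Real.exp_add]
  exact Real.exp_le_exp.2 (by linarith [(abs_le.1 (hN z hz)).1])

lemma one_sub_sq_mul_exp_harm_le {z : ℂ} (hz : z ∈ odisc) :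
    (1 - ‖z‖ ^ 2) * Real.exp (harm c₀ c z) ≤
      circInt (fun z => Real.exp (harm c₀ c z)) / (2 * π) := by
  have hz1 := mem_odisc.1 hz
  have h0 : 0 < 1 - ‖z‖ ^ 2 := by nlinarith [norm_nonneg z]
  refine le_of_forall_exp_le fun ε hε => ?_
  obtain ⟨N, hN⟩ := exists_harmN_close hc c₀ (half_pos hε)
  have h1 := norm_sq_mul_le_sum_sq_tc (differentiable_pol c N).cexp hz1
  have h2 := circInt_exp_harmN_le hc c₀ hN
  rw [circInt_exp_harmN] at h2
  have h3 : Real.exp (harm c₀ c z) ≤ Real.exp (ε / 2) * Real.exp (harmN c₀ c N z) := by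
    rw [← Real.exp_add]
    exact Real.exp_le_exp.2 (by linarith [(abs_le.1 (hN z (odisc_subset_cdisc hz))).1])
  rw [exp_harmN] at h3
  set T := ∑' n, ‖tc (fun z => Complex.exp (pol c N z)) n‖ ^ 2
  set L := circInt (fun z => Real.exp (harm c₀ c z))
  have hT : Real.exp c₀ * T ≤ Real.exp (ε / 2) * L / (2 * π) := by
    rw [le_div_iff₀ (by positivity)]; linarith
  calc _ ≤ (1 - ‖z‖ ^ 2) * (Real.exp (ε / 2) * (Real.exp c₀ * ‖Complex.exp (pol c N z)‖ ^ 2)) := by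
        gcongr
    _ = Real.exp (ε / 2) * Real.exp c₀ * ((1 - ‖z‖ ^ 2) * ‖Complex.exp (pol c N z)‖ ^ 2) := by ring
    _ ≤ Real.exp (ε / 2) * Real.exp c₀ * T := by gcongr
    _ = Real.exp (ε / 2) * (Real.exp c₀ * T) := by ring
    _ ≤ Real.exp (ε / 2) * (Real.exp (ε / 2) * L / (2 * π)) := by gcongr
    _ = (Real.exp (ε / 2) * Real.exp (ε / 2)) * (L / (2 * π)) := by ring
    _ = _ := by rw [← Real.exp_add, add_halves]

lemma circInt_exp_harm_le_of_sup {S : ℝ}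
    (hS : ∀ z ∈ odisc, (1 - ‖z‖ ^ 2) * Real.exp (harm c₀ c z) ≤ S) :
    circInt (fun z => Real.exp (harm c₀ c z)) ≤
      10 * π * √S * Real.exp ((c₀ + ∑' k : ℕ, ((k : ℝ) + 1) * ‖c k‖ ^ 2) / 2) := by
  refine le_of_forall_exp_le fun ε hε => ?_
  obtain ⟨N, hN⟩ := exists_harmN_close hc c₀ (half_pos hε)
  have h2 := le_circInt_exp_harmN hc c₀ hN
  rw [circInt_exp_harmN] at h2
  have h1 := sum_sq_tc_le_of_sup (c := c) (N := N) (S := Real.exp (ε / 2 - c₀) * S) (fun z hz => by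
    have h0 : 0 < 1 - ‖z‖ ^ 2 := by nlinarith [norm_nonneg z]
    have hzo := mem_odisc.2 hz
    have h3 : ‖Complex.exp (pol c N z)‖ ^ 2 ≤ Real.exp (ε / 2 - c₀) * Real.exp (harm c₀ c z) := by
      have : Real.exp c₀ * ‖Complex.exp (pol c N z)‖ ^ 2 ≤
          Real.exp c₀ * (Real.exp (ε / 2 - c₀) * Real.exp (harm c₀ c z)) := by
        rw [← exp_harmN, ← Real.exp_add, ← Real.exp_add]
        exact Real.exp_le_exp.2 (by linarith [(abs_le.1 (hN z (odisc_subset_cdisc hzo))).2])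
      exact le_of_mul_le_mul_left this (Real.exp_pos _)
    calc _ ≤ (1 - ‖z‖ ^ 2) * (Real.exp (ε / 2 - c₀) * Real.exp (harm c₀ c z)) := by gcongr
      _ = Real.exp (ε / 2 - c₀) * ((1 - ‖z‖ ^ 2) * Real.exp (harm c₀ c z)) := by ring
      _ ≤ _ := by gcongr; exact hS z hzo)
  rw [Real.sqrt_mul (Real.exp_pos _).le, ← Real.exp_half] at h1
  have h4 : ∑ k ∈ Finset.range N, ((k : ℝ) + 1) * ‖c k‖ ^ 2 ≤ ∑' k : ℕ, ((k : ℝ) + 1) * ‖c k‖ ^ 2 :=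
    (summable_weighted_sq hc).sum_le_tsum _ fun _ _ => by positivity
  set T := ∑' n, ‖tc (fun z => Complex.exp (pol c N z)) n‖ ^ 2
  set D := ∑' k : ℕ, ((k : ℝ) + 1) * ‖c k‖ ^ 2
  calc _ ≤ Real.exp (ε / 2) * (Real.exp c₀ * (2 * π * T)) := h2
    _ ≤ Real.exp (ε / 2) * (Real.exp c₀ * (2 * π *
        (5 * (Real.exp ((ε / 2 - c₀) / 2) * √S) * Real.exp (D / 2)))) := by
        gcongr
        refine h1.trans ?_
        gcongr
    _ = 10 * π * √S * (Real.exp (ε / 2) * Real.exp c₀ * Real.exp ((ε / 2 - c₀) / 2) *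
        Real.exp (D / 2)) := by ring
    _ = 10 * π * √S * Real.exp (3 * ε / 4 + (c₀ + D) / 2) := by
        rw [← Real.exp_add, ← Real.exp_add, ← Real.exp_add]; ring_nf
    _ ≤ 10 * π * √S * Real.exp (ε + (c₀ + D) / 2) := by gcongr; linarith
    _ = _ := by rw [Real.exp_add]; ring

lemma ballInt_exp_two_harm_le :
    ∫ z in odisc, Real.exp (2 * harm c₀ c z) ≤
      circInt (fun z => Real.exp (harm c₀ c z)) ^ 2 / (4 * π) := by
  refine le_of_forall_exp_le fun ε hε => ?_
  obtain ⟨N, hN⟩ := exists_harmN_close hc c₀ (ε := ε / 4) (by positivity)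
  have h2 := circInt_exp_harmN_le hc c₀ hN
  rw [circInt_exp_harmN] at h2
  have h1 := integral_norm_pow_four_le (differentiable_pol c N).cexp
  have hT0 : 0 ≤ ∑' n, ‖tc (fun z => Complex.exp (pol c N z)) n‖ ^ 2 := tsum_nonneg fun _ => by positivity
  set T := ∑' n, ‖tc (fun z => Complex.exp (pol c N z)) n‖ ^ 2
  set L := circInt (fun z => Real.exp (harm c₀ c z))
  have hcp := continuous_pol c N
  have h3 : ∫ z in odisc, Real.exp (2 * harm c₀ c z) ≤
      ∫ z in odisc, Real.exp (ε / 2 + 2 * c₀) * ‖Complex.exp (pol c N z)‖ ^ 4 := by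
    refine setIntegral_mono_on (integrableOn_odisc ?_) (integrableOn_odisc ?_)
      measurableSet_ball fun z hz => ?_
    · exact (continuousOn_const.mul (continuousOn_harm hc c₀)).rexp
    · exact (by fun_prop : Continuous fun z =>
        Real.exp (ε / 2 + 2 * c₀) * ‖Complex.exp (pol c N z)‖ ^ 4).continuousOn
    · have e : Real.exp (ε / 2 + 2 * c₀) * ‖Complex.exp (pol c N z)‖ ^ 4 =
          Real.exp (ε / 2) * Real.exp (harmN c₀ c N z) ^ 2 := by
        rw [exp_harmN, Real.exp_add, two_mul, Real.exp_add]; ring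
      rw [e, ← Real.exp_nat_mul, ← Real.exp_add]
      refine Real.exp_le_exp.2 ?_
      push_cast
      linarith [(abs_le.1 (hN z (odisc_subset_cdisc hz))).1]
  rw [integral_const_mul] at h3
  have h5 : (Real.exp c₀ * (2 * π * T)) ^ 2 ≤ (Real.exp (ε / 4) * L) ^ 2 :=
    pow_le_pow_left₀ (by positivity) h2 2
  calc _ ≤ Real.exp (ε / 2 + 2 * c₀) * (π * T ^ 2) := h3.trans (by gcongr)
    _ = Real.exp (ε / 2) * (Real.exp c₀ * (2 * π * T)) ^ 2 / (4 * π) := by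
        rw [Real.exp_add, two_mul, Real.exp_add]; field_simp; ring
    _ ≤ Real.exp (ε / 2) * (Real.exp (ε / 4) * L) ^ 2 / (4 * π) := by gcongr
    _ = Real.exp (ε / 2 + ε / 4 + ε / 4) * (L ^ 2 / (4 * π)) := by
        rw [Real.exp_add, Real.exp_add]; ring
    _ = _ := by ring_nf
end

lemma integral_deriv_mul_conj_bpt_pow {b b' : ℝ → ℝ} (hb : ∀ θ, HasDerivAt b (b' θ) θ)
    (hb' : Continuous b') (hp : Function.Periodic b (2 * π)) (n : ℕ) :
    ∫ θ in (-π)..π, (b' θ : ℂ) * (starRingEnd ℂ) (bpt θ ^ n) =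
      Complex.I * n * ∫ θ in (-π)..π, (b θ : ℂ) * (starRingEnd ℂ) (bpt θ ^ n) := by
  have hbc : Continuous b := continuous_iff_continuousAt.2 fun θ => (hb θ).continuousAt
  have hcc : Continuous fun θ => (starRingEnd ℂ) (bpt θ ^ n) :=
    Complex.continuous_conj.comp (continuous_bpt.pow n)
  have hd : ∀ θ, HasDerivAt (fun θ => (starRingEnd ℂ) (bpt θ ^ n))
      (-(Complex.I * n) * (starRingEnd ℂ) (bpt θ ^ n)) θ := fun θ => by
    have h1 := (hasDerivAt_bpt θ).pow n
    have h2 := Complex.conjCLE.toContinuousLinearMap.hasFDerivAt.comp_hasDerivAt θ h1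
    refine h2.congr_deriv ?_
    rcases n with _ | n
    · simp
    · simp; ring
  have hd2 : ∀ θ, HasDerivAt (fun θ => (b θ : ℂ) * (starRingEnd ℂ) (bpt θ ^ n))
      ((b' θ : ℂ) * (starRingEnd ℂ) (bpt θ ^ n) -
        Complex.I * n * ((b θ : ℂ) * (starRingEnd ℂ) (bpt θ ^ n))) θ := fun θ =>
    ((hb θ).ofReal_comp.mul (hd θ)).congr_deriv (by ring)
  have hi1 : IntervalIntegrable (fun θ => (b' θ : ℂ) * (starRingEnd ℂ) (bpt θ ^ n)) volume (-π) π :=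
    ((Complex.continuous_ofReal.comp hb').mul hcc).intervalIntegrable _ _
  have hi2 : IntervalIntegrable (fun θ => Complex.I * n *
      ((b θ : ℂ) * (starRingEnd ℂ) (bpt θ ^ n))) volume (-π) π :=
    (continuous_const.mul ((Complex.continuous_ofReal.comp hbc).mul hcc)).intervalIntegrable _ _
  have h := intervalIntegral.integral_eq_sub_of_hasDerivAt (fun θ _ => hd2 θ) (hi1.sub hi2)
  rw [intervalIntegral.integral_sub hi1 hi2, intervalIntegral.integral_const_mul] at h
  have e1 : b π = b (-π) := by rw [← hp (-π)]; congr 1; ring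
  have e2 : bpt π = bpt (-π) := by rw [← bpt_periodic (-π)]; congr 1; ring
  rw [e1, e2, sub_self] at h
  exact sub_eq_zero.1 h

/-- Positive Fourier coefficients of a periodic function. -/
def fcoef (b : ℝ → ℝ) (k : ℕ) : ℂ :=
  (1 / (2 * π) : ℝ) * ∫ θ in (-π)..π, (b θ : ℂ) * (starRingEnd ℂ) (bpt θ ^ (k + 1))

lemma norm_fcoef_le {b : ℝ → ℝ} {C : ℝ} (hC : ∀ θ, |b θ| ≤ C) (k : ℕ) : ‖fcoef b k‖ ≤ C := by
  have h : ‖∫ θ in (-π)..π, (b θ : ℂ) * (starRingEnd ℂ) (bpt θ ^ (k + 1))‖ ≤ C * |π - -π| :=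
    intervalIntegral.norm_integral_le_of_norm_le_const fun θ _ => by
      simpa [norm_bpt] using hC θ
  rw [fcoef, norm_mul, Complex.norm_real, Real.norm_of_nonneg (by positivity)]
  rw [abs_of_pos (by linarith [Real.pi_pos])] at h
  calc _ ≤ 1 / (2 * π) * (C * (π - -π)) := mul_le_mul_of_nonneg_left h (by positivity)
    _ = C := by field_simp; ring

lemma fcoef_deriv {b : ℝ → ℝ} (hb : ContDiff ℝ 1 b) (hp : Function.Periodic b (2 * π)) (k : ℕ) :
    ‖fcoef (deriv b) k‖ = (k + 1) * ‖fcoef b k‖ := by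
  have := integral_deriv_mul_conj_bpt_pow (b := b) (b' := deriv b)
    (fun θ => (hb.differentiable one_ne_zero θ).hasDerivAt) (hb.continuous_deriv le_rfl) hp (k + 1)
  have e : ‖((k : ℂ) + 1)‖ = (k : ℝ) + 1 := by exact_mod_cast Complex.norm_natCast (k + 1)
  rw [fcoef, fcoef, this]
  simp only [norm_mul, Complex.norm_I]
  push_cast
  rw [e]; ring

lemma periodic_deriv {b : ℝ → ℝ} {T : ℝ} (hp : Function.Periodic b T) :
    Function.Periodic (deriv b) T := fun θ => by
  rw [← deriv_comp_add_const]
  congr 1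
  ext x; exact hp x

lemma periodic_bounded {b : ℝ → ℝ} (hb : Continuous b) (hp : Function.Periodic b (2 * π)) :
    ∃ C, ∀ θ, |b θ| ≤ C := by
  obtain ⟨C, hC⟩ := (isCompact_Icc (a := (0:ℝ)) (b := 2 * π)).exists_bound_of_continuousOn
    hb.continuousOn
  refine ⟨C, fun θ => ?_⟩
  obtain ⟨y, hy, he⟩ := hp.exists_mem_Ico₀ (by positivity) θ
  rw [he]; exact hC y (Ico_subset_Icc_self hy)

lemma summable_fcoef {b : ℝ → ℝ} (hb : ContDiff ℝ (⊤ : ℕ∞) b) (hp : Function.Periodic b (2 * π)) :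
    Summable fun k : ℕ => ((k : ℝ) + 1) * ‖fcoef b k‖ := by
  have hb0 : ContDiff ℝ 1 b := hb.of_le (by exact_mod_cast le_top)
  have hb1 : ContDiff ℝ (⊤ : ℕ∞) (deriv b) := (contDiff_infty_iff_deriv.1 hb).2
  have hb2 : ContDiff ℝ (⊤ : ℕ∞) (deriv (deriv b)) := (contDiff_infty_iff_deriv.1 hb1).2
  have hb3 : ContDiff ℝ (⊤ : ℕ∞) (deriv (deriv (deriv b))) := (contDiff_infty_iff_deriv.1 hb2).2
  have hp1 := periodic_deriv hp
  have hp2 := periodic_deriv hp1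
  have hp3 := periodic_deriv hp2
  obtain ⟨C, hC⟩ := periodic_bounded hb3.continuous hp3
  have hs : Summable fun k : ℕ => C / ((k : ℝ) + 1) ^ 2 := by
    have := (summable_nat_add_iff 1).2 (Real.summable_nat_pow_inv.2 one_lt_two)
    simpa [div_eq_mul_inv] using this.mul_left C
  refine hs.of_nonneg_of_le (fun k => by positivity) fun k => ?_
  have h := norm_fcoef_le hC k
  rw [fcoef_deriv (hb2.of_le (by exact_mod_cast le_top)) hp2,
    fcoef_deriv (hb1.of_le (by exact_mod_cast le_top)) hp1, fcoef_deriv hb0 hp] at h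
  rw [le_div_iff₀ (by positivity)]
  calc _ = _ := by ring
    _ ≤ C := h

instance fact_two_pi_pos : Fact ((0:ℝ) < 2 * π) := ⟨by positivity⟩

lemma fourier_nat_eq (n : ℕ) (θ : ℝ) :
    fourier (T := 2 * π) (n : ℤ) (θ : AddCircle (2 * π)) = bpt θ ^ n := by
  rw [fourier_coe_apply, bpt, ← Complex.exp_nat_mul]
  congr 1
  have : (π : ℂ) ≠ 0 := by exact_mod_cast Real.pi_ne_zero
  push_cast; field_simp

lemma fourier_neg_nat_eq (n : ℕ) (θ : ℝ) :
    fourier (T := 2 * π) (-(n : ℤ)) (θ : AddCircle (2 * π)) = (starRingEnd ℂ) (bpt θ ^ n) := by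
  rw [fourier_neg, fourier_nat_eq]

lemma harm_fcoef_eq {b : ℝ → ℝ} (hb : Continuous b) (hp : Function.Periodic b (2 * π))
    (hc : Summable fun k : ℕ => ((k : ℝ) + 1) * ‖fcoef b k‖) (θ : ℝ) :
    harm (1 / (2 * π) * ∫ θ in (-π)..π, b θ) (fcoef b) (bpt θ) = b θ := by
  have hp' : Function.Periodic (fun θ => (b θ : ℂ)) (2 * π) := fun θ => by simp only [hp θ]
  let F : C(AddCircle (2 * π), ℂ) := ⟨hp'.lift,
    (QuotientAddGroup.isQuotientMap_mk _).continuous_iff.2 (Complex.continuous_ofReal.comp hb)⟩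
  have hF : ∀ x : ℝ, F (x : AddCircle (2 * π)) = (b x : ℂ) := fun x => rfl
  have hco : ∀ n, fourierCoeff F n =
      (1 / (2 * π)) • ∫ x in (-π)..π, fourier (T := 2 * π) (-n) (x : AddCircle (2 * π)) • (b x : ℂ) := by
    intro n
    rw [fourierCoeff_eq_intervalIntegral _ n (-π)]
    congr 2; ring
  have h1 : ∀ k : ℕ, fourierCoeff F ((k : ℤ) + 1) = fcoef b k := fun k => by
    rw [hco, fcoef, Complex.real_smul]
    congr 2; ext x
    have := fourier_neg_nat_eq (k + 1) x
    push_cast at this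
    rw [this, smul_eq_mul, mul_comm]
  have hconj : ∀ G : ℝ → ℂ, (starRingEnd ℂ) (∫ x in (-π)..π, G x) =
      ∫ x in (-π)..π, (starRingEnd ℂ) (G x) := fun G => by
    simp only [intervalIntegral, map_sub, integral_conj]
  have h2 : ∀ k : ℕ, fourierCoeff F (-((k : ℤ) + 1)) = (starRingEnd ℂ) (fcoef b k) := fun k => by
    rw [hco, fcoef, Complex.real_smul, map_mul, Complex.conj_ofReal, hconj]
    congr 2; ext x
    have := fourier_nat_eq (k + 1) x
    push_cast at this
    rw [neg_neg, this, smul_eq_mul, map_mul, Complex.conj_conj, Complex.conj_ofReal, mul_comm]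
  have h0 : fourierCoeff F 0 = ((1 / (2 * π) * ∫ θ in (-π)..π, b θ : ℝ) : ℂ) := by
    rw [hco]
    simp only [neg_zero, fourier_zero, one_smul]
    rw [intervalIntegral.integral_ofReal, Complex.real_smul]; push_cast; rfl
  have hs1 : Summable fun k => ‖fcoef b k‖ := summable_norm_of_weighted hc
  have hsum : Summable (fourierCoeff F) := by
    refine Summable.of_add_one_of_neg_add_one ?_ ?_
    · simp_rw [h1]; exact hs1.of_norm
    · simp_rw [h2]; exact Summable.of_norm (by simpa using hs1)
  have hs := has_pointwise_sum_fourier_series_of_summable hsum (θ : AddCircle (2 * π))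
  have hterm : Summable fun k => fcoef b k * bpt θ ^ (k + 1) :=
    Summable.of_norm (by simpa [norm_bpt] using hs1)
  have e1 : ∀ k : ℕ, fourierCoeff F ((k : ℤ) + 1) • fourier (T := 2 * π) ((k : ℤ) + 1) (θ : AddCircle (2 * π))
      = fcoef b k * bpt θ ^ (k + 1) := fun k => by
    have := fourier_nat_eq (k + 1) θ
    push_cast at this
    rw [this, h1, smul_eq_mul]
  have e2 : ∀ k : ℕ, fourierCoeff F (-((k : ℤ) + 1)) • fourier (T := 2 * π) (-((k : ℤ) + 1)) (θ : AddCircle (2 * π))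
      = (starRingEnd ℂ) (fcoef b k * bpt θ ^ (k + 1)) := fun k => by
    have := fourier_neg_nat_eq (k + 1) θ
    push_cast at this
    rw [this, h2, smul_eq_mul, map_mul, map_pow]
  have ht := hs.tsum_eq
  rw [tsum_of_add_one_of_neg_add_one (by simp_rw [e1]; exact hterm)
    (by simp_rw [e2]; exact (Complex.hasSum_conj'.2 (by simpa using hterm.hasSum)).summable)] at ht
  simp_rw [e1, e2] at ht
  rw [← Complex.conj_tsum, h0, fourier_zero, smul_eq_mul, mul_one, hF] at ht
  have := congrArg Complex.re ht
  simp only [Complex.add_re, Complex.conj_re, Complex.ofReal_re] at this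
  rw [harm, serA]; linarith

/-- Squared Euclidean norm of a differential. -/
def gsq (L : ℂ →L[ℝ] ℝ) : ℝ := (L 1) ^ 2 + (L Complex.I) ^ 2

lemma gsq_nonneg (L : ℂ →L[ℝ] ℝ) : 0 ≤ gsq L := by unfold gsq; positivity

lemma clm_apply_eq (L : ℂ →L[ℝ] ℝ) (v : ℂ) : L v = v.re * L 1 + v.im * L Complex.I := by
  conv_lhs => rw [show v = v.re • (1 : ℂ) + v.im • Complex.I by
    apply Complex.ext <;> simp]
  rw [map_add, map_smul, map_smul]; rfl

lemma abs_apply_le_sqrt_gsq (L : ℂ →L[ℝ] ℝ) (v : ℂ) : |L v| ≤ √(gsq L) * ‖v‖ := by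
  rw [← abs_of_nonneg (norm_nonneg v), ← abs_of_nonneg (Real.sqrt_nonneg (gsq L)), ← abs_mul]
  refine sq_le_sq.1 ?_
  rw [mul_pow, Real.sq_sqrt (gsq_nonneg L), clm_apply_eq, gsq, Complex.sq_norm, Complex.normSq_apply]
  nlinarith [sq_nonneg (v.re * L Complex.I - v.im * L 1)]

lemma continuous_gsq : Continuous gsq := by
  unfold gsq
  exact ((ContinuousLinearMap.apply ℝ ℝ (1 : ℂ)).continuous.pow 2).add
    ((ContinuousLinearMap.apply ℝ ℝ Complex.I).continuous.pow 2)

/-- The real differential `v ↦ 2 Re (a v)`. -/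
def hD (a : ℂ) : ℂ →L[ℝ] ℝ := (2 : ℝ) • Complex.reCLM.comp (ContinuousLinearMap.mul ℝ ℂ a)

@[simp] lemma hD_apply (a v : ℂ) : hD a v = 2 * (a * v).re := by simp [hD]

lemma continuous_hD : Continuous hD := by
  unfold hD
  exact (((ContinuousLinearMap.compL ℝ ℂ ℂ ℝ Complex.reCLM).continuous.comp
    (ContinuousLinearMap.mul ℝ ℂ).continuous).const_smul (2 : ℝ))

lemma gsq_hD (a : ℂ) : gsq (hD a) = 4 * ‖a‖ ^ 2 := by
  rw [gsq, Complex.sq_norm, Complex.normSq_apply]; simp; ring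

lemma hasFDerivAt_two_re {g : ℂ → ℂ} {a z : ℂ} (c₀ : ℝ) (hg : HasDerivAt g a z) :
    HasFDerivAt (fun z => c₀ + 2 * (g z).re) (hD a) z := by
  have h1 : HasFDerivAt g ((ContinuousLinearMap.toSpanSingleton ℂ a).restrictScalars ℝ) z :=
    hg.hasFDerivAt.restrictScalars ℝ
  have h2 := ((Complex.reCLM.hasFDerivAt (x := g z)).comp z h1).const_mul 2
  refine (h2.const_add c₀).congr_fderiv ?_
  ext v; simp [mul_comm]

lemma hasFDerivAt_harmN (c₀ : ℝ) (c : ℕ → ℂ) (N : ℕ) (z : ℂ) :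
    HasFDerivAt (harmN c₀ c N) (hD (deriv (pol c N) z)) z :=
  hasFDerivAt_two_re c₀ (differentiable_pol c N z).hasDerivAt

lemma hasFDerivAt_harm {c : ℕ → ℂ} (hc : Summable fun k : ℕ => ((k : ℝ) + 1) * ‖c k‖) (c₀ : ℝ)
    {z : ℂ} (hz : z ∈ odisc) : HasFDerivAt (harm c₀ c) (hD (serA' c z)) z :=
  hasFDerivAt_two_re c₀ (hasDerivAt_serA hc hz)

lemma fderivWithin_harmN (c₀ : ℝ) (c : ℕ → ℂ) (N : ℕ) {z : ℂ} (hz : z ∈ cdisc) :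
    fderivWithin ℝ (harmN c₀ c N) cdisc z = hD (deriv (pol c N) z) :=
  (hasFDerivAt_harmN c₀ c N z).hasFDerivWithinAt.fderivWithin (uniqueDiffOn_cdisc z hz)

lemma contDiff_harmN (c₀ : ℝ) (c : ℕ → ℂ) (N : ℕ) : ContDiff ℝ 2 (harmN c₀ c N) := by
  have h1 : ContDiff ℝ 2 (pol c N) := by
    unfold pol
    exact ContDiff.sum fun k _ => contDiff_const.mul (contDiff_id.pow _)
  exact contDiff_const.add (contDiff_const.mul (Complex.reCLM.contDiff.comp h1))

lemma lapW_harmN (c₀ : ℝ) (c : ℕ → ℂ) (N : ℕ) {z : ℂ} (hz : z ∈ cdisc) :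
    lapW (harmN c₀ c N) z = 0 := by
  have hd : HasDerivAt (deriv (pol c N)) (deriv (deriv (pol c N)) z) z :=
    (((differentiable_pol c N).contDiff (n := 2)).differentiable_deriv_two z).hasDerivAt
  have key : ∀ e : ℂ, fderivWithin ℝ (fun x => fderivWithin ℝ (harmN c₀ c N) cdisc x e) cdisc z e =
      2 * (deriv (deriv (pol c N)) z * e * e).re := fun e => by
    have h1 : HasFDerivAt (fun x => 0 + 2 * (deriv (pol c N) x * e).re)
        (hD (deriv (deriv (pol c N)) z * e)) z := hasFDerivAt_two_re 0 (hd.mul_const e)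
    have h2 : HasFDerivWithinAt (fun x => fderivWithin ℝ (harmN c₀ c N) cdisc x e)
        (hD (deriv (deriv (pol c N)) z * e)) cdisc z :=
      h1.hasFDerivWithinAt.congr (fun x hx => by simp [fderivWithin_harmN c₀ c N hx])
        (by simp [fderivWithin_harmN c₀ c N hz])
    rw [h2.fderivWithin (uniqueDiffOn_cdisc z hz)]; simp
  rw [lapW, key, key]; simp

lemma deriv_pol (c : ℕ → ℂ) (N : ℕ) (z : ℂ) :
    deriv (pol c N) z = ∑ k ∈ Finset.range N, ((k : ℂ) + 1) * c k * z ^ k := by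
  have : HasDerivAt (pol c N) (∑ k ∈ Finset.range N, ((k : ℂ) + 1) * c k * z ^ k) z := by
    unfold pol
    refine HasDerivAt.fun_sum fun k _ => ?_
    refine ((hasDerivAt_pow (k + 1) z).const_mul (c k)).congr_deriv ?_
    push_cast; ring_nf
  exact this.deriv

lemma integral_norm_deriv_pol_sq (c : ℕ → ℂ) (N : ℕ) :
    ∫ z in odisc, ‖deriv (pol c N) z‖ ^ 2 =
      π * ∑ k ∈ Finset.range N, ((k : ℝ) + 1) * ‖c k‖ ^ 2 := by
  have hd : Differentiable ℂ (deriv (pol c N)) :=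
    ((differentiable_pol c N).contDiff (n := 2)).differentiable_deriv_two
  have e : ∀ n : ℕ, π * ‖tc (deriv (pol c N)) n‖ ^ 2 / (n + 1) =
      if n < N then π * (((n : ℝ) + 1) * ‖c n‖ ^ 2) else 0 := fun n => by
    have e : ‖((n : ℂ) + 1)‖ = (n : ℝ) + 1 := by exact_mod_cast Complex.norm_natCast (n + 1)
    rw [tc_deriv, tc_pol]
    split_ifs
    · rw [norm_mul, e]; field_simp
    · simp
  have h1 := hasSum_bergman hd
  simp_rw [e] at h1
  have h2 := hasSum_sum_of_ne_finset_zero (L := .unconditional ℕ) (s := Finset.range N)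
    (f := fun n : ℕ => if n < N then π * (((n : ℝ) + 1) * ‖c n‖ ^ 2) else 0)
    (fun n hn => by simp at hn; simp [hn])
  rw [h1.unique h2, Finset.mul_sum]
  exact Finset.sum_congr rfl fun n hn => by simp [Finset.mem_range.1 hn]

lemma integral_mul_bpt_pow (b : ℝ → ℝ) (k : ℕ) :
    ∫ θ in (-π)..π, (b θ : ℂ) * bpt θ ^ (k + 1) = 2 * π * (starRingEnd ℂ) (fcoef b k) := by
  have hconj : ∀ G : ℝ → ℂ, (starRingEnd ℂ) (∫ x in (-π)..π, G x) =
      ∫ x in (-π)..π, (starRingEnd ℂ) (G x) := fun G => by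
    simp only [intervalIntegral, map_sub, integral_conj]
  have : (π : ℂ) ≠ 0 := by exact_mod_cast Real.pi_ne_zero
  rw [fcoef, map_mul, Complex.conj_ofReal, hconj]
  simp only [map_mul, Complex.conj_ofReal, Complex.conj_conj]
  push_cast; field_simp

lemma circInt_mul_nder_harmN {u : ℂ → ℝ} (hu : ContinuousOn u cdisc) (c₀ : ℝ) (N : ℕ) :
    circInt (fun z => u z * nder (harmN c₀ (fcoef fun θ => u (bpt θ)) N) z) =
      4 * π * ∑ k ∈ Finset.range N, ((k : ℝ) + 1) * ‖fcoef (fun θ => u (bpt θ)) k‖ ^ 2 := by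
  set b : ℝ → ℝ := fun θ => u (bpt θ) with hb
  have hbc : Continuous b := hu.comp_continuous continuous_bpt bpt_mem_cdisc
  set c := fcoef b
  have e1 : ∀ θ, u (bpt θ) * nder (harmN c₀ c N) (bpt θ) =
      (∑ k ∈ Finset.range N, (2 * ((k : ℂ) + 1) * c k) * ((b θ : ℂ) * bpt θ ^ (k + 1))).re := fun θ => by
    rw [nder, fderivWithin_harmN c₀ c N (bpt_mem_cdisc θ), hD_apply, deriv_pol, Finset.sum_mul]
    simp only [Complex.re_sum]
    rw [Finset.mul_sum, Finset.mul_sum]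
    refine Finset.sum_congr rfl fun k _ => ?_
    rw [show (2 * ((k : ℂ) + 1) * c k) * ((b θ : ℂ) * bpt θ ^ (k + 1)) =
      ((2 * b θ : ℝ) : ℂ) * (((k : ℂ) + 1) * c k * bpt θ ^ k * bpt θ) by push_cast; ring,
      Complex.re_ofReal_mul]
    ring
  have hcont : ∀ k : ℕ, Continuous fun θ => (2 * ((k : ℂ) + 1) * c k) * ((b θ : ℂ) * bpt θ ^ (k + 1)) :=
    fun k => continuous_const.mul ((Complex.continuous_ofReal.comp hbc).mul (continuous_bpt.pow _))
  rw [circInt_eq]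
  simp_rw [e1]
  have e2 : ∫ θ in (-π)..π, (∑ k ∈ Finset.range N,
      (2 * ((k : ℂ) + 1) * c k) * ((b θ : ℂ) * bpt θ ^ (k + 1))).re =
      (∫ θ in (-π)..π, ∑ k ∈ Finset.range N,
      (2 * ((k : ℂ) + 1) * c k) * ((b θ : ℂ) * bpt θ ^ (k + 1))).re := by
    exact Complex.reCLM.intervalIntegral_comp_comm
      ((continuous_finsetSum _ fun (k : ℕ) _ => hcont k).intervalIntegrable _ _)
  rw [e2, intervalIntegral.integral_finsetSum fun (k : ℕ) _ => (hcont k).intervalIntegrable _ _,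
    Complex.re_sum, Finset.mul_sum]
  refine Finset.sum_congr rfl fun k _ => ?_
  rw [intervalIntegral.integral_const_mul, integral_mul_bpt_pow]
  rw [show 2 * ((k : ℂ) + 1) * c k * (2 * π * (starRingEnd ℂ) (c k)) =
    ((4 * π * (k + 1) : ℝ) : ℂ) * (c k * (starRingEnd ℂ) (c k)) by push_cast; ring,
    Complex.mul_conj, ← Complex.ofReal_mul, Complex.ofReal_re, Complex.normSq_eq_norm_sq]
  ring

lemma gsq_sub (L M : ℂ →L[ℝ] ℝ) :
    gsq (L - M) = gsq L - 2 * (L 1 * M 1 + L Complex.I * M Complex.I) + gsq M := by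
  simp [gsq]; ring

lemma continuousOn_gsq {F : ℂ → ℂ →L[ℝ] ℝ} (hF : ContinuousOn F cdisc) :
    ContinuousOn (fun z => gsq (F z)) cdisc := continuous_gsq.comp_continuousOn hF

lemma continuousOn_fderivWithin_cdisc {u : ℂ → ℝ} (hu : ContDiffOn ℝ 1 u cdisc) :
    ContinuousOn (fun z => fderivWithin ℝ u cdisc z) cdisc :=
  hu.continuousOn_fderivWithin uniqueDiffOn_cdisc le_rfl

lemma integral_gsq_sub_harmN {u : ℂ → ℝ} (hu : ContDiffOn ℝ 1 u cdisc) (N : ℕ) :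
    ∫ z in odisc, gsq (fderivWithin ℝ u cdisc z - hD (deriv (pol (fcoef fun θ => u (bpt θ)) N) z)) =
      (∫ z in odisc, gsq (fderivWithin ℝ u cdisc z)) -
      4 * π * ∑ k ∈ Finset.range N, ((k : ℝ) + 1) * ‖fcoef (fun θ => u (bpt θ)) k‖ ^ 2 := by
  have h2 := circInt_mul_nder_harmN hu.continuousOn 0 N
  have h3 := green_disc hu (contDiff_harmN 0 (fcoef fun θ => u (bpt θ)) N).contDiffOn
  set c := fcoef fun θ => u (bpt θ)
  have hdc : Continuous (deriv (pol c N)) :=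
    ((differentiable_pol c N).contDiff (n := 2)).differentiable_deriv_two.continuous
  have hc1 := continuousOn_fderivWithin_cdisc hu
  have hc2 : ContinuousOn (fun z => hD (deriv (pol c N) z)) cdisc :=
    (continuous_hD.comp hdc).continuousOn
  have h4 : ∫ z in odisc, (fderivWithin ℝ u cdisc z 1 * hD (deriv (pol c N) z) 1 +
      fderivWithin ℝ u cdisc z Complex.I * hD (deriv (pol c N) z) Complex.I) =
      4 * π * ∑ k ∈ Finset.range N, ((k : ℝ) + 1) * ‖c k‖ ^ 2 := by
    rw [← h2, ← h3]
    refine setIntegral_congr_fun measurableSet_ball fun z hz => ?_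
    have hz' := odisc_subset_cdisc hz
    simp only [fderivWithin_harmN 0 c N hz', lapW_harmN 0 c N hz', mul_zero, add_zero]
  have h5 : ∫ z in odisc, gsq (hD (deriv (pol c N) z)) =
      4 * π * ∑ k ∈ Finset.range N, ((k : ℝ) + 1) * ‖c k‖ ^ 2 := by
    simp_rw [gsq_hD]
    rw [integral_const_mul, integral_norm_deriv_pol_sq]; ring
  simp_rw [gsq_sub]
  have i1 : IntegrableOn (fun z => gsq (fderivWithin ℝ u cdisc z)) odisc :=
    integrableOn_odisc (continuousOn_gsq hc1)
  have i3 : IntegrableOn (fun z => gsq (hD (deriv (pol c N) z))) odisc :=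
    integrableOn_odisc (continuousOn_gsq hc2)
  have i2 : IntegrableOn (fun z => 2 * (fderivWithin ℝ u cdisc z 1 * hD (deriv (pol c N) z) 1 +
      fderivWithin ℝ u cdisc z Complex.I * hD (deriv (pol c N) z) Complex.I)) odisc :=
    integrableOn_odisc (continuousOn_const.mul
      (((hc1.clm_apply continuousOn_const).mul (hc2.clm_apply continuousOn_const)).add
      ((hc1.clm_apply continuousOn_const).mul (hc2.clm_apply continuousOn_const))))
  rw [integral_add (f := fun z => gsq (fderivWithin ℝ u cdisc z) -
      2 * (fderivWithin ℝ u cdisc z 1 * hD (deriv (pol c N) z) 1 +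
      fderivWithin ℝ u cdisc z Complex.I * hD (deriv (pol c N) z) Complex.I)) (i1.sub i2) i3, integral_sub i1 i2, integral_const_mul, h4, h5]
  ring

lemma gsq_sub_le (L M : ℂ →L[ℝ] ℝ) : gsq (L - M) ≤ 2 * gsq L + 2 * gsq M := by
  simp only [gsq, sub_apply]
  nlinarith [sq_nonneg (L 1 + M 1), sq_nonneg (L Complex.I + M Complex.I)]

/-- Splitting of the Dirichlet energy into the harmonic part and the part vanishing on the circle. -/
lemma integral_gsq_sub_harm {u : ℂ → ℝ} (hu : ContDiffOn ℝ 1 u cdisc)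
    (hc : Summable fun k : ℕ => ((k : ℝ) + 1) * ‖fcoef (fun θ => u (bpt θ)) k‖) :
    ∫ z in odisc, gsq (fderivWithin ℝ u cdisc z - hD (serA' (fcoef fun θ => u (bpt θ)) z)) =
      (∫ z in odisc, gsq (fderivWithin ℝ u cdisc z)) -
      4 * π * ∑' k : ℕ, ((k : ℝ) + 1) * ‖fcoef (fun θ => u (bpt θ)) k‖ ^ 2 := by
  have hN := integral_gsq_sub_harmN hu
  set c := fcoef fun θ => u (bpt θ)
  have hc1 := continuousOn_fderivWithin_cdisc hu
  obtain ⟨C, hC0, hC⟩ := exists_bound_cdisc (continuousOn_gsq hc1)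
  set K := ∑' k : ℕ, ((k : ℝ) + 1) * ‖c k‖
  have hKb : ∀ z ∈ cdisc, ∀ N, ‖deriv (pol c N) z‖ ≤ K := fun z hz N => by
    rw [deriv_pol]
    refine (norm_sum_le _ _).trans ((Finset.sum_le_sum fun k _ => norm_serA'_term_le c hz k).trans ?_)
    exact hc.sum_le_tsum _ fun k _ => by positivity
  have hlim : Tendsto (fun N => ∫ z in odisc, gsq (fderivWithin ℝ u cdisc z - hD (deriv (pol c N) z)))
      atTop (𝓝 (∫ z in odisc, gsq (fderivWithin ℝ u cdisc z - hD (serA' c z)))) := by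
    refine tendsto_integral_of_dominated_convergence (fun _ => 2 * C + 8 * K ^ 2) (fun N => ?_)
      (integrableOn_odisc continuousOn_const) (fun N => ?_) ?_
    · have hdc : Continuous (deriv (pol c N)) :=
        ((differentiable_pol c N).contDiff (n := 2)).differentiable_deriv_two.continuous
      exact (integrableOn_odisc (continuousOn_gsq
        (hc1.sub (continuous_hD.comp hdc).continuousOn))).aestronglyMeasurable
    · refine (ae_restrict_iff' measurableSet_ball).2 (.of_forall fun z hz => ?_)
      have hz' := odisc_subset_cdisc hz
      rw [Real.norm_of_nonneg (gsq_nonneg _)]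
      refine (gsq_sub_le _ _).trans ?_
      rw [gsq_hD]
      have h1 := (le_abs_self _).trans (hC z hz')
      have h2 := pow_le_pow_left₀ (norm_nonneg _) (hKb z hz' N) 2
      linarith
    · refine (ae_restrict_iff' measurableSet_ball).2 (.of_forall fun z hz => ?_)
      have hz' := odisc_subset_cdisc hz
      have hs : HasSum (fun k : ℕ => ((k : ℂ) + 1) * c k * z ^ k) (serA' c z) :=
        (Summable.of_norm_bounded hc (norm_serA'_term_le c hz')).hasSum
      have h1 : Tendsto (fun N => deriv (pol c N) z) atTop (𝓝 (serA' c z)) := by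
        simp_rw [deriv_pol]; exact hs.tendsto_sum_nat
      exact (continuous_gsq.tendsto _).comp
        (tendsto_const_nhds.sub ((continuous_hD.tendsto _).comp h1))
  refine tendsto_nhds_unique hlim ?_
  simp_rw [hN]
  exact tendsto_const_nhds.sub (tendsto_const_nhds.mul
    (summable_weighted_sq hc).hasSum.tendsto_sum_nat)

lemma integrableOn_Icc_of_bdd {φ : ℝ → ℝ} {C : ℝ} (hc : ContinuousOn φ (Ioo 0 1))
    (hb : ∀ r ∈ Ioo (0:ℝ) 1, |φ r| ≤ C) : IntegrableOn φ (Icc 0 1) := by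
  rw [integrableOn_Icc_iff_integrableOn_Ioo]
  exact IntegrableOn.of_bound (C := C) (by simp)
    (hc.aestronglyMeasurable measurableSet_Ioo)
    ((ae_restrict_iff' measurableSet_Ioo).2 (.of_forall fun r hr => hb r hr))

/-- One-dimensional weighted Hardy inequality at the right end point. -/
lemma hardy_ray {f f' g : ℝ → ℝ} {K : ℝ} (hf : ContinuousOn f (Icc 0 1))
    (hb : ∀ r ∈ Icc (0:ℝ) 1, |f r| ≤ K * (1 - r)) (hd : ∀ r ∈ Ioo (0:ℝ) 1, HasDerivAt f (f' r) r)
    (hg : ContinuousOn g (Icc 0 1)) (hfg : ∀ r ∈ Ioo (0:ℝ) 1, f' r ^ 2 ≤ g r) :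
    ∫ r in Ioo (0:ℝ) 1, r * (f r / (1 - r)) ^ 2 ≤ 4 * ∫ r in Ioo (0:ℝ) 1, r * g r := by
  have hK : 0 ≤ K := by
    have := (abs_nonneg _).trans (hb 0 (by simp)); simpa using this
  have hq : ContinuousOn (fun r => f r / (1 - r)) (Ioo 0 1) :=
    (hf.mono Ioo_subset_Icc_self).div (by fun_prop) fun r hr => by linarith [hr.2]
  have hqb : ∀ r ∈ Icc (0:ℝ) 1, |f r / (1 - r)| ≤ K := fun r hr => by
    rcases eq_or_lt_of_le hr.2 with h | h
    · simp [h, hK]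
    · rw [abs_div, abs_of_pos (sub_pos.2 h), div_le_iff₀ (sub_pos.2 h)]; exact hb r hr
  have hi1 : IntegrableOn (fun r => r * (f r / (1 - r)) ^ 2) (Icc 0 1) := by
    refine integrableOn_Icc_of_bdd (C := 1 * K ^ 2) (continuousOn_id.mul (hq.pow 2)) fun r hr => ?_
    rw [abs_mul, abs_pow, abs_of_pos hr.1]
    exact mul_le_mul hr.2.le (pow_le_pow_left₀ (abs_nonneg _) (hqb r (Ioo_subset_Icc_self hr)) 2)
      (by positivity) zero_le_one
  have hi2 : IntegrableOn (fun r => r * g r) (Icc 0 1) :=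
    (continuousOn_id.mul hg).integrableOn_compact isCompact_Icc
  have hF : ContinuousOn (fun r => f r ^ 2 * r / (1 - r)) (Icc 0 1) := by
    intro r hr
    rcases eq_or_lt_of_le hr.2 with h | h
    · subst h
      have h0 : f 1 ^ 2 * 1 / (1 - 1) = 0 := by simp
      rw [ContinuousWithinAt, h0]
      refine squeeze_zero_norm' (a := fun r => K ^ 2 * (1 - r)) ?_ ?_
      · filter_upwards [self_mem_nhdsWithin] with r hr
        rcases eq_or_lt_of_le hr.2 with h | h
        · simp [h]
        · have h1 := hb r hr
          have h2 : f r ^ 2 ≤ (K * (1 - r)) ^ 2 := by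
            rw [← sq_abs]; exact pow_le_pow_left₀ (abs_nonneg _) h1 2
          have h3 : 0 < 1 - r := sub_pos.2 h
          rw [Real.norm_of_nonneg (div_nonneg (mul_nonneg (sq_nonneg _) hr.1) h3.le),
            div_le_iff₀ h3]
          nlinarith [mul_le_mul h2 hr.2 hr.1 (sq_nonneg _)]
      · have : Tendsto (fun r : ℝ => K ^ 2 * (1 - r)) (𝓝 1) (𝓝 (K ^ 2 * (1 - 1))) :=
          Continuous.tendsto (by fun_prop) 1
        simpa using this.mono_left nhdsWithin_le_nhds
    · exact ContinuousWithinAt.div (((hf r hr).pow 2).mul continuousWithinAt_id)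
        (by fun_prop) (by linarith)
  have key := intervalIntegral.integral_le_sub_of_hasDeriv_right_of_le
    (g := fun r => f r ^ 2 * r / (1 - r))
    (g' := fun r => ((2 * f r * f' r * r + f r ^ 2) * (1 - r) + f r ^ 2 * r) / (1 - r) ^ 2)
    (φ := fun r => 1 / 2 * (r * (f r / (1 - r)) ^ 2) - 2 * (r * g r)) zero_le_one hF
    (fun r hr => by
      have h1 := (((hd r hr).pow 2).mul (hasDerivAt_id r)).div ((hasDerivAt_id r).const_sub 1)
        (by simp; linarith [hr.2])
      refine (h1.congr_deriv ?_).hasDerivWithinAt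
      simp)
    (by exact (hi1.const_mul _).sub (hi2.const_mul _))
    (fun r hr => by
      have h3 : 0 < 1 - r := sub_pos.2 hr.2
      have h4 := hfg r hr
      have e : ((2 * f r * f' r * r + f r ^ 2) * (1 - r) + f r ^ 2 * r) / (1 - r) ^ 2 =
        2 * (f r / (1 - r)) * f' r * r + f r ^ 2 / (1 - r) + r * (f r / (1 - r)) ^ 2 := by
        field_simp
      rw [e]
      have h5 : 0 ≤ f r ^ 2 / (1 - r) := by positivity
      nlinarith [mul_nonneg hr.1.le (sq_nonneg (f r / (1 - r) + 2 * f' r)),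
        mul_le_mul_of_nonneg_left h4 hr.1.le])
  rw [intervalIntegral.integral_of_le zero_le_one, integral_Ioc_eq_integral_Ioo,
    integral_sub ((hi1.mono_set Ioo_subset_Icc_self).const_mul _)
      ((hi2.mono_set Ioo_subset_Icc_self).const_mul _), integral_const_mul, integral_const_mul] at key
  simp at key
  linarith

/-- A `C¹` function on the disc vanishing on the circle. -/
structure ZB (w : ℂ → ℝ) (dw : ℂ → ℂ →L[ℝ] ℝ) : Prop where
  cont : ContinuousOn w cdisc
  contD : ContinuousOn dw cdisc
  zero : ∀ z ∈ bdry, w z = 0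
  deriv : ∀ z ∈ odisc, HasFDerivAt w (dw z) z

section
variable {w : ℂ → ℝ} {dw : ℂ → ℂ →L[ℝ] ℝ}

lemma eq_norm_mul_bpt (z : ℂ) : ((‖z‖ : ℝ) : ℂ) * bpt (Complex.arg z) = z :=
  Complex.norm_mul_exp_arg_mul_I z

lemma ZB.exists_abs_le (h : ZB w dw) : ∃ K, 0 ≤ K ∧ ∀ z ∈ cdisc, |w z| ≤ K * (1 - ‖z‖) := by
  obtain ⟨K, hK⟩ := isCompact_cdisc.exists_bound_of_continuousOn h.contD
  have hK0 : 0 ≤ K := (norm_nonneg _).trans (hK 0 (by simp [cdisc]))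
  lift K to NNReal using hK0
  refine ⟨K, K.2, fun z hz => ?_⟩
  have hl : LipschitzOnWith K w odisc := (convex_ball (0:ℂ) 1).lipschitzOnWith_of_nnnorm_hasFDerivWithin_le
    (fun x hx => (h.deriv x hx).hasFDerivWithinAt)
    fun x hx => by exact_mod_cast hK x (odisc_subset_cdisc hx)
  have hcl : closure odisc = cdisc := closure_ball _ one_ne_zero
  have hl2 : LipschitzOnWith K w cdisc := by
    rw [← hcl]; exact hl.closure (by rw [hcl]; exact h.cont)
  have h1 := hl2.dist_le_mul z hz (bpt (Complex.arg z)) (bpt_mem_cdisc _)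
  rw [Real.dist_eq, h.zero _ (bpt_mem_bdry _), sub_zero] at h1
  have e : z - bpt z.arg = ((‖z‖ - 1 : ℝ) : ℂ) * bpt z.arg := by
    push_cast; rw [sub_mul, eq_norm_mul_bpt, one_mul]
  rw [dist_eq_norm, e, norm_mul, norm_bpt, mul_one, Complex.norm_real, Real.norm_eq_abs,
    abs_sub_comm, abs_of_nonneg (a := 1 - ‖z‖) (by linarith [mem_cdisc.1 hz])] at h1
  exact h1

lemma continuousOn_ray {φ : ℂ → ℝ} (hφ : ContinuousOn φ cdisc) (θ : ℝ) :
    ContinuousOn (fun r : ℝ => φ (r * bpt θ)) (Icc 0 1) :=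
  hφ.comp (Complex.continuous_ofReal.mul continuous_const).continuousOn
    fun _ hr => smul_bpt_mem_cdisc hr.1 hr.2 θ

lemma hasDerivAt_ray {φ : ℂ → ℝ} {L : ℂ →L[ℝ] ℝ} {x : ℂ} {θ r : ℝ}
    (h : HasFDerivAt φ L (x + r * bpt θ)) :
    HasDerivAt (fun r : ℝ => φ (x + r * bpt θ)) (L (bpt θ)) r := by
  have h1 : HasDerivAt (fun r : ℝ => x + (r : ℂ) * bpt θ) (bpt θ) r := by
    simpa using ((Complex.ofRealCLM.hasDerivAt (x := r)).mul_const (bpt θ)).const_add x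
  exact h.comp_hasDerivAt r h1

lemma ZB.continuousOn_quot (h : ZB w dw) : ContinuousOn (fun z => (w z / (1 - ‖z‖)) ^ 2) odisc :=
  ((h.cont.mono odisc_subset_cdisc).div (by fun_prop)
    fun z hz => by linarith [mem_odisc.1 hz]).pow 2

lemma ZB.exists_quot_le (h : ZB w dw) : ∃ K, ∀ z ∈ odisc, |(w z / (1 - ‖z‖)) ^ 2| ≤ K := by
  obtain ⟨K, hK0, hK⟩ := h.exists_abs_le
  refine ⟨K ^ 2, fun z hz => ?_⟩
  have h1 : 0 < 1 - ‖z‖ := by linarith [mem_odisc.1 hz]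
  rw [abs_pow]
  refine pow_le_pow_left₀ (abs_nonneg _) ?_ 2
  rw [abs_div, abs_of_pos h1, div_le_iff₀ h1]
  exact hK z (odisc_subset_cdisc hz)

lemma ZB.integrableOn_quot (h : ZB w dw) :
    IntegrableOn (fun z => (w z / (1 - ‖z‖)) ^ 2) odisc := by
  obtain ⟨K, hK⟩ := h.exists_quot_le
  exact IntegrableOn.of_bound (C := K) measure_ball_lt_top
    (h.continuousOn_quot.aestronglyMeasurable measurableSet_ball)
    ((ae_restrict_iff' measurableSet_ball).2 (.of_forall fun r hr => hK r hr))

lemma integrableOn_angle {φ : ℂ → ℝ} {C : ℝ} (hc : ContinuousOn φ odisc)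
    (hb : ∀ z ∈ odisc, |φ z| ≤ C) :
    IntegrableOn (fun θ => ∫ r in Ioo (0:ℝ) 1, r * φ (0 + r * bpt θ)) (Ioo (-π) π) := by
  have := integrableOn_polar hc hb
  rw [IntegrableOn, ← Measure.prod_restrict] at this
  exact this.integral_prod_right

/-- Hardy's inequality on the disc. -/
lemma ZB.hardy (h : ZB w dw) :
    ∫ z in odisc, (w z / (1 - ‖z‖)) ^ 2 ≤ 4 * ∫ z in odisc, gsq (dw z) := by
  obtain ⟨K, hK0, hK⟩ := h.exists_abs_le
  obtain ⟨K2, hK2⟩ := h.exists_quot_le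
  obtain ⟨K3, _, hK3⟩ := exists_bound_cdisc (continuousOn_gsq h.contD)
  have hgc : ContinuousOn (fun z => gsq (dw z)) odisc :=
    (continuousOn_gsq h.contD).mono odisc_subset_cdisc
  have hK3' : ∀ z ∈ odisc, |gsq (dw z)| ≤ K3 := fun z hz => hK3 z (odisc_subset_cdisc hz)
  have e1 := integral_ball_polar_θ h.continuousOn_quot hK2
  have e2 := integral_ball_polar_θ hgc hK3'
  rw [← odisc] at e1 e2
  rw [e1, e2, ← integral_const_mul]
  refine setIntegral_mono_on (integrableOn_angle h.continuousOn_quot hK2)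
    ((integrableOn_angle hgc hK3').const_mul _) measurableSet_Ioo fun θ _ => ?_
  simp only [zero_add]
  have := hardy_ray (f := fun r => w (r * bpt θ)) (f' := fun r => dw (r * bpt θ) (bpt θ))
    (g := fun r => gsq (dw (r * bpt θ))) (K := K) (continuousOn_ray h.cont θ)
    (fun r hr => by
      have := hK _ (smul_bpt_mem_cdisc hr.1 hr.2 θ)
      simpa [norm_bpt, abs_of_nonneg hr.1] using this)
    (fun r hr => by
      simpa using hasDerivAt_ray (x := 0) (by
        simpa using h.deriv _ (smul_bpt_mem_odisc hr.1.le hr.2 θ)))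
    (continuousOn_ray (continuousOn_gsq h.contD) θ)
    (fun r hr => by
      have := abs_apply_le_sqrt_gsq (dw (r * bpt θ)) (bpt θ)
      rw [norm_bpt, mul_one] at this
      rw [← sq_abs]
      calc _ ≤ (√(gsq (dw (r * bpt θ)))) ^ 2 := pow_le_pow_left₀ (abs_nonneg _) this 2
        _ = _ := Real.sq_sqrt (gsq_nonneg _))
  refine le_trans (le_of_eq ?_) this
  refine setIntegral_congr_fun measurableSet_Ioo fun r hr => ?_
  simp [norm_bpt, abs_of_pos hr.1]
end

lemma integral_ball_const (x : ℂ) {R : ℝ} (hR : 0 ≤ R) (a : ℝ) :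
    ∫ _ in ball x R, a = π * R ^ 2 * a := by
  rw [setIntegral_const, smul_eq_mul, Measure.real, Complex.volume_ball]
  simp [ENNReal.toReal_ofReal hR]; left; ring

section
variable {c : ℕ → ℂ} (hc : Summable fun k : ℕ => ((k : ℝ) + 1) * ‖c k‖) (c₀ : ℝ)
include hc

lemma integral_circle_harm {x : ℂ} {r : ℝ} (hr : 0 ≤ r) (hx : closedBall x r ⊆ odisc) :
    ∫ θ in (-π)..π, harm c₀ c (x + r * bpt θ) = 2 * π * harm c₀ c x := by
  have hcl : closure (ball x |r|) ⊆ odisc :=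
    closure_ball_subset_closedBall.trans (by rwa [abs_of_nonneg hr])
  have hd : DifferentiableOn ℂ (serA c) odisc :=
    fun z hz => (hasDerivAt_serA hc hz).differentiableAt.differentiableWithinAt
  have hdc : DiffContOnCl ℂ (serA c) (ball x |r|) :=
    (hd.mono hcl).diffContOnCl
  have h1 := hdc.circleAverage
  rw [Real.circleAverage_def, inv_smul_eq_iff₀ (by positivity)] at h1
  have hmem : ∀ θ, x + r * bpt θ ∈ odisc := fun θ => hx (by simp [norm_bpt, abs_of_nonneg hr])
  have hcont : Continuous fun θ => serA c (x + r * bpt θ) :=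
    (continuousOn_serA hc).comp_continuous (continuous_const.add (continuous_const.mul continuous_bpt))
      fun θ => odisc_subset_cdisc (hmem θ)
  have e := circInt_eq (fun z => harm c₀ c (x + r * z))
  rw [← e, circInt]
  have h2 : ∫ θ in (0:ℝ)..2 * π, (serA c (x + r * bpt θ)).re = 2 * π * (serA c x).re := by
    have h3 : ∫ θ in (0:ℝ)..2 * π, (serA c (x + r * bpt θ)).re =
        (∫ θ in (0:ℝ)..2 * π, serA c (x + r * bpt θ)).re :=
      Complex.reCLM.intervalIntegral_comp_comm (hcont.intervalIntegrable _ _)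
    rw [h3]
    have h4 := congrArg Complex.re h1
    simpa [circleMap, bpt] using h4
  have hi : IntervalIntegrable (fun θ => 2 * (serA c (x + r * bpt θ)).re) volume 0 (2 * π) :=
    (continuous_const.mul (Complex.continuous_re.comp hcont)).intervalIntegrable _ _
  simp only [harm]
  rw [intervalIntegral.integral_add intervalIntegrable_const hi,
    intervalIntegral.integral_const_mul, h2]
  simp; ring

/-- Mean value property of `harm` over balls. -/
lemma integral_ball_harm {x : ℂ} {R : ℝ} (hR : 0 ≤ R) (hx : closedBall x R ⊆ odisc) :
    ∫ y in ball x R, harm c₀ c y = π * R ^ 2 * harm c₀ c x := by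
  obtain ⟨C, _, hC⟩ := exists_bound_cdisc (continuousOn_harm hc c₀)
  have hs : ball x R ⊆ cdisc := (ball_subset_closedBall.trans hx).trans odisc_subset_cdisc
  rw [integral_ball_polar_r ((continuousOn_harm hc c₀).mono hs) (fun y hy => hC y (hs hy))]
  have e : ∀ r ∈ Ioo 0 R, ∫ θ in Ioo (-π) π, r * harm c₀ c (x + r * bpt θ) =
      r * (2 * π * harm c₀ c x) := fun r hr => by
    rw [integral_const_mul, ← integral_Ioc_eq_integral_Ioo,
      ← intervalIntegral.integral_of_le (by linarith [Real.pi_pos]),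
      integral_circle_harm hc c₀ hr.1.le ((closedBall_subset_closedBall hr.2.le).trans hx)]
  rw [setIntegral_congr_fun measurableSet_Ioo e, integral_mul_const, ← integral_Ioc_eq_integral_Ioo,
      ← intervalIntegral.integral_of_le hR, integral_id]
  ring
end

lemma closedBall_half_subset {x : ℂ} (hx : x ∈ odisc) : closedBall x ((1 - ‖x‖) / 2) ⊆ odisc := by
  intro y hy
  have h1 := mem_odisc.1 hx
  rw [mem_closedBall, dist_eq_norm] at hy
  have h2 := norm_add_le x (y - x)
  rw [add_sub_cancel] at h2
  exact mem_odisc.2 (by linarith)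

lemma ZB.integral_ball_abs_le {w : ℂ → ℝ} {dw : ℂ → ℂ →L[ℝ] ℝ} (h : ZB w dw) {x : ℂ}
    (hx : x ∈ odisc) :
    ∫ y in ball x ((1 - ‖x‖) / 2), |w y| ≤
      π * ((1 - ‖x‖) / 2) ^ 2 * (7 * √(∫ z in odisc, gsq (dw z)) + 1) := by
  set R := (1 - ‖x‖) / 2 with hR
  have hx1 := mem_odisc.1 hx
  have hR0 : 0 < R := by rw [hR]; linarith
  set G := ∫ z in odisc, gsq (dw z) with hG
  have hG0 : 0 ≤ G := integral_nonneg fun z => gsq_nonneg _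
  set l := √G + 1 with hl
  have hl0 : 0 < l := by positivity
  have hs : ball x R ⊆ odisc := ball_subset_closedBall.trans (closedBall_half_subset hx)
  have i1 : IntegrableOn (fun z => (w z / (1 - ‖z‖)) ^ 2) (ball x R) := h.integrableOn_quot.mono_set hs
  have h1 : ∫ y in ball x R, (w y / (1 - ‖y‖)) ^ 2 ≤ 4 * G :=
    (setIntegral_mono_set h.integrableOn_quot (.of_forall fun z => sq_nonneg _)
      (LE.le.eventuallyLE hs)).trans h.hardy
  have i0 : IntegrableOn (fun z => |w z|) (ball x R) := (integrableOn_odisc h.cont.abs).mono_set hs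
  have ic : ∀ a : ℝ, IntegrableOn (fun _ : ℂ => a) (ball x R) := fun a =>
    (integrableOn_odisc continuousOn_const).mono_set hs
  have h2 : ∫ y in ball x R, |w y| ≤
      ∫ y in ball x R, (l / 2 + 9 * R ^ 2 / (2 * l) * (w y / (1 - ‖y‖)) ^ 2) := by
    refine setIntegral_mono_on i0 ((ic _).add (i1.const_mul _)) measurableSet_ball fun y hy => ?_
    have hy1 := mem_odisc.1 (hs hy)
    have h3 : 1 - ‖y‖ ≤ 3 * R := by
      have := norm_sub_norm_le x y
      rw [mem_ball, dist_comm, dist_eq_norm] at hy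
      linarith
    have h4 : 0 < 1 - ‖y‖ := by linarith
    set q := w y / (1 - ‖y‖) with hq
    have h5 : |w y| ≤ 3 * R * |q| := by
      have : w y = q * (1 - ‖y‖) := by rw [hq]; field_simp
      rw [this, abs_mul, abs_of_pos h4, mul_comm]
      exact mul_le_mul_of_nonneg_right h3 (abs_nonneg _)
    have h6 : 0 ≤ (l - 3 * R * |q|) ^ 2 / (2 * l) := by positivity
    have h7 : l / 2 + 9 * R ^ 2 / (2 * l) * q ^ 2 - 3 * R * |q| = (l - 3 * R * |q|) ^ 2 / (2 * l) := by
      rw [← sq_abs q]; field_simp; ring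
    linarith
  rw [integral_add (ic _) (i1.const_mul _), integral_ball_const x hR0.le, integral_const_mul] at h2
  refine h2.trans ?_
  have h8 : 9 * R ^ 2 / (2 * l) * ∫ y in ball x R, (w y / (1 - ‖y‖)) ^ 2 ≤ 18 * R ^ 2 * √G := by
    calc _ ≤ 9 * R ^ 2 / (2 * l) * (4 * G) := mul_le_mul_of_nonneg_left h1 (by positivity)
      _ ≤ 18 * R ^ 2 * √G := by
        rw [div_mul_eq_mul_div, div_le_iff₀ (by positivity)]
        have := Real.mul_self_sqrt hG0
        have h9 := Real.sqrt_nonneg G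
        have h10 : G ≤ √G * l := by rw [hl]; nlinarith
        nlinarith [mul_le_mul_of_nonneg_left h10 (sq_nonneg R)]
  have hpi := Real.pi_gt_three
  have h11 : 18 * R ^ 2 * √G ≤ 6 * (π * R ^ 2 * √G) := by
    nlinarith [mul_nonneg (sq_nonneg R) (Real.sqrt_nonneg G)]
  have h12 : 0 ≤ π * R ^ 2 * √G := by positivity
  have h13 : 0 ≤ π * R ^ 2 := by positivity
  rw [hl]
  linarith

/-- Pointwise upper bound for the harmonic part in terms of the volume. -/
lemma two_harm_le {u w : ℂ → ℝ} {dw : ℂ → ℂ →L[ℝ] ℝ} {c : ℕ → ℂ}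
    (hc : Summable fun k : ℕ => ((k : ℝ) + 1) * ‖c k‖) {c₀ : ℝ} (h : ZB w dw)
    (hu : ContinuousOn u cdisc) (hdec : ∀ z, u z = harm c₀ c z + w z) {x : ℂ} (hx : x ∈ odisc) :
    2 * harm c₀ c x ≤
      Real.log ((∫ z in odisc, Real.exp (2 * u z)) / (π * ((1 - ‖x‖) / 2) ^ 2)) +
      2 * (7 * √(∫ z in odisc, gsq (dw z)) + 1) := by
  have h1 := h.integral_ball_abs_le hx
  have h2 := integral_ball_harm hc c₀ (by linarith [mem_odisc.1 hx]) (closedBall_half_subset hx)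
  set R := (1 - ‖x‖) / 2 with hR
  have hx1 := mem_odisc.1 hx
  have hR0 : 0 < R := by rw [hR]; linarith
  have hs : ball x R ⊆ odisc := ball_subset_closedBall.trans (closedBall_half_subset hx)
  set V := ∫ z in odisc, Real.exp (2 * u z)
  have hce : ContinuousOn (fun z => Real.exp (2 * u z)) cdisc := (continuousOn_const.mul hu).rexp
  have hVR : ∫ z in ball x R, Real.exp (2 * u z) ≤ V :=
    setIntegral_mono_set (integrableOn_odisc hce) (.of_forall fun z => (Real.exp_pos _).le)
      (LE.le.eventuallyLE hs)
  have hP : 0 < π * R ^ 2 := by positivity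
  have hV : 0 < V := by
    refine lt_of_lt_of_le ?_ hVR
    refine (setIntegral_pos_iff_support_of_nonneg_ae (.of_forall fun z => (Real.exp_pos _).le)
      ((integrableOn_odisc hce).mono_set hs)).2 ?_
    have : Function.support (fun z => Real.exp (2 * u z)) = univ := by
      ext z; simp [(Real.exp_pos _).ne']
    rw [this, univ_inter]; exact measure_ball_pos _ _ hR0
  set a := Real.log (V / (π * R ^ 2))
  have ha : Real.exp (-a) * V = π * R ^ 2 := by
    rw [Real.exp_neg, Real.exp_log (by positivity)]; field_simp
  have ic : ∀ b : ℝ, IntegrableOn (fun _ : ℂ => b) (ball x R) := fun b =>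
    (integrableOn_odisc continuousOn_const).mono_set hs
  have i1 : IntegrableOn (fun z => Real.exp (-a) * Real.exp (2 * u z)) (ball x R) :=
    ((integrableOn_odisc hce).mono_set hs).const_mul _
  have i2 : IntegrableOn (fun z => 2 * |w z|) (ball x R) :=
    ((integrableOn_odisc h.cont.abs).mono_set hs).const_mul _
  have i3 : IntegrableOn (fun z => (a - 1) + Real.exp (-a) * Real.exp (2 * u z)) (ball x R) :=
    (ic _).add i1
  have key : ∫ y in ball x R, 2 * harm c₀ c y ≤
      ∫ y in ball x R, (((a - 1) + Real.exp (-a) * Real.exp (2 * u y)) + 2 * |w y|) := by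
    refine setIntegral_mono_on (((integrableOn_odisc (continuousOn_harm hc c₀)).mono_set hs).const_mul _)
      (i3.add i2) measurableSet_ball fun y hy => ?_
    have e1 := Real.add_one_le_exp (-a + 2 * u y)
    rw [Real.exp_add] at e1
    have e2 := hdec y
    have e3 := neg_abs_le (w y)
    linarith
  rw [integral_const_mul, h2, integral_add i3 i2, integral_add (ic _) i1, integral_ball_const x hR0.le,
    integral_const_mul, integral_const_mul] at key
  have h4 : Real.exp (-a) * ∫ z in ball x R, Real.exp (2 * u z) ≤ π * R ^ 2 := by
    rw [← ha]; exact mul_le_mul_of_nonneg_left hVR (Real.exp_pos _).le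
  have h5 : π * R ^ 2 * (2 * harm c₀ c x) ≤
      π * R ^ 2 * (a + 2 * (7 * √(∫ z in odisc, gsq (dw z)) + 1)) := by linarith
  exact le_of_mul_le_mul_left h5 hP

/-- Boundary length of the metric `e^{2u}|dz|²`. -/
def lenU (u : ℂ → ℝ) : ℝ := circInt fun z => Real.exp (u z)

/-- Area of the metric `e^{2u}|dz|²`. -/
def volU (u : ℂ → ℝ) : ℝ := ∫ z in odisc, Real.exp (2 * u z)

/-- The quadratic part of the energy. -/
def quadU (u : ℂ → ℝ) : ℝ :=
  1 / 2 * (∫ z in odisc, gsq (fderivWithin ℝ u cdisc z)) + circInt u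

lemma circInt_pos {φ : ℂ → ℝ} (hφ : ContinuousOn φ bdry) (h : ∀ z ∈ bdry, 0 < φ z) :
    0 < circInt φ :=
  intervalIntegral.intervalIntegral_pos_of_pos
    ((hφ.comp_continuous continuous_bpt bpt_mem_bdry).intervalIntegrable _ _)
    (fun θ => h _ (bpt_mem_bdry θ)) (by positivity)

lemma ballInt_pos {φ : ℂ → ℝ} (hφ : ContinuousOn φ cdisc) (h : ∀ z ∈ cdisc, 0 < φ z) :
    0 < ∫ z in odisc, φ z := by
  refine (setIntegral_pos_iff_support_of_nonneg_ae
    ((ae_restrict_iff' measurableSet_ball).2 (.of_forall fun z hz => (h z (odisc_subset_cdisc hz)).le))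
    (integrableOn_odisc hφ)).2 ?_
  refine lt_of_lt_of_le (measure_ball_pos volume (0:ℂ) one_pos) (measure_mono ?_)
  exact fun z hz => ⟨(h z (odisc_subset_cdisc hz)).ne', hz⟩

lemma lenU_pos {u : ℂ → ℝ} (hu : ContinuousOn u cdisc) : 0 < lenU u :=
  circInt_pos (hu.mono bdry_subset_cdisc).rexp fun _ _ => Real.exp_pos _

lemma volU_pos {u : ℂ → ℝ} (hu : ContinuousOn u cdisc) : 0 < volU u :=
  ballInt_pos (continuousOn_const.mul hu).rexp fun _ _ => Real.exp_pos _

/-- Splitting of a smooth function into its harmonic extension and a remainder vanishing on the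
circle. -/
lemma exists_decomp {u : ℂ → ℝ} (hu : ContDiffOn ℝ (⊤ : ℕ∞) u cdisc) :
    ∃ (c₀ : ℝ) (c : ℕ → ℂ) (w : ℂ → ℝ) (dw : ℂ → ℂ →L[ℝ] ℝ),
      (Summable fun k : ℕ => ((k : ℝ) + 1) * ‖c k‖) ∧ ZB w dw ∧ (∀ z, u z = harm c₀ c z + w z) ∧
      circInt (fun z => Real.exp (harm c₀ c z)) = lenU u ∧
      1 / 2 * (∫ z in odisc, gsq (dw z)) +
        2 * π * (c₀ + ∑' k : ℕ, ((k : ℝ) + 1) * ‖c k‖ ^ 2) = quadU u := by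
  set b : ℝ → ℝ := fun θ => u (bpt θ) with hb
  have hbs : ContDiff ℝ (⊤ : ℕ∞) b := by
    have := hu.comp contDiff_bpt.contDiffOn (s := univ) fun θ _ => bpt_mem_cdisc θ
    exact contDiffOn_univ.1 this
  have hbp : Function.Periodic b (2 * π) := fun θ => by simp only [hb, bpt_periodic θ]
  have hc := summable_fcoef hbs hbp
  have hu1 : ContDiffOn ℝ 1 u cdisc := hu.of_le (by exact_mod_cast le_top)
  set c₀ := 1 / (2 * π) * ∫ θ in (-π)..π, b θ with hc₀
  have hbd : ∀ θ, harm c₀ (fcoef b) (bpt θ) = u (bpt θ) := harm_fcoef_eq hbs.continuous hbp hc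
  refine ⟨c₀, fcoef b, fun z => u z - harm c₀ (fcoef b) z,
    fun z => fderivWithin ℝ u cdisc z - hD (serA' (fcoef b) z), hc, ⟨?_, ?_, ?_, ?_⟩,
    fun z => by ring, ?_, ?_⟩
  · exact hu.continuousOn.sub (continuousOn_harm hc c₀)
  · exact (continuousOn_fderivWithin_cdisc hu1).sub
      (continuous_hD.comp_continuousOn (continuousOn_serA' hc))
  · intro z hz
    have hz1 : ‖z‖ = 1 := by simpa [bdry] using hz
    have e := eq_norm_mul_bpt z
    rw [hz1, Complex.ofReal_one, one_mul] at e
    rw [← e, hbd, sub_self]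
  · exact fun z hz => (hasFDerivAt_of_cdisc hu1 hz).sub (hasFDerivAt_harm hc c₀ hz)
  · simp only [lenU, circInt, hbd]
  · rw [integral_gsq_sub_harm hu1 hc, quadU, circInt_eq u]
    have : 2 * π * c₀ = ∫ θ in (-π)..π, u (bpt θ) := by rw [hc₀]; field_simp; rfl
    rw [mul_add, this]; ring

lemma log_lenU_le_of_sup {c : ℕ → ℂ} (hc : Summable fun k : ℕ => ((k : ℝ) + 1) * ‖c k‖) {c₀ s : ℝ}
    (hS : ∀ z ∈ odisc, (1 - ‖z‖ ^ 2) * Real.exp (harm c₀ c z) ≤ Real.exp s) :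
    Real.log (circInt (fun z => Real.exp (harm c₀ c z))) ≤
      Real.log (10 * π) + s / 2 + (c₀ + ∑' k : ℕ, ((k : ℝ) + 1) * ‖c k‖ ^ 2) / 2 := by
  have hpos : 0 < circInt (fun z => Real.exp (harm c₀ c z)) := lenU_pos (continuousOn_harm hc c₀)
  have h := circInt_exp_harm_le_of_sup hc c₀ hS
  rw [Real.log_le_iff_le_exp hpos, Real.exp_add, Real.exp_add, Real.exp_log (by positivity)]
  rwa [← Real.exp_half] at h

/-- Lower bound of the area by the boundary length and the quadratic energy. -/
lemma exists_log_lenU_le : ∃ C : ℝ, ∀ u : ℂ → ℝ, ContDiffOn ℝ (⊤ : ℕ∞) u cdisc →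
    Real.log (lenU u) ≤ C + 1 / 4 * Real.log (volU u) + quadU u / (4 * π) := by
  refine ⟨Real.log (10 * π) + (Real.log 4 - 1 / 2 * Real.log π + 1) / 2 + 49 / 2 * π, fun u hu => ?_⟩
  obtain ⟨c₀, c, w, dw, hc, hZ, hdec, hlen, hq⟩ := exists_decomp hu
  have hV : 0 < volU u := volU_pos hu.continuousOn
  set G := ∫ z in odisc, gsq (dw z) with hG
  have hG0 : 0 ≤ G := integral_nonneg fun z => gsq_nonneg _
  have h1 := log_lenU_le_of_sup hc (c₀ := c₀)
    (s := Real.log 4 - 1 / 2 * Real.log π + 1 + 1 / 2 * Real.log (volU u) + 7 * √G)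
    (fun z hz => by
      have h2 := two_harm_le hc hZ hu.continuousOn hdec hz
      rw [← hG, ← volU] at h2
      have hz1 := mem_odisc.1 hz
      set R := (1 - ‖z‖) / 2 with hR
      have hR0 : 0 < R := by rw [hR]; linarith
      rw [Real.log_div hV.ne' (by positivity), Real.log_mul (by positivity) (by positivity),
        Real.log_pow] at h2
      push_cast at h2
      have h3 : 1 - ‖z‖ ^ 2 ≤ 4 * R := by rw [hR]; nlinarith [norm_nonneg z]
      have h4 : harm c₀ c z + Real.log R + Real.log 4 ≤
        Real.log 4 - 1 / 2 * Real.log π + 1 + 1 / 2 * Real.log (volU u) + 7 * √G := by linarith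
      refine le_trans ?_ (Real.exp_le_exp.2 h4)
      rw [Real.exp_add, Real.exp_add, Real.exp_log hR0, Real.exp_log (by norm_num)]
      nlinarith [mul_le_mul_of_nonneg_right h3 (Real.exp_pos (harm c₀ c z)).le])
  rw [hlen] at h1
  set X := c₀ + ∑' k : ℕ, ((k : ℝ) + 1) * ‖c k‖ ^ 2
  have hX : X / 2 = quadU u / (4 * π) - G / (8 * π) := by
    rw [← hq]; field_simp; ring
  have h5 : 7 * √G / 2 ≤ G / (8 * π) + 49 / 2 * π := by
    have e := Real.mul_self_sqrt hG0
    have : G / (8 * π) + 49 / 2 * π - 7 * √G / 2 = (√G - 14 * π) ^ 2 / (8 * π) := by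
      have : (√G - 14 * π) ^ 2 = G - 28 * π * √G + 196 * π ^ 2 := by nlinarith
      rw [this]; field_simp; ring
    have h6 : 0 ≤ (√G - 14 * π) ^ 2 / (8 * π) := by positivity
    linarith
  linarith

/-- Lebedev–Milin inequality in terms of the boundary length. -/
lemma log_circInt_exp_harm_le {c : ℕ → ℂ} (hc : Summable fun k : ℕ => ((k : ℝ) + 1) * ‖c k‖)
    (c₀ : ℝ) : Real.log (circInt (fun z => Real.exp (harm c₀ c z))) ≤
      2 * Real.log (10 * π) + (c₀ + ∑' k : ℕ, ((k : ℝ) + 1) * ‖c k‖ ^ 2) := by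
  have hpos : 0 < circInt (fun z => Real.exp (harm c₀ c z)) := lenU_pos (continuousOn_harm hc c₀)
  have h1 := log_lenU_le_of_sup hc (c₀ := c₀)
    (s := Real.log (circInt (fun z => Real.exp (harm c₀ c z)))) (fun z hz => by
      rw [Real.exp_log hpos]
      refine (one_sub_sq_mul_exp_harm_le hc c₀ hz).trans (div_le_self hpos.le ?_)
      linarith [Real.pi_gt_three])
  linarith

lemma lintegral_ball_radial {φ : ℝ → ℝ≥0∞} (hφ : Measurable φ) (x : ℂ) (S : ℝ) :
    ∫⁻ y in ball x S, φ ‖y - x‖ =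
      ENNReal.ofReal (2 * π) * ∫⁻ r in Ioo (0 : ℝ) S, ENNReal.ofReal r * φ r := by
  rw [lintegral_ball_polar, Measure.volume_eq_prod, ← Measure.prod_restrict]
  have h1 : ∫⁻ p, ENNReal.ofReal p.1 * φ ‖x + p.1 * bpt p.2 - x‖
      ∂((volume.restrict (Ioo (0 : ℝ) S)).prod (volume.restrict (Ioo (-π) π))) =
      ∫⁻ p, (ENNReal.ofReal p.1 * φ p.1) * 1
      ∂((volume.restrict (Ioo (0 : ℝ) S)).prod (volume.restrict (Ioo (-π) π))) := by
    rw [Measure.prod_restrict]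
    refine setLIntegral_congr_fun (measurableSet_Ioo.prod measurableSet_Ioo) fun p hp => ?_
    simp [norm_bpt, abs_of_pos hp.1.1]
  rw [h1, lintegral_prod_mul (f := fun r => ENNReal.ofReal r * φ r) (g := fun _ => 1)
    (by fun_prop) (by fun_prop), mul_comm]
  congr 1
  rw [lintegral_one, Measure.restrict_apply_univ, Real.volume_Ioo]
  congr 1
  ring

lemma lintegral_ball_inv_norm (x : ℂ) {S : ℝ} (hS : 0 ≤ S) :
    ∫⁻ y in ball x S, ENNReal.ofReal ‖y - x‖⁻¹ = ENNReal.ofReal (2 * π * S) := by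
  rw [lintegral_ball_radial (φ := fun r => ENNReal.ofReal r⁻¹) (by fun_prop)]
  have : ∫⁻ r in Ioo (0 : ℝ) S, ENNReal.ofReal r * ENNReal.ofReal r⁻¹ =
      ∫⁻ r in Ioo (0 : ℝ) S, 1 := by
    refine setLIntegral_congr_fun measurableSet_Ioo fun r hr => ?_
    rw [← ENNReal.ofReal_mul hr.1.le, mul_inv_cancel₀ hr.1.ne', ENNReal.ofReal_one]
  rw [this, ENNReal.ofReal_mul (p := 2 * π) (by positivity), lintegral_one, Measure.restrict_apply_univ,
    Real.volume_Ioo, sub_zero]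

lemma lintegral_annulus_inv_sq (x : ℂ) {s S : ℝ} (hs : 0 < s) (hS : 0 < S) :
    ∫⁻ y in ball x S, (if s ≤ ‖y - x‖ then ENNReal.ofReal (‖y - x‖ ^ 2)⁻¹ else 0) ≤
      ENNReal.ofReal (2 * π * Real.log (max 1 (S / s))) := by
  rw [lintegral_ball_radial (φ := fun r => if s ≤ r then ENNReal.ofReal (r ^ 2)⁻¹ else 0)
    (Measurable.ite measurableSet_Ici (by fun_prop) measurable_const),
    ENNReal.ofReal_mul (p := 2 * π) (by positivity)]
  refine mul_le_mul_right ?_ _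
  rcases lt_or_ge S s with h | h
  · refine le_of_eq_of_le ?_ bot_le
    have : ∫⁻ r in Ioo (0 : ℝ) S, ENNReal.ofReal r *
        (if s ≤ r then ENNReal.ofReal (r ^ 2)⁻¹ else 0) = ∫⁻ r in Ioo (0 : ℝ) S, 0 := by
      refine setLIntegral_congr_fun measurableSet_Ioo fun r hr => ?_
      simp [not_le.2 (hr.2.trans h)]
    simpa using this
  · have h1 : ∫⁻ r in Ioo (0 : ℝ) S, ENNReal.ofReal r *
        (if s ≤ r then ENNReal.ofReal (r ^ 2)⁻¹ else 0) ≤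
        ∫⁻ r in Icc s S, ENNReal.ofReal r⁻¹ := by
      rw [← lintegral_indicator measurableSet_Ioo, ← lintegral_indicator measurableSet_Icc]
      refine lintegral_mono fun r => ?_
      by_cases hr : r ∈ Ioo (0 : ℝ) S
      · by_cases hr' : s ≤ r
        · rw [indicator_of_mem hr, indicator_of_mem (show r ∈ Icc s S from ⟨hr', hr.2.le⟩), if_pos hr',
            ← ENNReal.ofReal_mul hr.1.le]
          refine le_of_eq ?_
          congr 1
          have := hr.1.ne'
          field_simp
        · simp [hr']
      · simp [hr]
    refine h1.trans ?_
    have hint : IntegrableOn (fun r : ℝ => r⁻¹) (Icc s S) :=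
      (continuousOn_inv₀.mono fun r hr => (hs.trans_le hr.1).ne').integrableOn_Icc
    rw [← ofReal_integral_eq_lintegral_ofReal hint
      ((ae_restrict_iff' measurableSet_Icc).2 (.of_forall fun r hr =>
        inv_nonneg.2 (hs.trans_le hr.1).le)),
      integral_Icc_eq_integral_Ioc, ← intervalIntegral.integral_of_le h,
      integral_inv_of_pos hs hS]
    gcongr
    exact le_max_right _ _

/-- The truncated kernel `1/|x-y|`, supported in `|x-y| < dist(x, ∂B)/2`. -/
def kerT (x y : ℂ) : ℝ≥0∞ :=
  if ‖y - x‖ < (1 - ‖x‖) / 2 then ENNReal.ofReal ‖y - x‖⁻¹ else 0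

/-- Truncated logarithmic kernel. -/
def logT (x x' : ℂ) : ℝ := Real.log (max 1 ((1 - ‖x‖) / ‖x' - x‖))

lemma logT_nonneg (x x' : ℂ) : 0 ≤ logT x x' := Real.log_nonneg (le_max_left _ _)

lemma measurable_logT (x : ℂ) : Measurable (logT x) := by unfold logT; fun_prop

lemma measurable_kerT : Measurable fun p : ℂ × ℂ => kerT p.1 p.2 :=
  Measurable.ite (measurableSet_lt (by fun_prop) (by fun_prop)) (by fun_prop) measurable_const

lemma lintegral_indicator_ball_kernel {φ : ℝ → ℝ≥0∞} (x : ℂ) (S : ℝ) :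
    ∫⁻ y, (if ‖y - x‖ < S then φ ‖y - x‖ else 0) = ∫⁻ y in ball x S, φ ‖y - x‖ := by
  rw [← lintegral_indicator measurableSet_ball]
  congr 1; ext y
  simp [indicator, dist_eq_norm]

lemma kerT_mul_kerT_le {x x' : ℂ} (hne : x ≠ x') (y : ℂ) :
    kerT x y * kerT x' y ≤
      ENNReal.ofReal (2 / ‖x' - x‖) *
        (if ‖y - x‖ < ‖x' - x‖ / 2 then ENNReal.ofReal ‖y - x‖⁻¹ else 0) +
      ENNReal.ofReal (2 / ‖x' - x‖) *
        (if ‖y - x'‖ < ‖x' - x‖ / 2 then ENNReal.ofReal ‖y - x'‖⁻¹ else 0) +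
      (ENNReal.ofReal (1 / 2) * (if ‖y - x‖ < (1 - ‖x‖) / 2 then
        (if ‖x' - x‖ / 2 ≤ ‖y - x‖ then ENNReal.ofReal (‖y - x‖ ^ 2)⁻¹ else 0) else 0) +
      ENNReal.ofReal (1 / 2) * (if ‖y - x'‖ < (1 - ‖x'‖) / 2 then
        (if ‖x' - x‖ / 2 ≤ ‖y - x'‖ then ENNReal.ofReal (‖y - x'‖ ^ 2)⁻¹ else 0) else 0)) := by
  unfold kerT
  have hr : 0 < ‖x' - x‖ := norm_pos_iff.2 (sub_ne_zero.2 hne.symm)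
  have htri : ‖x' - x‖ ≤ ‖y - x‖ + ‖y - x'‖ := by
    have := norm_sub_le (y - x) (y - x')
    rwa [sub_sub_sub_cancel_left] at this
  set r := ‖x' - x‖
  set a := ‖y - x‖ with ha
  set b := ‖y - x'‖ with hb
  have ha0 : 0 ≤ a := norm_nonneg _
  have hb0 : 0 ≤ b := norm_nonneg _
  by_cases h1 : a < (1 - ‖x‖) / 2
  swap
  · simp [h1]
  by_cases h2 : b < (1 - ‖x'‖) / 2
  swap
  · simp [h2]
  rw [if_pos h1, if_pos h2]
  by_cases h3 : a < r / 2
  · refine le_trans ?_ (le_self_add.trans le_self_add)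
    rw [if_pos h3, mul_comm]
    gcongr
    rw [← one_div, div_le_div_iff₀ (by linarith) hr]
    linarith
  by_cases h4 : b < r / 2
  · refine le_trans ?_ (le_add_self.trans le_self_add)
    rw [if_pos h4]
    gcongr
    rw [← one_div, div_le_div_iff₀ (by linarith) hr]
    linarith
  refine le_trans ?_ le_add_self
  rw [if_pos h1, if_pos h2, if_pos (not_lt.1 h3), if_pos (not_lt.1 h4),
    ← ENNReal.ofReal_mul (by positivity), ← ENNReal.ofReal_mul (by positivity),
    ← ENNReal.ofReal_mul (by positivity), ← ENNReal.ofReal_add (by positivity) (by positivity)]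
  refine ENNReal.ofReal_le_ofReal ?_
  rw [← inv_pow, ← inv_pow]
  nlinarith [sq_nonneg (a⁻¹ - b⁻¹)]

lemma lintegral_kerT_mul_kerT_le {x x' : ℂ} (hx : x ∈ odisc) (hx' : x' ∈ odisc) (hne : x ≠ x') :
    ∫⁻ y, kerT x y * kerT x' y ≤
      ENNReal.ofReal (4 * π) + (ENNReal.ofReal (π * logT x x') + ENNReal.ofReal (π * logT x' x)) := by
  have hr : 0 < ‖x' - x‖ := norm_pos_iff.2 (sub_ne_zero.2 hne.symm)
  have hx1 := mem_odisc.1 hx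
  have hx1' := mem_odisc.1 hx'
  refine (lintegral_mono (kerT_mul_kerT_le hne)).trans ?_
  have m1 : ∀ (z : ℂ) (c S : ℝ), Measurable fun y : ℂ => ENNReal.ofReal c *
      (if ‖y - z‖ < S then ENNReal.ofReal ‖y - z‖⁻¹ else 0) := fun z c S =>
    (Measurable.ite (measurableSet_lt (by fun_prop) (by fun_prop)) (by fun_prop)
      measurable_const).const_mul _
  have m2 : ∀ (z : ℂ) (S s : ℝ), Measurable fun y : ℂ => 
      (if ‖y - z‖ < S then (if s ≤ ‖y - z‖ then ENNReal.ofReal (‖y - z‖ ^ 2)⁻¹ else 0) else 0) :=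
    fun z S s =>
    (Measurable.ite (measurableSet_lt (by fun_prop) (by fun_prop)) 
      (Measurable.ite (measurableSet_le (by fun_prop) (by fun_prop)) (by fun_prop)
      measurable_const) measurable_const)
  have e1 : ∀ z : ℂ, ∫⁻ y : ℂ, ENNReal.ofReal (2 / ‖x' - x‖) *
        (if ‖y - z‖ < ‖x' - x‖ / 2 then ENNReal.ofReal ‖y - z‖⁻¹ else 0) =
        ENNReal.ofReal (2 * π) := fun z => by
    rw [lintegral_const_mul' _ _ ENNReal.ofReal_ne_top,
      lintegral_indicator_ball_kernel (φ := fun r => ENNReal.ofReal r⁻¹),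
      lintegral_ball_inv_norm z (by positivity), ← ENNReal.ofReal_mul (by positivity)]
    congr 1
    field_simp
  have e2 : ∀ z : ℂ, ‖z‖ < 1 → ∫⁻ y : ℂ, ENNReal.ofReal (1 / 2) * (if ‖y - z‖ < (1 - ‖z‖) / 2 then
        (if ‖x' - x‖ / 2 ≤ ‖y - z‖ then ENNReal.ofReal (‖y - z‖ ^ 2)⁻¹ else 0) else 0) ≤
        ENNReal.ofReal (π * Real.log (max 1 ((1 - ‖z‖) / ‖x' - x‖))) := fun z hz => by
    rw [lintegral_const_mul' _ _ ENNReal.ofReal_ne_top,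
      lintegral_indicator_ball_kernel
        (φ := fun r => if ‖x' - x‖ / 2 ≤ r then ENNReal.ofReal (r ^ 2)⁻¹ else 0)]
    refine (mul_le_mul_right (lintegral_annulus_inv_sq z (by positivity) (by linarith)) _).trans ?_
    rw [← ENNReal.ofReal_mul (by positivity), div_div_div_cancel_right₀ two_ne_zero]
    refine ENNReal.ofReal_le_ofReal (le_of_eq (by ring))
  rw [lintegral_add_left (by exact (m1 _ _ _).add (m1 _ _ _)), lintegral_add_left (m1 _ _ _),
    lintegral_add_left ((m2 _ _ _).const_mul _), e1, e1]
  refine add_le_add ?_ (add_le_add (e2 x hx1) ?_)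
  · rw [← ENNReal.ofReal_add (by positivity) (by positivity)]
    exact ENNReal.ofReal_le_ofReal (by linarith)
  · unfold logT
    rw [norm_sub_rev x x']
    exact e2 x' hx1'

lemma exp_mul_log_eq_rpow {m a : ℝ} (hm : 0 < m) : Real.exp (a * Real.log m) = m ^ a := by
  rw [Real.rpow_def_of_pos hm, mul_comm]

lemma lintegral_ball_rpow_le (x : ℂ) {d : ℝ} (hd : 0 < d) :
    ∫⁻ y in ball x (d / 2), ENNReal.ofReal ((d / ‖y - x‖) ^ (3 / 2 : ℝ)) ≤
      ENNReal.ofReal (4 * π * d ^ 2) := by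
  rw [lintegral_ball_radial (φ := fun r => ENNReal.ofReal ((d / r) ^ (3 / 2 : ℝ))) (by fun_prop)]
  have h1 : ∫⁻ r in Ioo (0 : ℝ) (d / 2), ENNReal.ofReal r * ENNReal.ofReal ((d / r) ^ (3 / 2 : ℝ)) =
      ∫⁻ r in Ioo (0 : ℝ) (d / 2), ENNReal.ofReal (d ^ (3 / 2 : ℝ) * r ^ (-1 / 2 : ℝ)) := by
    refine setLIntegral_congr_fun measurableSet_Ioo fun r hr => ?_
    rw [← ENNReal.ofReal_mul hr.1.le]
    congr 1
    rw [Real.div_rpow hd.le hr.1.le, show (-1 / 2 : ℝ) = 1 - 3 / 2 by norm_num,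
      Real.rpow_sub hr.1, Real.rpow_one]
    ring
  have hint : IntegrableOn (fun r : ℝ => d ^ (3 / 2 : ℝ) * r ^ (-1 / 2 : ℝ)) (Ioo 0 (d / 2)) := by
    have := (intervalIntegral.intervalIntegrable_rpow' (a := 0) (b := d / 2)
      (show (-1 : ℝ) < -1 / 2 by norm_num)).const_mul (d ^ (3 / 2 : ℝ))
    rw [intervalIntegrable_iff_integrableOn_Ioo_of_le (by positivity)] at this
    exact this
  rw [h1, ← ofReal_integral_eq_lintegral_ofReal hint
    ((ae_restrict_iff' measurableSet_Ioo).2 (.of_forall fun r hr => by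
      have := hr.1
      simp only [Pi.zero_apply]; positivity)), ← ENNReal.ofReal_mul (by positivity)]
  refine ENNReal.ofReal_le_ofReal ?_
  rw [← integral_Ioc_eq_integral_Ioo, ← intervalIntegral.integral_of_le (by positivity),
    intervalIntegral.integral_const_mul, integral_rpow (Or.inl (by norm_num))]
  have h2 : (d / 2) ^ (1 / 2 : ℝ) ≤ d ^ (1 / 2 : ℝ) :=
    Real.rpow_le_rpow (by positivity) (by linarith) (by norm_num)
  have h3 : d ^ (3 / 2 : ℝ) * d ^ (1 / 2 : ℝ) = d ^ 2 := by
    rw [← Real.rpow_add hd, ← Real.rpow_natCast]; norm_num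
  have h4 : (0 : ℝ) ^ (1 / 2 : ℝ) = 0 := Real.zero_rpow (by norm_num)
  have h5 : (-1 / 2 + 1 : ℝ) = 1 / 2 := by norm_num
  rw [h5, h4, ← h3]
  have h6 : 0 ≤ d ^ (3 / 2 : ℝ) := by positivity
  calc _ = 4 * π * (d ^ (3 / 2 : ℝ) * (d / 2) ^ (1 / 2 : ℝ)) := by ring
    _ ≤ _ := by gcongr

section
variable {c : ℕ → ℂ} (hc : Summable fun k : ℕ => ((k : ℝ) + 1) * ‖c k‖) (c₀ : ℝ)
include hc

lemma exp_two_harm_le_of_near {x z : ℂ} (hx : x ∈ odisc) (hz : ‖z - x‖ < (1 - ‖x‖) / 2) :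
    Real.exp (2 * harm c₀ c z) ≤
      circInt (fun z => Real.exp (harm c₀ c z)) ^ 2 / (π ^ 2 * (1 - ‖x‖) ^ 2) := by
  have hx1 := mem_odisc.1 hx
  have h1 : ‖z‖ ≤ ‖x‖ + ‖z - x‖ := by simpa using norm_add_le x (z - x)
  have hz1 : ‖z‖ < 1 := by linarith
  have h2 := one_sub_sq_mul_exp_harm_le hc c₀ (mem_odisc.2 hz1)
  have h3 : (1 - ‖x‖) / 2 * Real.exp (harm c₀ c z) ≤
      circInt (fun z => Real.exp (harm c₀ c z)) / (2 * π) := by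
    refine le_trans ?_ h2
    gcongr
    nlinarith [norm_nonneg z]
  have h4 : Real.exp (harm c₀ c z) ≤
      circInt (fun z => Real.exp (harm c₀ c z)) / (π * (1 - ‖x‖)) := by
    rw [le_div_iff₀ (by have := Real.pi_pos; nlinarith)]
    rw [le_div_iff₀ (by positivity)] at h3
    linarith
  calc Real.exp (2 * harm c₀ c z) = Real.exp (harm c₀ c z) ^ 2 := by
        rw [← Real.exp_nat_mul]; norm_num
    _ ≤ _ := by
        rw [← mul_pow, ← div_pow]
        gcongr

lemma lintegral_exp_logT_le {x : ℂ} (hx : x ∈ odisc) :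
    ∫⁻ z in odisc, ENNReal.ofReal (Real.exp (3 / 2 * logT x z) * Real.exp (2 * harm c₀ c z)) ≤
      ENNReal.ofReal (2 * circInt (fun z => Real.exp (harm c₀ c z)) ^ 2) := by
  set Len := circInt (fun z => Real.exp (harm c₀ c z)) with hLen
  have hx1 := mem_odisc.1 hx
  set d := 1 - ‖x‖ with hd
  have hd0 : 0 < d := by rw [hd]; linarith
  have hpt : ∀ z : ℂ, ENNReal.ofReal (Real.exp (3 / 2 * logT x z) * Real.exp (2 * harm c₀ c z)) ≤
      ENNReal.ofReal (3 * Real.exp (2 * harm c₀ c z)) +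
      ENNReal.ofReal (Len ^ 2 / (π ^ 2 * d ^ 2)) *
        (if ‖z - x‖ < d / 2 then ENNReal.ofReal ((d / ‖z - x‖) ^ (3 / 2 : ℝ)) else 0) := fun z => by
    have hm : 0 < max 1 (d / ‖z - x‖) := lt_of_lt_of_le one_pos (le_max_left _ _)
    rw [logT, exp_mul_log_eq_rpow hm]
    by_cases h1 : d / ‖z - x‖ ≤ 2
    · refine le_trans ?_ le_self_add
      refine ENNReal.ofReal_le_ofReal ?_
      gcongr
      have h2 : max 1 (d / ‖z - x‖) ≤ 2 := max_le (by norm_num) h1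
      calc max 1 (d / ‖z - x‖) ^ (3 / 2 : ℝ) ≤ (2 : ℝ) ^ (3 / 2 : ℝ) :=
            Real.rpow_le_rpow hm.le h2 (by norm_num)
        _ ≤ 3 := by
            rw [show (3 / 2 : ℝ) = 1 + 1 / 2 by norm_num, Real.rpow_add two_pos, Real.rpow_one,
              ← Real.sqrt_eq_rpow]
            have : √2 ≤ 3 / 2 := by rw [Real.sqrt_le_left (by norm_num)]; norm_num
            linarith
    · push Not at h1
      have hr : 0 < ‖z - x‖ := by
        by_contra h
        have : ‖z - x‖ = 0 := le_antisymm (not_lt.1 h) (norm_nonneg _)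
        rw [this, div_zero] at h1
        linarith
      have h2 : ‖z - x‖ < d / 2 := by
        rw [lt_div_iff₀ hr] at h1; linarith
      refine le_trans ?_ le_add_self
      rw [if_pos h2, ← ENNReal.ofReal_mul (by positivity), max_eq_right (by linarith), mul_comm]
      refine ENNReal.ofReal_le_ofReal ?_
      gcongr
      exact exp_two_harm_le_of_near hc c₀ hx h2
  have hκ : ContinuousOn (fun z => 3 * Real.exp (2 * harm c₀ c z)) cdisc :=
    continuousOn_const.mul (continuousOn_const.mul (continuousOn_harm hc c₀)).rexp
  refine (lintegral_mono hpt).trans ?_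
  have hmeas : AEMeasurable (fun z => ENNReal.ofReal (3 * Real.exp (2 * harm c₀ c z)))
      (volume.restrict odisc) :=
    ((hκ.mono odisc_subset_cdisc).aemeasurable measurableSet_ball).ennreal_ofReal
  rw [lintegral_add_left' hmeas, lintegral_const_mul' _ _ ENNReal.ofReal_ne_top,
    ← ofReal_integral_eq_lintegral_ofReal (integrableOn_odisc hκ)
      (.of_forall fun z => by simp only [Pi.zero_apply]; positivity), integral_const_mul]
  have h2 : ∫⁻ z in odisc,
      (if ‖z - x‖ < d / 2 then ENNReal.ofReal ((d / ‖z - x‖) ^ (3 / 2 : ℝ)) else 0) ≤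
      ENNReal.ofReal (4 * π * d ^ 2) := by
    refine (setLIntegral_le_lintegral _ _).trans ?_
    rw [lintegral_indicator_ball_kernel (φ := fun r => ENNReal.ofReal ((d / r) ^ (3 / 2 : ℝ)))]
    exact lintegral_ball_rpow_le x hd0
  have h3 := ballInt_exp_two_harm_le hc c₀
  rw [← hLen] at h3
  have hp := Real.pi_gt_three
  calc _ ≤ ENNReal.ofReal (3 * (Len ^ 2 / (4 * π))) +
        ENNReal.ofReal (Len ^ 2 / (π ^ 2 * d ^ 2)) * ENNReal.ofReal (4 * π * d ^ 2) := by
        gcongr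
    _ ≤ _ := by
        rw [← ENNReal.ofReal_mul (by positivity), ← ENNReal.ofReal_add (by positivity) (by positivity)]
        refine ENNReal.ofReal_le_ofReal ?_
        have e : 3 * (Len ^ 2 / (4 * π)) + Len ^ 2 / (π ^ 2 * d ^ 2) * (4 * π * d ^ 2) =
          (19 / 4) * Len ^ 2 / π := by field_simp; ring
        rw [e, div_le_iff₀ (by positivity)]
        nlinarith [sq_nonneg Len]

end

/-- Gibbs variational principle for the density `e^{2u}` relative to `e^{2h}`, `u = h + w`. -/
lemma gibbs_le {u h w F : ℂ → ℝ} (hu : ContinuousOn u cdisc) (hh : ContinuousOn h cdisc)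
    (hw : ContinuousOn w cdisc) (hdec : ∀ z, u z = h z + w z) (hF : Measurable F)
    (hF0 : ∀ z, 0 ≤ F z) {Λ : ℝ} (hΛ : 0 < Λ)
    (hint : ∫⁻ z in odisc, ENNReal.ofReal (Real.exp (F z) * Real.exp (2 * h z)) ≤ ENNReal.ofReal Λ) :
    0 ≤ (∫ z in odisc, Real.exp (2 * u z) / volU u * (2 * w z)) -
        Real.log (volU u) + Real.log Λ ∧
    ∫⁻ z in odisc, ENNReal.ofReal (F z * (Real.exp (2 * u z) / volU u)) ≤
      ENNReal.ofReal ((∫ z in odisc, Real.exp (2 * u z) / volU u * (2 * w z)) -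
        Real.log (volU u) + Real.log Λ) := by
  have hZ := volU_pos hu
  set Z := volU u with hZd
  have hpc : ContinuousOn (fun z => Real.exp (2 * u z) / Z) cdisc :=
    (continuousOn_const.mul hu).rexp.div_const Z
  have hp1 : ∫ z in odisc, Real.exp (2 * u z) / Z = 1 := by
    rw [integral_div, ← volU, ← hZd, div_self hZ.ne']
  have i1 : IntegrableOn (fun z => Real.exp (2 * u z) / Z) odisc := integrableOn_odisc hpc
  have i2 : IntegrableOn (fun z => Real.exp (2 * u z) / Z * (2 * w z)) odisc :=
    integrableOn_odisc (hpc.mul (continuousOn_const.mul hw))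
  have mF : AEStronglyMeasurable F (volume.restrict odisc) := hF.aestronglyMeasurable
  have me : AEStronglyMeasurable (fun z => Real.exp (F z) * Real.exp (2 * h z))
      (volume.restrict odisc) := by
    refine AEStronglyMeasurable.mul (hF.exp).aestronglyMeasurable ?_
    exact (((continuousOn_const.mul hh).rexp).mono odisc_subset_cdisc).aestronglyMeasurable
      measurableSet_ball
  have i3 : IntegrableOn (fun z => Real.exp (F z) * Real.exp (2 * h z)) odisc :=
    (lintegral_ofReal_ne_top_iff_integrable me (.of_forall fun z => by
      simp only [Pi.zero_apply]; positivity)).1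
      (hint.trans_lt ENNReal.ofReal_lt_top).ne
  have h3 : ∫ z in odisc, Real.exp (F z) * Real.exp (2 * h z) ≤ Λ := by
    rw [← ofReal_integral_eq_lintegral_ofReal i3 (.of_forall fun z => by
      simp only [Pi.zero_apply]; positivity)] at hint
    exact (ENNReal.ofReal_le_ofReal_iff hΛ.le).1 hint
  set RHS : ℂ → ℝ := fun z => Real.exp (2 * u z) / Z * (2 * w z) +
    (Real.log Λ - Real.log Z - 1) * (Real.exp (2 * u z) / Z) +
    Λ⁻¹ * (Real.exp (F z) * Real.exp (2 * h z)) with hRHS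
  have i12 : IntegrableOn (fun z => Real.exp (2 * u z) / Z * (2 * w z) +
    (Real.log Λ - Real.log Z - 1) * (Real.exp (2 * u z) / Z)) odisc := i2.add (i1.const_mul _)
  have iR : IntegrableOn RHS odisc := i12.add (i3.const_mul _)
  have hle : ∀ z, F z * (Real.exp (2 * u z) / Z) ≤ RHS z := fun z => by
    have hp : 0 < Real.exp (2 * u z) / Z := by positivity
    have h1 := Real.add_one_le_exp (F z - (2 * w z - Real.log Z) - Real.log Λ)
    have h2 : Real.exp (F z - (2 * w z - Real.log Z) - Real.log Λ) * (Real.exp (2 * u z) / Z) =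
        Λ⁻¹ * (Real.exp (F z) * Real.exp (2 * h z)) := by
      rw [hdec z, mul_add, Real.exp_add, Real.exp_sub, Real.exp_sub, Real.exp_sub,
        Real.exp_log hZ, Real.exp_log hΛ]
      field_simp
    have h4 := mul_le_mul_of_nonneg_right h1 hp.le
    rw [h2] at h4
    simp only [hRHS]
    linarith
  have h0 : ∀ z, 0 ≤ F z * (Real.exp (2 * u z) / Z) := fun z => mul_nonneg (hF0 z) (by positivity)
  have iF : IntegrableOn (fun z => F z * (Real.exp (2 * u z) / Z)) odisc :=
    Integrable.mono' iR (mF.mul i1.aestronglyMeasurable) (.of_forall fun z => by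
      rw [Real.norm_of_nonneg (h0 z)]; exact hle z)
  rw [← ofReal_integral_eq_lintegral_ofReal iF (.of_forall h0)]
  suffices hB : ∫ z in odisc, F z * (Real.exp (2 * u z) / Z) ≤
      (∫ z in odisc, Real.exp (2 * u z) / Z * (2 * w z)) - Real.log Z + Real.log Λ from
    ⟨(integral_nonneg h0).trans hB, ENNReal.ofReal_le_ofReal hB⟩
  refine (integral_mono iF iR hle).trans ?_
  rw [hRHS, integral_add i12 (i3.const_mul _), integral_add i2 (i1.const_mul _),
    integral_const_mul, integral_const_mul, hp1]
  have : Λ⁻¹ * (∫ z in odisc, Real.exp (F z) * Real.exp (2 * h z)) ≤ 1 := by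
    rw [inv_mul_le_iff₀ hΛ]; linarith
  linarith

lemma ray_mem_odisc {x : ℂ} (hx : x ∈ odisc) {s : ℝ} (hs0 : 0 ≤ s) (hs : s ≤ (1 - ‖x‖) / 2)
    (θ : ℝ) : x + s * bpt θ ∈ odisc :=
  closedBall_half_subset hx (by
    rw [mem_closedBall, dist_eq_norm]; simp [norm_bpt, abs_of_nonneg hs0, hs])

lemma ZB.le_add_lintegral_ray {w : ℂ → ℝ} {dw : ℂ → ℂ →L[ℝ] ℝ} (h : ZB w dw) {x : ℂ}
    (hx : x ∈ odisc) (θ : ℝ) {r : ℝ} (hr : r ∈ Ioo 0 ((1 - ‖x‖) / 2)) :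
    ENNReal.ofReal (w x) ≤ ENNReal.ofReal |w (x + r * bpt θ)| +
      ∫⁻ s in Ioo 0 ((1 - ‖x‖) / 2), ENNReal.ofReal (√(gsq (dw (x + s * bpt θ)))) := by
  set R := (1 - ‖x‖) / 2 with hR
  have hmem : ∀ s ∈ Icc 0 r, x + (s : ℂ) * bpt θ ∈ odisc := fun s hs =>
    ray_mem_odisc hx hs.1 (hs.2.trans hr.2.le) θ
  have hray : ContinuousOn (fun s : ℝ => x + (s : ℂ) * bpt θ) (Icc 0 r) := by fun_prop
  have hmaps : MapsTo (fun s : ℝ => x + (s : ℂ) * bpt θ) (Icc 0 r) cdisc :=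
    fun s hs => odisc_subset_cdisc (hmem s hs)
  have hcd : ContinuousOn (fun s : ℝ => dw (x + s * bpt θ) (bpt θ)) (Icc 0 r) :=
    (h.contD.comp hray hmaps).clm_apply continuousOn_const
  have hcg : ContinuousOn (fun s : ℝ => √(gsq (dw (x + s * bpt θ)))) (Icc 0 r) :=
    ((continuousOn_gsq h.contD).comp hray hmaps).sqrt
  have h1 : ∫ s in (0 : ℝ)..r, dw (x + s * bpt θ) (bpt θ) = w (x + r * bpt θ) - w x := by
    rw [intervalIntegral.integral_eq_sub_of_hasDerivAt (f := fun s : ℝ => w (x + s * bpt θ))]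
    · simp
    · intro s hs
      rw [uIcc_of_le hr.1.le] at hs
      exact hasDerivAt_ray (h.deriv _ (hmem s hs))
    · rw [intervalIntegrable_iff_integrableOn_Icc_of_le hr.1.le]
      exact hcd.integrableOn_Icc
  have h2 : |∫ s in (0 : ℝ)..r, dw (x + s * bpt θ) (bpt θ)| ≤
      ∫ s in (0 : ℝ)..r, √(gsq (dw (x + s * bpt θ))) := by
    rw [← Real.norm_eq_abs]
    refine intervalIntegral.norm_integral_le_of_norm_le hr.1.le (.of_forall fun s hs => ?_) ?_
    · rw [Real.norm_eq_abs]
      have := abs_apply_le_sqrt_gsq (dw (x + s * bpt θ)) (bpt θ)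
      rwa [norm_bpt, mul_one] at this
    · rw [intervalIntegrable_iff_integrableOn_Icc_of_le hr.1.le]
      exact hcg.integrableOn_Icc
  have h3 : w x ≤ |w (x + r * bpt θ)| + ∫ s in (0 : ℝ)..r, √(gsq (dw (x + s * bpt θ))) := by
    have a1 := neg_abs_le (∫ s in (0 : ℝ)..r, dw (x + s * bpt θ) (bpt θ))
    have a2 := le_abs_self (w (x + r * bpt θ))
    linarith
  refine (ENNReal.ofReal_le_ofReal h3).trans (ENNReal.ofReal_add_le.trans ?_)
  gcongr
  rw [intervalIntegral.integral_of_le hr.1.le, integral_Ioc_eq_integral_Ioo,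
    ofReal_integral_eq_lintegral_ofReal (hcg.integrableOn_Icc.mono_set Ioo_subset_Icc_self)
      (.of_forall fun s => Real.sqrt_nonneg _)]
  exact lintegral_mono_set (Ioo_subset_Ioo_right hr.2.le)

lemma lintegral_Ioo_ofReal_id {R : ℝ} (hR : 0 ≤ R) :
    ∫⁻ r in Ioo (0 : ℝ) R, ENNReal.ofReal r = ENNReal.ofReal (R ^ 2 / 2) := by
  rw [← ofReal_integral_eq_lintegral_ofReal (f := fun r : ℝ => r)
      ((continuous_id.continuousOn (s := Icc 0 R)).integrableOn_Icc.mono_set Ioo_subset_Icc_self)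
      ((ae_restrict_iff' measurableSet_Ioo).2 (.of_forall fun s hs => hs.1.le)),
      ← integral_Ioc_eq_integral_Ioo, ← intervalIntegral.integral_of_le hR]
  simp

lemma ZB.sqrt_aemeasurable {w : ℂ → ℝ} {dw : ℂ → ℂ →L[ℝ] ℝ} (h : ZB w dw) :
    AEMeasurable (fun y => ENNReal.ofReal √(gsq (dw y))) (volume.restrict odisc) :=
  (((continuousOn_gsq h.contD).sqrt.mono odisc_subset_cdisc).aemeasurable
    measurableSet_ball).ennreal_ofReal

/-- Pointwise representation bound by the truncated Riesz potential of the gradient. -/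
lemma ZB.le_potential {w : ℂ → ℝ} {dw : ℂ → ℂ →L[ℝ] ℝ} (h : ZB w dw) {x : ℂ} (hx : x ∈ odisc) :
    ENNReal.ofReal (w x) ≤ ENNReal.ofReal (7 * √(∫ z in odisc, gsq (dw z)) + 1) +
      ENNReal.ofReal (1 / (2 * π)) *
        ∫⁻ y in odisc, kerT x y * ENNReal.ofReal √(gsq (dw y)) := by
  set R := (1 - ‖x‖) / 2 with hR
  have hx1 := mem_odisc.1 hx
  have hR0 : 0 < R := by rw [hR]; linarith
  have hpi := Real.pi_pos
  set A := 7 * √(∫ z in odisc, gsq (dw z)) + 1 with hA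
  have hsub : ball x R ⊆ odisc := ball_subset_closedBall.trans (closedBall_half_subset hx)
  -- the potential in polar coordinates
  have hker : ∫⁻ y in odisc, kerT x y * ENNReal.ofReal √(gsq (dw y)) =
      ∫⁻ y in ball x R, ENNReal.ofReal ‖y - x‖⁻¹ * ENNReal.ofReal √(gsq (dw y)) := by
    rw [← lintegral_indicator measurableSet_ball, odisc, ← lintegral_indicator measurableSet_ball]
    congr 1; ext y
    by_cases hy : y ∈ ball x R
    · have hy2 : y ∈ ball (0:ℂ) 1 := hsub hy
      rw [indicator_of_mem hy, indicator_of_mem hy2, kerT, if_pos]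
      rwa [mem_ball, dist_eq_norm] at hy
    · rw [indicator_of_notMem hy]
      refine indicator_apply_eq_zero.2 fun _ => ?_
      rw [kerT, if_neg, zero_mul]
      rwa [mem_ball, dist_eq_norm] at hy
  set μ : Measure ℝ := volume.restrict (Ioo 0 R) with hμ
  set ν : Measure ℝ := volume.restrict (Ioo (-π) π) with hν
  have hpr : (volume.restrict (Ioo (0:ℝ) R ×ˢ Ioo (-π) π) : Measure (ℝ × ℝ)) = μ.prod ν := by
    rw [Measure.volume_eq_prod, ← Measure.prod_restrict]
  have hmap : MapsTo (fun p : ℝ × ℝ => x + (p.1 : ℂ) * bpt p.2) (Ioo (0:ℝ) R ×ˢ Ioo (-π) π) cdisc :=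
    fun p hp => odisc_subset_cdisc (ray_mem_odisc hx hp.1.1.le hp.1.2.le p.2)
  have hcp : Continuous (fun p : ℝ × ℝ => x + (p.1 : ℂ) * bpt p.2) := by
    have := continuous_bpt
    fun_prop
  have hprodm : MeasurableSet (Ioo (0:ℝ) R ×ˢ Ioo (-π) π) := measurableSet_Ioo.prod measurableSet_Ioo
  have mg : AEMeasurable (fun p : ℝ × ℝ => ENNReal.ofReal √(gsq (dw (x + p.1 * bpt p.2))))
      (μ.prod ν) := by
    rw [← hpr]
    exact ((((continuousOn_gsq h.contD).sqrt.comp hcp.continuousOn hmap)).aemeasurable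
      hprodm).ennreal_ofReal
  have mw : AEMeasurable (fun p : ℝ × ℝ => ENNReal.ofReal p.1 *
      ENNReal.ofReal |w (x + p.1 * bpt p.2)|) (μ.prod ν) := by
    rw [← hpr]
    refine AEMeasurable.mul (f := fun p : ℝ × ℝ => ENNReal.ofReal p.1) (by fun_prop) ?_
    exact (((h.cont.abs.comp hcp.continuousOn hmap)).aemeasurable hprodm).ennreal_ofReal
  set N : ℝ → ℝ≥0∞ := fun θ => ∫⁻ s, ENNReal.ofReal √(gsq (dw (x + s * bpt θ))) ∂μ with hN
  have mN : AEMeasurable N ν := mg.lintegral_prod_left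
  have hpot : ∫⁻ y in odisc, kerT x y * ENNReal.ofReal √(gsq (dw y)) = ∫⁻ θ, N θ ∂ν := by
    rw [hker, lintegral_ball_polar]
    have : ∫⁻ p in Ioo (0 : ℝ) R ×ˢ Ioo (-π) π, ENNReal.ofReal p.1 *
        (ENNReal.ofReal ‖x + p.1 * bpt p.2 - x‖⁻¹ *
          ENNReal.ofReal √(gsq (dw (x + p.1 * bpt p.2)))) =
        ∫⁻ p in Ioo (0 : ℝ) R ×ˢ Ioo (-π) π, ENNReal.ofReal √(gsq (dw (x + p.1 * bpt p.2))) := by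
      refine setLIntegral_congr_fun hprodm fun p hp => ?_
      have hp1 := hp.1.1
      rw [← mul_assoc, ← ENNReal.ofReal_mul hp1.le]
      simp [norm_bpt, abs_of_pos hp1, mul_inv_cancel₀ hp1.ne']
    rw [this, hpr, lintegral_prod_symm _ mg]
  -- average of the ray inequality
  have hineq : ∫⁻ p, ENNReal.ofReal p.1 * ENNReal.ofReal (w x) ∂(μ.prod ν) ≤
      ∫⁻ p, (ENNReal.ofReal p.1 * ENNReal.ofReal |w (x + p.1 * bpt p.2)| +
        ENNReal.ofReal p.1 * N p.2) ∂(μ.prod ν) := by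
    rw [← hpr]
    refine setLIntegral_mono_ae' hprodm (.of_forall fun p hp => ?_)
    rw [← mul_add]
    gcongr
    exact h.le_add_lintegral_ray hx p.2 hp.1
  rw [lintegral_add_left' mw, lintegral_prod_mul (f := fun r => ENNReal.ofReal r) (g := N)
      (by fun_prop) mN,
    lintegral_prod_mul (f := fun r => ENNReal.ofReal r) (g := fun _ => ENNReal.ofReal (w x))
      (by fun_prop) (by fun_prop), hμ, lintegral_Ioo_ofReal_id hR0.le, ← hμ, ← hpot] at hineq
  have hnu : ∫⁻ _, ENNReal.ofReal (w x) ∂ν = ENNReal.ofReal (2 * π) * ENNReal.ofReal (w x) := by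
    rw [lintegral_const, hν, Measure.restrict_apply_univ, Real.volume_Ioo, mul_comm]
    congr 2; ring
  have habs : ∫⁻ p, ENNReal.ofReal p.1 * ENNReal.ofReal |w (x + p.1 * bpt p.2)| ∂(μ.prod ν) ≤
      ENNReal.ofReal (π * R ^ 2 * A) := by
    rw [← hpr, ← lintegral_ball_polar (fun y => ENNReal.ofReal |w y|),
      ← ofReal_integral_eq_lintegral_ofReal ((integrableOn_odisc h.cont.abs).mono_set hsub)
        (.of_forall fun _ => abs_nonneg _)]
    exact ENNReal.ofReal_le_ofReal (h.integral_ball_abs_le hx)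
  rw [hnu] at hineq
  have hfin := hineq.trans (add_le_add_left habs _)
  have hc : ENNReal.ofReal (1 / (π * R ^ 2)) * (ENNReal.ofReal (R ^ 2 / 2) * ENNReal.ofReal (2 * π)) = 1 := by
    rw [← ENNReal.ofReal_mul (by positivity), ← ENNReal.ofReal_mul (by positivity),
      ← ENNReal.ofReal_one]
    congr 1; field_simp
  have hfin2 := mul_le_mul_right hfin (ENNReal.ofReal (1 / (π * R ^ 2)))
  rw [← mul_assoc (ENNReal.ofReal (R ^ 2 / 2)), ← mul_assoc, hc, one_mul, mul_add,
    ← ENNReal.ofReal_mul (by positivity),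
    ← mul_assoc (ENNReal.ofReal (1 / (π * R ^ 2))), ← ENNReal.ofReal_mul (by positivity)] at hfin2
  have e1 : 1 / (π * R ^ 2) * (π * R ^ 2 * A) = A := by field_simp
  have e2 : 1 / (π * R ^ 2) * (R ^ 2 / 2) = 1 / (2 * π) := by field_simp
  rwa [e1, e2] at hfin2

lemma ENNReal.ofReal_mul_mul_le {c s t : ℝ} (hc : 0 ≤ c) (hs : 0 < s) (ht : 0 < t)
    (h : c ^ 2 ≤ 4 * (s * t)) (a b : ℝ≥0∞) :
    ENNReal.ofReal c * (a * b) ≤ ENNReal.ofReal s * a ^ 2 + ENNReal.ofReal t * b ^ 2 := by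
  by_cases ha : a = ∞
  · have : ENNReal.ofReal s * a ^ 2 = ∞ := by
      rw [ha]; simp [ENNReal.mul_top, hs]
    rw [this]; simp
  by_cases hb : b = ∞
  · have : ENNReal.ofReal t * b ^ 2 = ∞ := by
      rw [hb]; simp [ENNReal.mul_top, ht]
    rw [this]; simp
  lift a to NNReal using ha
  lift b to NNReal using hb
  rw [← ENNReal.ofReal_coe_nnreal, ← ENNReal.ofReal_coe_nnreal (p := b),
    ← ENNReal.ofReal_mul a.coe_nonneg, ← ENNReal.ofReal_mul hc, ← ENNReal.ofReal_pow a.coe_nonneg,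
    ← ENNReal.ofReal_pow b.coe_nonneg, ← ENNReal.ofReal_mul hs.le, ← ENNReal.ofReal_mul ht.le,
    ← ENNReal.ofReal_add (by positivity) (by positivity)]
  refine ENNReal.ofReal_le_ofReal ?_
  have ha := a.coe_nonneg
  have hb := b.coe_nonneg
  generalize (a : ℝ) = x at *
  generalize (b : ℝ) = y at *
  have h1 : c ≤ 2 * √s * √t := by
    rw [mul_assoc, ← Real.sqrt_mul hs.le]
    have : c ≤ √(4 * (s * t)) := Real.le_sqrt_of_sq_le h
    rwa [Real.sqrt_mul (by norm_num), show (4 : ℝ) = 2 ^ 2 by norm_num,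
      Real.sqrt_sq (by norm_num)] at this
  have h2 : c * (x * y) ≤ 2 * √s * √t * (x * y) := by gcongr
  have h3 := sq_nonneg (√s * x - √t * y)
  have h4 := Real.sq_sqrt hs.le
  have h5 := Real.sq_sqrt ht.le
  nlinarith

section
variable {ν : Measure ℂ} [SFinite ν]

/-- The potential of `ν` for the truncated kernel. -/
def potT (ν : Measure ℂ) (y : ℂ) : ℝ≥0∞ := ∫⁻ x, kerT x y ∂ν

lemma measurable_potT : Measurable (potT ν) := measurable_kerT.lintegral_prod_left'

lemma measurable_kerT_right (x : ℂ) : Measurable (kerT x) :=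
  measurable_kerT.comp measurable_prodMk_left

lemma measurable_kerT_left (y : ℂ) : Measurable fun x => kerT x y :=
  measurable_kerT.comp measurable_prodMk_right

lemma lintegral_kerT_mul_swap {g : ℂ → ℝ≥0∞} {s : Set ℂ} (hg : AEMeasurable g (volume.restrict s)) :
    ∫⁻ x, (∫⁻ y in s, kerT x y * g y) ∂ν = ∫⁻ y in s, g y * potT ν y := by
  rw [lintegral_lintegral_swap]
  · refine lintegral_congr fun y => ?_
    rw [lintegral_mul_const _ (measurable_kerT_left y), potT, mul_comm]
  · exact (measurable_kerT.aemeasurable).mul hg.comp_snd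

lemma lintegral_potT_sq :
    ∫⁻ y, potT ν y ^ 2 = ∫⁻ x, ∫⁻ x', (∫⁻ y, kerT x y * kerT x' y) ∂ν ∂ν := by
  have h1 := lintegral_kerT_mul_swap (ν := ν) (s := univ) (g := potT ν)
    measurable_potT.aemeasurable
  simp only [Measure.restrict_univ] at h1
  simp only [sq]
  rw [← h1]
  refine lintegral_congr fun x => ?_
  have h2 := lintegral_kerT_mul_swap (ν := ν) (s := univ) (g := kerT x)
    (measurable_kerT_right x).aemeasurable
  simp only [Measure.restrict_univ] at h2
  rw [← h2]
  simp only [mul_comm]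

lemma measurable_logT_prod : Measurable fun p : ℂ × ℂ => logT p.1 p.2 := by
  unfold logT; fun_prop

/-- Energy of the potential in terms of the logarithmic energy. -/
lemma lintegral_potT_sq_le (hν : ν univ = 1) (hd : ∀ᵐ x ∂ν, x ∈ odisc)
    (hna : ∀ x, ∀ᵐ x' ∂ν, x ≠ x') {b : ℝ≥0∞}
    (hb : ∀ x ∈ odisc, ∫⁻ x', ENNReal.ofReal (π * logT x x') ∂ν ≤ b) :
    ∫⁻ y, potT ν y ^ 2 ≤ ENNReal.ofReal (4 * π) + (b + b) := by
  rw [lintegral_potT_sq]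
  have hm : Measurable fun p : ℂ × ℂ => ENNReal.ofReal (π * logT p.1 p.2) :=
    (measurable_logT_prod.const_mul π).ennreal_ofReal
  have h1 : ∫⁻ x, ∫⁻ x', (∫⁻ y, kerT x y * kerT x' y) ∂ν ∂ν ≤
      ∫⁻ x, ∫⁻ x', (ENNReal.ofReal (4 * π) + (ENNReal.ofReal (π * logT x x') +
        ENNReal.ofReal (π * logT x' x))) ∂ν ∂ν := by
    refine lintegral_mono_ae ?_
    filter_upwards [hd] with x hx
    refine lintegral_mono_ae ?_
    filter_upwards [hd, hna x] with x' hx' hne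
    exact lintegral_kerT_mul_kerT_le hx hx' hne
  refine h1.trans ?_
  have hl : ∀ x, Measurable fun x' => ENNReal.ofReal (π * logT x x') := fun x =>
    ((measurable_logT x).const_mul π).ennreal_ofReal
  have h2 : ∀ x, ∫⁻ x', (ENNReal.ofReal (4 * π) + (ENNReal.ofReal (π * logT x x') +
        ENNReal.ofReal (π * logT x' x))) ∂ν = ENNReal.ofReal (4 * π) +
        (∫⁻ x', ENNReal.ofReal (π * logT x x') ∂ν + ∫⁻ x', ENNReal.ofReal (π * logT x' x) ∂ν) :=
    fun x => by
    rw [lintegral_add_left measurable_const, lintegral_add_left (hl x), lintegral_const, hν, mul_one]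
  have hi : Measurable fun x => ∫⁻ x', ENNReal.ofReal (π * logT x x') ∂ν := hm.lintegral_prod_right'
  have hms : Measurable (Function.uncurry fun x x' : ℂ => ENNReal.ofReal (π * logT x' x)) :=
    ((measurable_logT_prod.comp measurable_swap).const_mul π).ennreal_ofReal
  have h3 : ∫⁻ x, ∫⁻ x', ENNReal.ofReal (π * logT x' x) ∂ν ∂ν =
      ∫⁻ x, ∫⁻ x', ENNReal.ofReal (π * logT x x') ∂ν ∂ν :=
    lintegral_lintegral_swap hms.aemeasurable
  have h4 : ∫⁻ x, ∫⁻ x', ENNReal.ofReal (π * logT x x') ∂ν ∂ν ≤ b := by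
    calc _ ≤ ∫⁻ _, b ∂ν := lintegral_mono_ae (by filter_upwards [hd] with x hx using hb x hx)
      _ = b := by rw [lintegral_const, hν, mul_one]
  simp only [h2]
  rw [lintegral_add_left measurable_const, lintegral_add_left hi, h3, lintegral_const, hν, mul_one]
  gcongr

end

/-- Moser–Trudinger inequality relative to a harmonic weight. -/
lemma log_volU_le {u w : ℂ → ℝ} {dw : ℂ → ℂ →L[ℝ] ℝ} {c : ℕ → ℂ}
    (hc : Summable fun k : ℕ => ((k : ℝ) + 1) * ‖c k‖) {c₀ : ℝ} (h : ZB w dw)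
    (hu : ContinuousOn u cdisc) (hdec : ∀ z, u z = harm c₀ c z + w z) :
    Real.log (volU u) ≤ 2 * (7 * √(∫ z in odisc, gsq (dw z)) + 1) +
      1 / (3 * π) * (∫ z in odisc, gsq (dw z)) + 3 +
      Real.log (2 * circInt (fun z => Real.exp (harm c₀ c z)) ^ 2) := by
  set Len := circInt (fun z => Real.exp (harm c₀ c z)) with hLen
  have hL : 0 < Len := lenU_pos (continuousOn_harm hc c₀)
  have hZ := volU_pos hu
  set Z := volU u with hZd
  set G := ∫ z in odisc, gsq (dw z) with hG
  have hG0 : 0 ≤ G := integral_nonneg fun z => gsq_nonneg _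
  set A := 7 * √G + 1 with hA
  set B := (∫ z in odisc, Real.exp (2 * u z) / Z * (2 * w z)) - Real.log Z +
    Real.log (2 * Len ^ 2) with hB
  have hpi := Real.pi_pos
  have hpc : ContinuousOn (fun z => Real.exp (2 * u z) / Z) cdisc :=
    (continuousOn_const.mul hu).rexp.div_const Z
  have hp0 : ∀ z, 0 ≤ Real.exp (2 * u z) / Z := fun z => by positivity
  have hgibbs : ∀ x ∈ odisc, 0 ≤ B ∧ ∫⁻ z in odisc,
      ENNReal.ofReal (3 / 2 * logT x z * (Real.exp (2 * u z) / Z)) ≤ ENNReal.ofReal B :=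
    fun x hx => gibbs_le hu (continuousOn_harm hc c₀) h.cont hdec
      ((measurable_logT x).const_mul _) (fun z => mul_nonneg (by norm_num) (logT_nonneg x z))
      (by positivity) (lintegral_exp_logT_le hc c₀ hx)
  have hB0 : 0 ≤ B := (hgibbs 0 (mem_odisc.2 (by simp))).1
  have hdm : AEMeasurable (fun z => ENNReal.ofReal (Real.exp (2 * u z) / Z))
      (volume.restrict odisc) :=
    ((hpc.mono odisc_subset_cdisc).aemeasurable measurableSet_ball).ennreal_ofReal
  set ν : Measure ℂ := (volume.restrict odisc).withDensity
    (fun z => ENNReal.ofReal (Real.exp (2 * u z) / Z)) with hν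
  have hac : ν ≪ volume.restrict odisc := withDensity_absolutelyContinuous _ _
  have hν1 : ν univ = 1 := by
    rw [hν, withDensity_apply _ MeasurableSet.univ, Measure.restrict_univ,
      ← ofReal_integral_eq_lintegral_ofReal (integrableOn_odisc hpc) (.of_forall hp0),
      integral_div, ← volU, ← hZd, div_self hZ.ne', ENNReal.ofReal_one]
  have hd : ∀ᵐ x ∂ν, x ∈ odisc := hac.ae_le (ae_restrict_mem measurableSet_ball)
  have hna : ∀ x, ∀ᵐ x' ∂ν, x ≠ x' := fun x => by
    refine hac.ae_le (ae_restrict_of_ae ?_)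
    filter_upwards [compl_mem_ae_iff.2 (measure_singleton (μ := (volume : Measure ℂ)) x)] with y hy
    exact fun h => hy h.symm
  have hb : ∀ x ∈ odisc, ∫⁻ x', ENNReal.ofReal (π * logT x x') ∂ν ≤
      ENNReal.ofReal (2 * π / 3 * B) := fun x hx => by
    have hm : Measurable fun x' => ENNReal.ofReal (π * logT x x') :=
      ((measurable_logT x).const_mul π).ennreal_ofReal
    rw [hν, lintegral_withDensity_eq_lintegral_mul₀ hdm hm.aemeasurable]
    have e : ∀ z, ((fun z => ENNReal.ofReal (Real.exp (2 * u z) / Z)) *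
        fun x' => ENNReal.ofReal (π * logT x x')) z =
        ENNReal.ofReal (2 * π / 3) *
          ENNReal.ofReal (3 / 2 * logT x z * (Real.exp (2 * u z) / Z)) := fun z => by
      rw [Pi.mul_apply, ← ENNReal.ofReal_mul (hp0 z), ← ENNReal.ofReal_mul (by positivity)]
      congr 1; ring
    rw [lintegral_congr e, lintegral_const_mul' _ _ ENNReal.ofReal_ne_top,
      ENNReal.ofReal_mul (by positivity)]
    exact mul_le_mul_right (hgibbs x hx).2 _
  have hΦ := lintegral_potT_sq_le hν1 hd hna hb
  have hgm := h.sqrt_aemeasurable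
  set g : ℂ → ℝ≥0∞ := fun y => ENNReal.ofReal √(gsq (dw y)) with hg
  have hg2 : ∫⁻ y in odisc, g y ^ 2 = ENNReal.ofReal G := by
    rw [hG, ofReal_integral_eq_lintegral_ofReal (integrableOn_odisc (continuousOn_gsq h.contD))
      (.of_forall fun z => gsq_nonneg _)]
    refine lintegral_congr fun y => ?_
    rw [hg, ← ENNReal.ofReal_pow (Real.sqrt_nonneg _), Real.sq_sqrt (gsq_nonneg _)]
  have hmid : ENNReal.ofReal (1 / π) * ∫⁻ y in odisc, g y * potT ν y ≤
      ENNReal.ofReal (1 / (3 * π) * G + 3 + B) := by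
    rw [← lintegral_const_mul' _ _ ENNReal.ofReal_ne_top]
    calc _ ≤ ∫⁻ y in odisc, (ENNReal.ofReal (1 / (3 * π)) * g y ^ 2 +
          ENNReal.ofReal (3 / (4 * π)) * potT ν y ^ 2) := by
          refine lintegral_mono fun y => ENNReal.ofReal_mul_mul_le (by positivity) (by positivity)
            (by positivity) (le_of_eq ?_) _ _
          field_simp
          try norm_num
      _ = ENNReal.ofReal (1 / (3 * π)) * ENNReal.ofReal G +
          ENNReal.ofReal (3 / (4 * π)) * ∫⁻ y in odisc, potT ν y ^ 2 := by
          rw [lintegral_add_left' ((hgm.pow_const 2).const_mul _),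
            lintegral_const_mul' _ _ ENNReal.ofReal_ne_top,
            lintegral_const_mul' _ _ ENNReal.ofReal_ne_top, hg2]
      _ ≤ ENNReal.ofReal (1 / (3 * π)) * ENNReal.ofReal G +
          ENNReal.ofReal (3 / (4 * π)) * (ENNReal.ofReal (4 * π) +
            (ENNReal.ofReal (2 * π / 3 * B) + ENNReal.ofReal (2 * π / 3 * B))) := by
          gcongr
          exact (setLIntegral_le_lintegral _ _).trans hΦ
      _ = _ := by
          rw [← ENNReal.ofReal_add (by positivity) (by positivity),
            ← ENNReal.ofReal_add (by positivity) (by positivity),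
            ← ENNReal.ofReal_mul (by positivity), ← ENNReal.ofReal_mul (by positivity),
            ← ENNReal.ofReal_add (by positivity) (by positivity)]
          congr 1
          field_simp
          ring
  have hwm : AEMeasurable (fun z => ENNReal.ofReal (w z)) (volume.restrict odisc) :=
    ((h.cont.mono odisc_subset_cdisc).aemeasurable measurableSet_ball).ennreal_ofReal
  have hW : ∫⁻ x, ENNReal.ofReal (w x) ∂ν ≤ ENNReal.ofReal A +
      ENNReal.ofReal (1 / (2 * π)) * ∫⁻ y in odisc, g y * potT ν y := by
    calc _ ≤ ∫⁻ x, (ENNReal.ofReal A + ENNReal.ofReal (1 / (2 * π)) *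
          ∫⁻ y in odisc, kerT x y * g y) ∂ν :=
          lintegral_mono_ae (by filter_upwards [hd] with x hx using h.le_potential hx)
      _ = _ := by
          rw [lintegral_add_left measurable_const, lintegral_const, hν1, mul_one,
            lintegral_const_mul' _ _ ENNReal.ofReal_ne_top, lintegral_kerT_mul_swap hgm]
  have hWr : ENNReal.ofReal (∫ z in odisc, Real.exp (2 * u z) / Z * w z) ≤
      ∫⁻ x, ENNReal.ofReal (w x) ∂ν := by
    have hcm : ContinuousOn (fun z => Real.exp (2 * u z) / Z * max (w z) 0) cdisc :=
      hpc.mul (ContinuousOn.sup h.cont continuousOn_const)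
    have hle : ∫ z in odisc, Real.exp (2 * u z) / Z * w z ≤
        ∫ z in odisc, Real.exp (2 * u z) / Z * max (w z) 0 :=
      integral_mono (integrableOn_odisc (hpc.mul h.cont)) (integrableOn_odisc hcm)
        fun z => mul_le_mul_of_nonneg_left (le_max_left _ _) (hp0 z)
    refine (ENNReal.ofReal_le_ofReal hle).trans ?_
    rw [ofReal_integral_eq_lintegral_ofReal (integrableOn_odisc hcm)
      (.of_forall fun z => mul_nonneg (hp0 z) (le_max_right _ _)), hν,
      lintegral_withDensity_eq_lintegral_mul₀ hdm hwm]
    refine le_of_eq (lintegral_congr fun z => ?_)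
    rw [Pi.mul_apply, ENNReal.ofReal_mul (hp0 z), ENNReal.ofReal_max, ENNReal.ofReal_zero,
      max_eq_left zero_le]
  have hI : ∫ z in odisc, Real.exp (2 * u z) / Z * (2 * w z) =
      2 * ∫ z in odisc, Real.exp (2 * u z) / Z * w z := by
    rw [← integral_const_mul]; congr 1; ext z; ring
  have hfin : ENNReal.ofReal (2 * ∫ z in odisc, Real.exp (2 * u z) / Z * w z) ≤
      ENNReal.ofReal (2 * A + (1 / (3 * π) * G + 3 + B)) := by
    rw [ENNReal.ofReal_mul two_pos.le, ENNReal.ofReal_add (by positivity) (by positivity)]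
    refine (mul_le_mul_right (hWr.trans hW) _).trans ?_
    rw [mul_add, ← ENNReal.ofReal_mul two_pos.le, ← mul_assoc, ← ENNReal.ofReal_mul two_pos.le,
      show 2 * (1 / (2 * π)) = 1 / π by field_simp]
    exact add_le_add_right hmid _
  rw [ENNReal.ofReal_le_ofReal_iff (by positivity)] at hfin
  rw [hB, hI] at hfin
  linarith

/-- Lower bound of the boundary length by the area and the quadratic energy. -/
lemma exists_log_volU_le : ∃ C : ℝ, ∀ u : ℂ → ℝ, ContDiffOn ℝ (⊤ : ℕ∞) u cdisc →
    Real.log (volU u) ≤ C + 2 / 5 * Real.log (lenU u) + 4 / (5 * π) * quadU u := by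
  refine ⟨5 + Real.log 2 + 735 * π + 16 / 5 * Real.log (10 * π), fun u hu => ?_⟩
  obtain ⟨c₀, c, w, dw, hc, hZ, hdec, hlen, hq⟩ := exists_decomp hu
  have h1 := log_volU_le hc hZ hu.continuousOn hdec
  have h2 := log_circInt_exp_harm_le hc c₀
  have hL := lenU_pos hu.continuousOn
  rw [hlen] at h1 h2
  set G := ∫ z in odisc, gsq (dw z) with hG
  have hG0 : 0 ≤ G := integral_nonneg fun z => gsq_nonneg _
  have hpi := Real.pi_pos
  rw [Real.log_mul two_ne_zero (by positivity), Real.log_pow] at h1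
  set D := c₀ + ∑' k : ℕ, ((k : ℝ) + 1) * ‖c k‖ ^ 2
  have h3 : 14 * √G ≤ 1 / (15 * π) * G + 735 * π := by
    have h4 := Real.sq_sqrt hG0
    have h5 := sq_nonneg (√G - 105 * π)
    have e : (√G - 105 * π) ^ 2 = G + 105 * π * (105 * π - 2 * √G) := by
      rw [sub_sq, h4]; ring
    have : 1 / (15 * π) * G + 735 * π - 14 * √G = (√G - 105 * π) ^ 2 / (15 * π) := by
      rw [e]
      field_simp
      ring
    have : 0 ≤ (√G - 105 * π) ^ 2 / (15 * π) := by positivity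
    linarith
  have h6 : 4 / (5 * π) * quadU u = 2 / (5 * π) * G + 8 / 5 * D := by
    rw [← hq]; field_simp; ring
  have h7 : 1 / (15 * π) * G + 1 / (3 * π) * G = 2 / (5 * π) * G := by field_simp; ring
  push_cast at h1
  rw [h6]
  linarith

section FlowDom
variable {T : ℝ≥0∞}

lemma flowDom_of_le {b s : ℝ} (hb : b ∈ flowDom T) (h0 : 0 ≤ s) (h : s ≤ b) : s ∈ flowDom T :=
  ⟨h0, (ENNReal.ofReal_le_ofReal h).trans_lt hb.2⟩

lemma exists_gt_flowDom {t : ℝ} (ht : t ∈ flowDom T) : ∃ b ∈ flowDom T, t < b := by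
  obtain ⟨c, hc1, hc2⟩ := exists_between ht.2
  have hct : c ≠ ∞ := (hc2.trans_le le_top).ne
  have h : t < c.toReal := by
    rcases (ENNReal.ofReal_lt_iff_lt_toReal ht.1 hct).1 hc1 with h
    exact h
  exact ⟨c.toReal, ⟨ht.1.trans h.le, by rwa [ENNReal.ofReal_toReal hct]⟩, h⟩

lemma flowDom_mem_nhds {t : ℝ} (ht : t ∈ flowDom T) (h0 : 0 < t) : flowDom T ∈ 𝓝 t := by
  obtain ⟨b, hb, htb⟩ := exists_gt_flowDom ht
  filter_upwards [Icc_mem_nhds h0 htb] with s hs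
  exact flowDom_of_le hb hs.1 hs.2

lemma convex_flowDom : Convex ℝ (flowDom T) := by
  have : (flowDom T).OrdConnected := by
    constructor
    intro x hx y hy s hs
    exact flowDom_of_le hy (hx.1.trans hs.1) hs.2
  exact this.convex

lemma pos_of_mem_interior_flowDom {t : ℝ} (ht : t ∈ interior (flowDom T)) : 0 < t := by
  have h : interior (flowDom T) ⊆ interior (Ici 0) := interior_mono fun s hs => hs.1
  simpa using h ht

lemma uniqueDiffOn_flowDom : UniqueDiffOn ℝ (flowDom T) := by
  rcases (flowDom T).eq_empty_or_nonempty with h | ⟨t, ht⟩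
  · rw [h]; exact uniqueDiffOn_empty
  · obtain ⟨b, hb, htb⟩ := exists_gt_flowDom ht
    obtain ⟨c, hc⟩ := exists_between htb
    refine uniqueDiffOn_convex convex_flowDom ⟨c, mem_interior_iff_mem_nhds.2 ?_⟩
    exact flowDom_mem_nhds (flowDom_of_le hb (ht.1.trans hc.1.le) hc.2.le) (ht.1.trans_lt hc.1)

end FlowDom

section Param
variable {T : ℝ≥0∞} {X : Type*} [MeasurableSpace X] {μ : Measure X} [IsFiniteMeasure μ]
  {e : X → ℂ} {K : Set ℂ} {F F' : ℂ × ℝ → ℝ}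

lemma exists_param_bound (hK : IsCompact K) (hF : ContinuousOn F (K ×ˢ flowDom T)) {t : ℝ}
    (ht : t ∈ flowDom T) : ∃ b C : ℝ, t < b ∧ b ∈ flowDom T ∧
      ∀ z ∈ K, ∀ s, 0 ≤ s → s ≤ b → |F (z, s)| ≤ C := by
  obtain ⟨b, hb, htb⟩ := exists_gt_flowDom ht
  have hc : IsCompact (K ×ˢ Icc 0 b) := hK.prod isCompact_Icc
  have hsub : K ×ˢ Icc 0 b ⊆ K ×ˢ flowDom T :=
    prod_mono_right fun s hs => flowDom_of_le hb hs.1 hs.2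
  obtain ⟨C, hC⟩ := hc.exists_bound_of_continuousOn (hF.mono hsub)
  exact ⟨b, C, htb, hb, fun z hz s h0 hs => hC (z, s) ⟨hz, h0, hs⟩⟩

lemma continuousOn_slice (hF : ContinuousOn F (K ×ˢ flowDom T)) {t : ℝ} (ht : t ∈ flowDom T) :
    ContinuousOn (fun z => F (z, t)) K :=
  hF.comp (by fun_prop) fun _ hz => ⟨hz, ht⟩

lemma continuousOn_param (hK : IsCompact K) (he : ∀ᵐ x ∂μ, e x ∈ K)
    (hm : ∀ φ : ℂ → ℝ, ContinuousOn φ K → AEStronglyMeasurable (fun x => φ (e x)) μ)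
    (hF : ContinuousOn F (K ×ˢ flowDom T)) :
    ContinuousOn (fun t => ∫ x, F (e x, t) ∂μ) (flowDom T) := by
  intro t ht
  obtain ⟨b, C, htb, hb, hC⟩ := exists_param_bound hK hF ht
  have hev : ∀ᶠ s in 𝓝[flowDom T] t, s < b := mem_nhdsWithin_of_mem_nhds (Iio_mem_nhds htb)
  refine continuousWithinAt_of_dominated (bound := fun _ => C) ?_ ?_ (integrable_const C) ?_
  · filter_upwards [self_mem_nhdsWithin] with s hs
    exact hm _ (continuousOn_slice hF hs)
  · filter_upwards [self_mem_nhdsWithin, hev] with s hs hsb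
    filter_upwards [he] with x hx
    exact hC _ hx s hs.1 hsb.le
  · filter_upwards [he] with x hx
    exact (hF (e x, t) ⟨hx, ht⟩).comp (by fun_prop) fun s hs => ⟨hx, hs⟩

lemma hasDerivAt_param (hK : IsCompact K) (he : ∀ᵐ x ∂μ, e x ∈ K)
    (hm : ∀ φ : ℂ → ℝ, ContinuousOn φ K → AEStronglyMeasurable (fun x => φ (e x)) μ)
    (hF : ContinuousOn F (K ×ˢ flowDom T)) (hF' : ContinuousOn F' (K ×ˢ flowDom T))
    (hd : ∀ z ∈ K, ∀ t ∈ flowDom T, 0 < t → HasDerivAt (fun s => F (z, s)) (F' (z, t)) t)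
    {t : ℝ} (ht : t ∈ flowDom T) (h0 : 0 < t) :
    HasDerivAt (fun t => ∫ x, F (e x, t) ∂μ) (∫ x, F' (e x, t) ∂μ) t := by
  obtain ⟨b, C, htb, hb, hC⟩ := exists_param_bound hK hF' ht
  obtain ⟨b', C', -, hb', hC'⟩ := exists_param_bound hK hF ht
  have hin : Ioo 0 b ⊆ flowDom T := fun s hs => flowDom_of_le hb hs.1.le hs.2.le
  refine (hasDerivAt_integral_of_dominated_loc_of_deriv_le (μ := μ) (bound := fun _ => C)
    (F := fun t x => F (e x, t)) (F' := fun t x => F' (e x, t))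
    (Ioo_mem_nhds h0 htb) ?_ ?_ ?_ ?_ (integrable_const C) ?_).2
  · filter_upwards [flowDom_mem_nhds ht h0] with s hs
    exact hm _ (continuousOn_slice hF hs)
  · obtain ⟨C₀, hC₀⟩ := hK.exists_bound_of_continuousOn (continuousOn_slice hF ht)
    refine Integrable.of_bound (hm _ (continuousOn_slice hF ht)) C₀ ?_
    filter_upwards [he] with x hx
    exact hC₀ _ hx
  · exact hm _ (continuousOn_slice hF' ht)
  · filter_upwards [he] with x hx s hs
    exact hC _ hx s hs.1.le hs.2.le
  · filter_upwards [he] with x hx s hs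
    exact hd _ hx s (hin hs) hs.1

end Param

section ParamDisc
variable {T : ℝ≥0∞} {F F' : ℂ × ℝ → ℝ}

instance : IsFiniteMeasure (volume.restrict odisc) :=
  ⟨by simp [odisc, measure_ball_lt_top]⟩

lemma ae_odisc : ∀ᵐ x ∂(volume.restrict odisc), x ∈ cdisc := by
  filter_upwards [ae_restrict_mem (measurableSet_ball : MeasurableSet odisc)] with x hx
  exact odisc_subset_cdisc hx

lemma aesm_odisc (φ : ℂ → ℝ) (h : ContinuousOn φ cdisc) :
    AEStronglyMeasurable (fun x => φ x) (volume.restrict odisc) :=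
  (h.mono odisc_subset_cdisc).aestronglyMeasurable measurableSet_ball

lemma isCompact_bdry : IsCompact bdry := isCompact_sphere _ _

lemma continuous_comp_bpt {φ : ℂ → ℝ} (h : ContinuousOn φ bdry) : Continuous fun θ => φ (bpt θ) :=
  h.comp_continuous continuous_bpt bpt_mem_bdry

lemma circInt_eq_Ioc (φ : ℂ → ℝ) : circInt φ = ∫ θ in Ioc 0 (2 * π), φ (bpt θ) :=
  intervalIntegral.integral_of_le Real.two_pi_pos.le

lemma continuousOn_ballInt_param (hF : ContinuousOn F (cdisc ×ˢ flowDom T)) :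
    ContinuousOn (fun t => ∫ z in odisc, F (z, t)) (flowDom T) :=
  continuousOn_param (e := fun z : ℂ => z) isCompact_cdisc ae_odisc aesm_odisc hF

lemma hasDerivAt_ballInt_param
    (hF : ContinuousOn F (cdisc ×ˢ flowDom T)) (hF' : ContinuousOn F' (cdisc ×ˢ flowDom T))
    (hd : ∀ z ∈ cdisc, ∀ t ∈ flowDom T, 0 < t → HasDerivAt (fun s => F (z, s)) (F' (z, t)) t)
    {t : ℝ} (ht : t ∈ flowDom T) (h0 : 0 < t) :
    HasDerivAt (fun t => ∫ z in odisc, F (z, t)) (∫ z in odisc, F' (z, t)) t :=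
  hasDerivAt_param (e := fun z : ℂ => z) isCompact_cdisc ae_odisc aesm_odisc hF hF' hd ht h0

lemma continuousOn_circInt_param (hF : ContinuousOn F (bdry ×ˢ flowDom T)) :
    ContinuousOn (fun t => circInt fun z => F (z, t)) (flowDom T) := by
  simp only [circInt_eq_Ioc]
  exact continuousOn_param isCompact_bdry (Eventually.of_forall bpt_mem_bdry)
    (fun φ h => (continuous_comp_bpt h).aestronglyMeasurable) hF

lemma hasDerivAt_circInt_param
    (hF : ContinuousOn F (bdry ×ˢ flowDom T)) (hF' : ContinuousOn F' (bdry ×ˢ flowDom T))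
    (hd : ∀ z ∈ bdry, ∀ t ∈ flowDom T, 0 < t → HasDerivAt (fun s => F (z, s)) (F' (z, t)) t)
    {t : ℝ} (ht : t ∈ flowDom T) (h0 : 0 < t) :
    HasDerivAt (fun t => circInt fun z => F (z, t)) (circInt fun z => F' (z, t)) t := by
  simp only [circInt_eq_Ioc]
  exact hasDerivAt_param isCompact_bdry (Eventually.of_forall bpt_mem_bdry)
    (fun φ h => (continuous_comp_bpt h).aestronglyMeasurable) hF hF' hd ht h0

end ParamDisc

section Slice
variable {T : ℝ≥0∞} {E : Type*} [NormedAddCommGroup E] [NormedSpace ℝ E] {G : ℂ × ℝ → E}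
  {G' : ℂ × ℝ →L[ℝ] E} {z : ℂ} {t : ℝ}

lemma hasDerivAt_time_slice (h : HasFDerivWithinAt G G' (cdisc ×ˢ flowDom T) (z, t))
    (hz : z ∈ cdisc) (ht : t ∈ flowDom T) (h0 : 0 < t) :
    HasDerivAt (fun s => G (z, s)) (G' (0, 1)) t := by
  have h1 : HasDerivWithinAt (fun s : ℝ => ((z, s) : ℂ × ℝ)) (0, 1) (flowDom T) t :=
    ((hasDerivAt_const t z).prodMk (hasDerivAt_id t)).hasDerivWithinAt
  exact (h.comp_hasDerivWithinAt t h1 fun s hs => ⟨hz, hs⟩).hasDerivAt (flowDom_mem_nhds ht h0)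

lemma hasFDerivWithinAt_space_slice (h : HasFDerivWithinAt G G' (cdisc ×ˢ flowDom T) (z, t))
    (ht : t ∈ flowDom T) :
    HasFDerivWithinAt (fun w => G (w, t)) (G'.comp (ContinuousLinearMap.inl ℝ ℂ ℝ)) cdisc z := by
  have h1 : HasFDerivWithinAt (fun w : ℂ => ((w, t) : ℂ × ℝ)) (ContinuousLinearMap.inl ℝ ℂ ℝ)
      cdisc z := (hasFDerivAt_prodMk_left z t).hasFDerivWithinAt
  have h2 : MapsTo (fun w : ℂ => ((w, t) : ℂ × ℝ)) cdisc (cdisc ×ˢ flowDom T) :=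
    fun w hw => ⟨hw, ht⟩
  exact HasFDerivWithinAt.comp z h h1 h2

end Slice

lemma continuousOn_lapW {w : ℂ → ℝ} (hw : ContDiffOn ℝ (⊤ : ℕ∞) w cdisc) :
    ContinuousOn (lapW w) cdisc := by
  have hd : ∀ a : ℂ, ContinuousOn (fun z => fderivWithin ℝ
      (fun x => fderivWithin ℝ w cdisc x a) cdisc z a) cdisc := fun a =>
    continuousOn_dir (((hw.fderivWithin uniqueDiffOn_cdisc (m := 1)
      (by norm_cast)).clm_apply contDiffOn_const)) a
  exact (hd 1).add (hd Complex.I)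

lemma continuousOn_nder {w : ℂ → ℝ} (hw : ContDiffOn ℝ (⊤ : ℕ∞) w cdisc) :
    ContinuousOn (nder w) cdisc :=
  (hw.continuousOn_fderivWithin uniqueDiffOn_cdisc (by simp)).clm_apply continuousOn_id

lemma circInt_add {φ χ : ℂ → ℝ} (hφ : ContinuousOn φ bdry) (hχ : ContinuousOn χ bdry) :
    circInt (fun z => φ z + χ z) = circInt φ + circInt χ :=
  intervalIntegral.integral_add ((continuous_comp_bpt hφ).intervalIntegrable _ _)
    ((continuous_comp_bpt hχ).intervalIntegrable _ _)

lemma circInt_sub {φ χ : ℂ → ℝ} (hφ : ContinuousOn φ bdry) (hχ : ContinuousOn χ bdry) :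
    circInt (fun z => φ z - χ z) = circInt φ - circInt χ :=
  intervalIntegral.integral_sub ((continuous_comp_bpt hφ).intervalIntegrable _ _)
    ((continuous_comp_bpt hχ).intervalIntegrable _ _)

lemma circInt_congr {φ χ : ℂ → ℝ} (h : ∀ z ∈ bdry, φ z = χ z) : circInt φ = circInt χ :=
  intervalIntegral.integral_congr fun θ _ => h _ (bpt_mem_bdry θ)

/-- The space-time derivative of `u` on `cdisc × [0, T)`. -/
def flowD1 (T : ℝ≥0∞) (u : ℂ → ℝ → ℝ) : ℂ × ℝ → ℂ × ℝ →L[ℝ] ℝ :=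
  fderivWithin ℝ (fun p : ℂ × ℝ => u p.1 p.2) (cdisc ×ˢ flowDom T)

/-- The second space-time derivative of `u` on `cdisc × [0, T)`. -/
def flowD2 (T : ℝ≥0∞) (u : ℂ → ℝ → ℝ) : ℂ × ℝ → ℂ × ℝ →L[ℝ] ℂ × ℝ →L[ℝ] ℝ :=
  fderivWithin ℝ (flowD1 T u) (cdisc ×ˢ flowDom T)

lemma uniqueDiffOn_flow (T : ℝ≥0∞) : UniqueDiffOn ℝ (cdisc ×ˢ flowDom T) :=
  uniqueDiffOn_cdisc.prod uniqueDiffOn_flowDom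

section Smooth
variable {T : ℝ≥0∞} {u : ℂ → ℝ → ℝ}
  (hu : ContDiffOn ℝ (⊤ : ℕ∞) (fun p : ℂ × ℝ => u p.1 p.2) (cdisc ×ˢ flowDom T))
  {z : ℂ} {t : ℝ}
include hu

lemma contDiffOn_flowD1 : ContDiffOn ℝ (⊤ : ℕ∞) (flowD1 T u) (cdisc ×ˢ flowDom T) :=
  hu.fderivWithin (uniqueDiffOn_flow T) (by simp)

lemma continuousOn_flowD2 : ContinuousOn (flowD2 T u) (cdisc ×ˢ flowDom T) :=
  (contDiffOn_flowD1 hu).continuousOn_fderivWithin (uniqueDiffOn_flow T) (by simp)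

lemma hasFDerivWithinAt_flow (hz : z ∈ cdisc) (ht : t ∈ flowDom T) :
    HasFDerivWithinAt (fun p : ℂ × ℝ => u p.1 p.2) (flowD1 T u (z, t)) (cdisc ×ˢ flowDom T) (z, t) :=
  (hu.differentiableOn (by simp) _ ⟨hz, ht⟩).hasFDerivWithinAt

lemma hasFDerivWithinAt_flowD1 (hz : z ∈ cdisc) (ht : t ∈ flowDom T) :
    HasFDerivWithinAt (flowD1 T u) (flowD2 T u (z, t)) (cdisc ×ˢ flowDom T) (z, t) :=
  ((contDiffOn_flowD1 hu).differentiableOn (by simp) _ ⟨hz, ht⟩).hasFDerivWithinAt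

lemma hasDerivAt_flow (hz : z ∈ cdisc) (ht : t ∈ flowDom T) (h0 : 0 < t) :
    HasDerivAt (u z) (flowD1 T u (z, t) (0, 1)) t :=
  hasDerivAt_time_slice (hasFDerivWithinAt_flow hu hz ht) hz ht h0

lemma fderivWithin_flow (hz : z ∈ cdisc) (ht : t ∈ flowDom T) (a : ℂ) :
    fderivWithin ℝ (fun w => u w t) cdisc z a = flowD1 T u (z, t) (a, 0) := by
  have h := hasFDerivWithinAt_space_slice (hasFDerivWithinAt_flow hu hz ht) ht
  rw [h.fderivWithin (uniqueDiffOn_cdisc z hz)]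
  rfl

lemma hasDerivAt_flowD1 (hz : z ∈ cdisc) (ht : t ∈ flowDom T) (h0 : 0 < t) (a : ℂ × ℝ) :
    HasDerivAt (fun s => flowD1 T u (z, s) a) (flowD2 T u (z, t) (0, 1) a) t := by
  have h := hasDerivAt_time_slice (hasFDerivWithinAt_flowD1 hu hz ht) hz ht h0
  simpa using h.clm_apply (hasDerivAt_const t a)

lemma flowD2_symm (hz : z ∈ cdisc) (ht : t ∈ flowDom T) (a b : ℂ × ℝ) :
    flowD2 T u (z, t) a b = flowD2 T u (z, t) b a := by
  have hi : (z, t) ∈ closure (interior (cdisc ×ˢ flowDom T)) := by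
    obtain ⟨b, hb, htb⟩ := exists_gt_flowDom ht
    have hd : odisc ×ˢ Ioo t b ⊆ interior (cdisc ×ˢ flowDom T) := by
      refine interior_maximal (prod_mono odisc_subset_cdisc fun s hs =>
        flowDom_of_le hb (ht.1.trans hs.1.le) hs.2.le) (isOpen_ball.prod isOpen_Ioo)
    refine closure_mono hd ?_
    rw [closure_prod_eq, closure_Ioo htb.ne, odisc, closure_ball _ one_ne_zero]
    exact ⟨hz, le_rfl, htb.le⟩
  exact (hu (z, t) ⟨hz, ht⟩).isSymmSndFDerivWithinAt (by simp; norm_cast) (uniqueDiffOn_flow T) hi ⟨hz, ht⟩ a b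

lemma contDiffOn_slice (ht : t ∈ flowDom T) : ContDiffOn ℝ (⊤ : ℕ∞) (fun w => u w t) cdisc :=
  hu.comp (f := fun w : ℂ => ((w, t) : ℂ × ℝ)) (by fun_prop) fun w hw => ⟨hw, ht⟩

lemma contDiffOn_flow_time (ht : t ∈ flowDom T) :
    ContDiffOn ℝ (⊤ : ℕ∞) (fun w => flowD1 T u (w, t) (0, 1)) cdisc := by
  have h : ContDiffOn ℝ (⊤ : ℕ∞) (fun w => flowD1 T u (w, t)) cdisc :=
    (contDiffOn_flowD1 hu).comp (f := fun w : ℂ => ((w, t) : ℂ × ℝ)) (by fun_prop)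
      fun w hw => ⟨hw, ht⟩
  exact h.clm_apply contDiffOn_const

lemma fderivWithin_flow_time (hz : z ∈ cdisc) (ht : t ∈ flowDom T) (a : ℂ) :
    fderivWithin ℝ (fun w => flowD1 T u (w, t) (0, 1)) cdisc z a =
      flowD2 T u (z, t) (0, 1) (a, 0) := by
  have h := hasFDerivWithinAt_space_slice (hasFDerivWithinAt_flowD1 hu hz ht) ht
  have h2 := h.clm_apply (hasFDerivWithinAt_const ((0 : ℂ), (1 : ℝ)) z cdisc)
  rw [h2.fderivWithin (uniqueDiffOn_cdisc z hz), flowD2_symm hu hz ht]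
  simp

lemma continuousOn_flowD1_apply (a : ℂ × ℝ) :
    ContinuousOn (fun p => flowD1 T u p a) (cdisc ×ˢ flowDom T) :=
  (contDiffOn_flowD1 hu).continuousOn.clm_apply continuousOn_const

lemma continuousOn_flowD2_apply (a b : ℂ × ℝ) :
    ContinuousOn (fun p => flowD2 T u p a b) (cdisc ×ˢ flowDom T) :=
  ((continuousOn_flowD2 hu).clm_apply continuousOn_const).clm_apply continuousOn_const

lemma quadU_flow_eq (ht : t ∈ flowDom T) : quadU (fun w => u w t) =
    1 / 2 * (∫ z in odisc, ((flowD1 T u (z, t) (1, 0)) ^ 2 + (flowD1 T u (z, t) (Complex.I, 0)) ^ 2))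
      + circInt fun z => u z t := by
  unfold quadU
  congr 2
  refine setIntegral_congr_fun measurableSet_ball fun z hz => ?_
  simp only [gsq, fderivWithin_flow hu (odisc_subset_cdisc hz) ht]

lemma continuousOn_quadU : ContinuousOn (fun t => quadU fun w => u w t) (flowDom T) := by
  have h1 : ContinuousOn (fun t => ∫ z in odisc,
      ((flowD1 T u (z, t) (1, 0)) ^ 2 + (flowD1 T u (z, t) (Complex.I, 0)) ^ 2)) (flowDom T) :=
    continuousOn_ballInt_param (F := fun p => (flowD1 T u p (1, 0)) ^ 2 +
      (flowD1 T u p (Complex.I, 0)) ^ 2)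
      (((continuousOn_flowD1_apply hu _).pow 2).add ((continuousOn_flowD1_apply hu _).pow 2))
  have h2 : ContinuousOn (fun t => circInt fun z => u z t) (flowDom T) :=
    continuousOn_circInt_param (F := fun p => u p.1 p.2)
      (hu.continuousOn.mono (prod_mono_left bdry_subset_cdisc))
  exact ((continuousOn_const.mul h1).add h2).congr fun t ht => quadU_flow_eq hu ht

lemma hasDerivAt_quadU (ht : t ∈ flowDom T) (h0 : 0 < t) :
    HasDerivAt (fun t => quadU fun w => u w t)
      ((circInt fun z => flowD1 T u (z, t) (0, 1) * (nder (fun w => u w t) z + 1)) -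
        ∫ z in odisc, flowD1 T u (z, t) (0, 1) * lapW (fun w => u w t) z) t := by
  have h1 := hasDerivAt_ballInt_param (T := T)
    (F := fun p => (flowD1 T u p (1, 0)) ^ 2 + (flowD1 T u p (Complex.I, 0)) ^ 2)
    (F' := fun p => 2 * (flowD1 T u p (1, 0) * flowD2 T u p (0, 1) (1, 0) +
      flowD1 T u p (Complex.I, 0) * flowD2 T u p (0, 1) (Complex.I, 0)))
    (((continuousOn_flowD1_apply hu _).pow 2).add ((continuousOn_flowD1_apply hu _).pow 2))
    (continuousOn_const.mul
      (((continuousOn_flowD1_apply hu _).mul (continuousOn_flowD2_apply hu _ _)).add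
        ((continuousOn_flowD1_apply hu _).mul (continuousOn_flowD2_apply hu _ _))))
    (fun z hz s hs hs0 =>
      (((hasDerivAt_flowD1 hu hz hs hs0 (1, 0)).pow 2).add
        ((hasDerivAt_flowD1 hu hz hs hs0 (Complex.I, 0)).pow 2)).congr_deriv (by simp; ring)) ht h0
  have h2 := hasDerivAt_circInt_param (T := T) (F := fun p => u p.1 p.2)
    (F' := fun p => flowD1 T u p (0, 1))
    (hu.continuousOn.mono (prod_mono_left bdry_subset_cdisc))
    ((continuousOn_flowD1_apply hu _).mono (prod_mono_left bdry_subset_cdisc))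
    (fun z hz s hs hs0 => hasDerivAt_flow hu (bdry_subset_cdisc hz) hs hs0) ht h0
  have h3 := ((h1.const_mul (1 / 2)).add h2).congr_of_eventuallyEq
    (f₁ := fun t => quadU fun w => u w t) (by
      filter_upwards [flowDom_mem_nhds ht h0] with s hs
      exact quadU_flow_eq hu hs)
  refine h3.congr_deriv ?_
  have hsm := contDiffOn_slice hu ht
  have hv := contDiffOn_flow_time hu ht
  have hg := green_disc (hv.of_le (by simp)) (hsm.of_le (m := 2) (by norm_cast))
  have hlap := continuousOn_lapW hsm
  have i1 : IntegrableOn (fun z => flowD1 T u (z, t) (1, 0) * flowD2 T u (z, t) (0, 1) (1, 0) +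
      flowD1 T u (z, t) (Complex.I, 0) * flowD2 T u (z, t) (0, 1) (Complex.I, 0)) odisc :=
    integrableOn_odisc (continuousOn_slice (F := fun p =>
      flowD1 T u p (1, 0) * flowD2 T u p (0, 1) (1, 0) +
      flowD1 T u p (Complex.I, 0) * flowD2 T u p (0, 1) (Complex.I, 0))
      (((continuousOn_flowD1_apply hu _).mul (continuousOn_flowD2_apply hu _ _)).add
        ((continuousOn_flowD1_apply hu _).mul (continuousOn_flowD2_apply hu _ _))) ht)
  have i2 : IntegrableOn (fun z => flowD1 T u (z, t) (0, 1) * lapW (fun w => u w t) z) odisc :=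
    integrableOn_odisc (hv.continuousOn.mul hlap)
  have e1 : (∫ z in odisc, (flowD1 T u (z, t) (1, 0) * flowD2 T u (z, t) (0, 1) (1, 0) +
      flowD1 T u (z, t) (Complex.I, 0) * flowD2 T u (z, t) (0, 1) (Complex.I, 0))) +
      (∫ z in odisc, flowD1 T u (z, t) (0, 1) * lapW (fun w => u w t) z) =
      circInt fun z => flowD1 T u (z, t) (0, 1) * nder (fun w => u w t) z := by
    rw [← hg, ← integral_add i1 i2]
    refine setIntegral_congr_fun measurableSet_ball fun z hz => ?_
    simp only [fderivWithin_flow hu (odisc_subset_cdisc hz) ht,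
      fderivWithin_flow_time hu (odisc_subset_cdisc hz) ht]
    ring
  have hn := continuousOn_nder hsm
  have e2 : (circInt fun z => flowD1 T u (z, t) (0, 1) * (nder (fun w => u w t) z + 1)) =
      (circInt fun z => flowD1 T u (z, t) (0, 1) * nder (fun w => u w t) z) +
      circInt fun z => flowD1 T u (z, t) (0, 1) := by
    rw [← circInt_add (φ := fun z => flowD1 T u (z, t) (0, 1) * nder (fun w => u w t) z)
      ((hv.continuousOn.mul hn).mono bdry_subset_cdisc) (hv.continuousOn.mono bdry_subset_cdisc)]
    simp only [mul_add, mul_one]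
  rw [e2, ← e1, integral_const_mul]
  ring

end Smooth

section FlowQuantities
variable {T : ℝ≥0∞} {u : ℂ → ℝ → ℝ}
  (hu : ContDiffOn ℝ (⊤ : ℕ∞) (fun p : ℂ × ℝ => u p.1 p.2) (cdisc ×ˢ flowDom T))
  {f j : ℂ → ℝ} {t : ℝ}
include hu

lemma continuousOn_weighted_vol (hf : ContinuousOn f cdisc) :
    ContinuousOn (fun t => ∫ z in odisc, f z * Real.exp (2 * u z t)) (flowDom T) :=
  continuousOn_ballInt_param (F := fun p => f p.1 * Real.exp (2 * u p.1 p.2))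
    ((hf.comp continuousOn_fst fun _ hp => hp.1).mul
      (Real.continuous_exp.comp_continuousOn (continuousOn_const.mul hu.continuousOn)))

lemma hasDerivAt_weighted_vol (hf : ContinuousOn f cdisc) (ht : t ∈ flowDom T) (h0 : 0 < t) :
    HasDerivAt (fun t => ∫ z in odisc, f z * Real.exp (2 * u z t))
      (2 * ∫ z in odisc, f z * Real.exp (2 * u z t) * flowD1 T u (z, t) (0, 1)) t := by
  have hF : ContinuousOn (fun p : ℂ × ℝ => f p.1 * Real.exp (2 * u p.1 p.2))
      (cdisc ×ˢ flowDom T) := (hf.comp continuousOn_fst fun _ hp => hp.1).mul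
      (Real.continuous_exp.comp_continuousOn (continuousOn_const.mul hu.continuousOn))
  have h := hasDerivAt_ballInt_param (T := T) (F := fun p => f p.1 * Real.exp (2 * u p.1 p.2))
    (F' := fun p => 2 * (f p.1 * Real.exp (2 * u p.1 p.2) * flowD1 T u p (0, 1))) hF
    (continuousOn_const.mul (hF.mul (continuousOn_flowD1_apply hu _)))
    (fun z hz s hs hs0 => ((((hasDerivAt_flow hu hz hs hs0).const_mul 2).exp).const_mul
      (f z)).congr_deriv (by simp only; ring)) ht h0
  exact h.congr_deriv (integral_const_mul _ _)

lemma continuousOn_weighted_len (hj : ContinuousOn j bdry) :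
    ContinuousOn (fun t => circInt fun z => j z * Real.exp (u z t)) (flowDom T) :=
  continuousOn_circInt_param (F := fun p => j p.1 * Real.exp (u p.1 p.2))
    ((hj.comp continuousOn_fst fun _ hp => hp.1).mul
      (Real.continuous_exp.comp_continuousOn
        (hu.continuousOn.mono (prod_mono_left bdry_subset_cdisc))))

lemma hasDerivAt_weighted_len (hj : ContinuousOn j bdry) (ht : t ∈ flowDom T) (h0 : 0 < t) :
    HasDerivAt (fun t => circInt fun z => j z * Real.exp (u z t))
      (circInt fun z => j z * Real.exp (u z t) * flowD1 T u (z, t) (0, 1)) t := by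
  have hF : ContinuousOn (fun p : ℂ × ℝ => j p.1 * Real.exp (u p.1 p.2)) (bdry ×ˢ flowDom T) :=
    (hj.comp continuousOn_fst fun _ hp => hp.1).mul (Real.continuous_exp.comp_continuousOn
      (hu.continuousOn.mono (prod_mono_left bdry_subset_cdisc)))
  exact hasDerivAt_circInt_param (T := T) (F := fun p => j p.1 * Real.exp (u p.1 p.2))
    (F' := fun p => j p.1 * Real.exp (u p.1 p.2) * flowD1 T u p (0, 1)) hF
    (hF.mul ((continuousOn_flowD1_apply hu _).mono (prod_mono_left bdry_subset_cdisc)))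
    (fun z hz s hs hs0 => (((hasDerivAt_flow hu (bdry_subset_cdisc hz) hs hs0).exp).const_mul
      (j z)).congr_deriv (by simp only; ring)) ht h0

end FlowQuantities

lemma integral_lapW {w : ℂ → ℝ} (hw : ContDiffOn ℝ (⊤ : ℕ∞) w cdisc) :
    ∫ z in odisc, lapW w z = circInt (nder w) := by
  have h := green_disc (v := fun _ => 1) contDiffOn_const (hw.of_le (m := 2) (by norm_cast))
  simpa using h

lemma circInt_const (c : ℝ) : circInt (fun _ => c) = 2 * π * c := by simp [circInt]

section Flow
variable {T : ℝ≥0∞} {u : ℂ → ℝ → ℝ} {ρ : ℝ → ℝ} {f j : ℂ → ℝ} {t : ℝ}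

lemma IsFlow.exp_mul_interior (h : IsFlow f j T u ρ) (ht : t ∈ flowDom T) (h0 : 0 < t) {z : ℂ}
    (hz : z ∈ odisc) : Real.exp (2 * u z t) * flowD1 T u (z, t) (0, 1) =
      alphaC f u ρ t * (f z * Real.exp (2 * u z t)) + lapW (fun w => u w t) z := by
  have h1 := h.2.2.2.1 t ht h0 z hz
  rw [(hasDerivAt_flow h.1 (odisc_subset_cdisc hz) ht h0).deriv] at h1
  rw [h1, mul_add, ← mul_assoc (Real.exp _) (Real.exp _), ← Real.exp_add, add_neg_cancel,
    Real.exp_zero]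
  ring

lemma IsFlow.exp_mul_boundary (h : IsFlow f j T u ρ) (ht : t ∈ flowDom T) (h0 : 0 < t) {z : ℂ}
    (hz : z ∈ bdry) : Real.exp (u z t) * flowD1 T u (z, t) (0, 1) =
      betaC j u ρ t * (j z * Real.exp (u z t)) - (nder (fun w => u w t) z + 1) := by
  have h1 := h.2.2.2.2.1 t ht h0 z hz
  rw [(hasDerivAt_flow h.1 (bdry_subset_cdisc hz) ht h0).deriv] at h1
  rw [h1, mul_sub, ← mul_assoc (Real.exp _) (Real.exp _), ← Real.exp_add, add_neg_cancel,
    Real.exp_zero]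
  ring

section
variable (h : IsFlow f j T u ρ) (hf : ContinuousOn f cdisc) (hfpos : ∀ z ∈ cdisc, 0 < f z)
  (hj : ContinuousOn j bdry) (hjpos : ∀ z ∈ bdry, 0 < j z) (ht : t ∈ flowDom T)
include h hf hfpos ht

lemma IsFlow.weighted_vol_pos : 0 < ∫ z in odisc, f z * Real.exp (2 * u z t) := by
  have hc := (contDiffOn_slice h.1 ht).continuousOn
  exact ballInt_pos (hf.mul (Real.continuous_exp.comp_continuousOn (continuousOn_const.mul hc)))
    fun z hz => mul_pos (hfpos z hz) (Real.exp_pos _)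

lemma IsFlow.alphaC_mul : alphaC f u ρ t * (∫ z in odisc, f z * Real.exp (2 * u z t)) = 2 * ρ t :=
  div_mul_cancel₀ _ (h.weighted_vol_pos hf hfpos ht).ne'

omit hf hfpos
include hj hjpos

lemma IsFlow.weighted_len_pos : 0 < circInt fun z => j z * Real.exp (u z t) := by
  have hc := (contDiffOn_slice h.1 ht).continuousOn
  exact circInt_pos (hj.mul (Real.continuous_exp.comp_continuousOn (hc.mono bdry_subset_cdisc)))
    fun z hz => mul_pos (hjpos z hz) (Real.exp_pos _)

lemma IsFlow.betaC_mul :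
    betaC j u ρ t * (circInt fun z => j z * Real.exp (u z t)) = 2 * (π - ρ t) :=
  div_mul_cancel₀ _ (h.weighted_len_pos hj hjpos ht).ne'

include hf hfpos

/-- The derivative of the enclosed area plus the boundary length vanishes along the flow. -/
lemma IsFlow.hasDerivAt_vol_add_len (h0 : 0 < t) :
    HasDerivAt (fun t => 1 / 2 * volU (fun w => u w t) + lenU (fun w => u w t)) 0 t := by
  have hsm := contDiffOn_slice h.1 ht
  have hc := hsm.continuousOn
  have hv := (contDiffOn_flow_time h.1 ht).continuousOn
  have h1 := hasDerivAt_weighted_vol h.1 (f := fun _ => 1) continuousOn_const ht h0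
  have h2 := hasDerivAt_weighted_len h.1 (j := fun _ => 1) continuousOn_const ht h0
  simp only [one_mul] at h1 h2
  refine ((h1.const_mul (1 / 2)).add h2).congr_deriv ?_
  have i1 : IntegrableOn (fun z => alphaC f u ρ t * (f z * Real.exp (2 * u z t))) odisc :=
    integrableOn_odisc (continuousOn_const.mul (hf.mul
      (Real.continuous_exp.comp_continuousOn (continuousOn_const.mul hc))))
  have i2 : IntegrableOn (fun z => lapW (fun w => u w t) z) odisc :=
    integrableOn_odisc (continuousOn_lapW hsm)
  have e1 : ∫ z in odisc, Real.exp (2 * u z t) * flowD1 T u (z, t) (0, 1) =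
      2 * ρ t + circInt (nder fun w => u w t) := by
    have hi : EqOn (fun z => Real.exp (2 * u z t) * flowD1 T u (z, t) (0, 1)) (fun z =>
        alphaC f u ρ t * (f z * Real.exp (2 * u z t)) + lapW (fun w => u w t) z) odisc :=
      fun z hz => h.exp_mul_interior ht h0 hz
    rw [setIntegral_congr_fun (s := odisc) measurableSet_ball hi, integral_add i1 i2, integral_const_mul, h.alphaC_mul hf hfpos ht, integral_lapW hsm]
  have hn := (continuousOn_nder hsm).mono bdry_subset_cdisc
  have e2 : (circInt fun z => Real.exp (u z t) * flowD1 T u (z, t) (0, 1)) =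
      2 * (π - ρ t) - (circInt (nder fun w => u w t) + 2 * π) := by
    have c1 : ContinuousOn (fun z => betaC j u ρ t * (j z * Real.exp (u z t))) bdry :=
      continuousOn_const.mul (hj.mul (Real.continuous_exp.comp_continuousOn
        (hc.mono bdry_subset_cdisc)))
    have c2 : ContinuousOn (fun z => nder (fun w => u w t) z + 1) bdry := hn.add continuousOn_const
    rw [circInt_congr fun z hz => h.exp_mul_boundary ht h0 hz, circInt_sub c1 c2,
      circInt_const_mul, h.betaC_mul hj hjpos ht, circInt_add hn continuousOn_const, circInt_const]
    ring
  rw [e1, e2]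
  ring

omit hfpos hjpos in
/-- The time derivative of the Dirichlet energy along the flow. -/
lemma IsFlow.exists_hasDerivAt_quadU (h0 : 0 < t) : ∃ D : ℝ, 0 ≤ D ∧
    HasDerivAt (fun t => quadU fun w => u w t)
      (betaC j u ρ t * (circInt fun z => j z * Real.exp (u z t) * flowD1 T u (z, t) (0, 1)) +
        alphaC f u ρ t * (∫ z in odisc, f z * Real.exp (2 * u z t) * flowD1 T u (z, t) (0, 1)) -
        D) t := by
  have hsm := contDiffOn_slice h.1 ht
  have hc := hsm.continuousOn
  have hv := (contDiffOn_flow_time h.1 ht).continuousOn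
  have he2 : ContinuousOn (fun z => Real.exp (2 * u z t)) cdisc :=
    Real.continuous_exp.comp_continuousOn (continuousOn_const.mul hc)
  have he : ContinuousOn (fun z => Real.exp (u z t)) bdry :=
    Real.continuous_exp.comp_continuousOn (hc.mono bdry_subset_cdisc)
  have hvb := hv.mono bdry_subset_cdisc
  refine ⟨(circInt fun z => Real.exp (u z t) * flowD1 T u (z, t) (0, 1) ^ 2) +
    ∫ z in odisc, Real.exp (2 * u z t) * flowD1 T u (z, t) (0, 1) ^ 2, ?_,
    (hasDerivAt_quadU h.1 ht h0).congr_deriv ?_⟩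
  · refine add_nonneg (intervalIntegral.integral_nonneg Real.two_pi_pos.le fun θ _ => by positivity)
      (integral_nonneg fun z => by positivity)
  · have i1 : IntegrableOn (fun z => Real.exp (2 * u z t) * flowD1 T u (z, t) (0, 1) ^ 2) odisc :=
      integrableOn_odisc (he2.mul (hv.pow 2))
    have i2 : IntegrableOn (fun z => alphaC f u ρ t *
        (f z * Real.exp (2 * u z t) * flowD1 T u (z, t) (0, 1))) odisc :=
      integrableOn_odisc (continuousOn_const.mul ((hf.mul he2).mul hv))
    have e1 : ∫ z in odisc, flowD1 T u (z, t) (0, 1) * lapW (fun w => u w t) z =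
        (∫ z in odisc, Real.exp (2 * u z t) * flowD1 T u (z, t) (0, 1) ^ 2) - alphaC f u ρ t *
          ∫ z in odisc, f z * Real.exp (2 * u z t) * flowD1 T u (z, t) (0, 1) := by
      rw [← integral_const_mul, ← integral_sub i1 i2]
      refine setIntegral_congr_fun measurableSet_ball fun z hz => ?_
      have := h.exp_mul_interior ht h0 hz
      linear_combination -flowD1 T u (z, t) (0, 1) * this
    have e2 : (circInt fun z => flowD1 T u (z, t) (0, 1) * (nder (fun w => u w t) z + 1)) =
        betaC j u ρ t * (circInt fun z => j z * Real.exp (u z t) * flowD1 T u (z, t) (0, 1)) -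
          circInt fun z => Real.exp (u z t) * flowD1 T u (z, t) (0, 1) ^ 2 := by
      have c1 : ContinuousOn (fun z => betaC j u ρ t *
          (j z * Real.exp (u z t) * flowD1 T u (z, t) (0, 1))) bdry :=
        continuousOn_const.mul ((hj.mul he).mul hvb)
      have c2 : ContinuousOn (fun z => Real.exp (u z t) * flowD1 T u (z, t) (0, 1) ^ 2) bdry :=
        he.mul (hvb.pow 2)
      rw [← circInt_const_mul, ← circInt_sub c1 c2]
      refine circInt_congr fun z hz => ?_
      have := h.exp_mul_boundary ht h0 hz
      linear_combination flowD1 T u (z, t) (0, 1) * this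
    rw [e1, e2]
    ring

end
end Flow

/-- The part of the energy depending on `ρ` only. -/
def rhoEnergy (r : ℝ) : ℝ :=
  -r * Real.log 2 + 2 * ((π - r) * Real.log (π - r)) + r * Real.log r + r

/-- The energy functional decreasing along the prescribed curvature flow. -/
def flowEnergy (f j w : ℂ → ℝ) (r : ℝ) : ℝ :=
  quadU w - r * Real.log (∫ z in odisc, f z * Real.exp (2 * w z)) -
    2 * (π - r) * Real.log (circInt fun z => j z * Real.exp (w z)) + rhoEnergy r

lemma hasDerivAt_rhoEnergy {r : ℝ} (h0 : 0 < r) (h1 : r < π) :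
    HasDerivAt rhoEnergy (Real.log r - 2 * Real.log (π - r) - Real.log 2) r := by
  have hp : π - r ≠ 0 := (sub_pos.2 h1).ne'
  have a : HasDerivAt (fun r : ℝ => π - r) (-1) r := by
    simpa using (hasDerivAt_id r).const_sub π
  have b := (Real.hasDerivAt_mul_log hp).comp r a
  have c := Real.hasDerivAt_mul_log h0.ne'
  have d := (((hasDerivAt_id r).neg.mul_const (Real.log 2)).add (b.const_mul 2)).add c |>.add
    (hasDerivAt_id r)
  exact d.congr_deriv (by ring)

lemma neg_one_le_mul_log {x : ℝ} (hx : 0 < x) : -1 ≤ x * Real.log x := by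
  have h := mul_le_mul_of_nonneg_left (Real.one_sub_inv_le_log_of_pos hx) hx.le
  rw [mul_sub, mul_inv_cancel₀ hx.ne'] at h
  linarith

lemma le_rhoEnergy {r : ℝ} (h0 : 0 < r) (h1 : r < π) : -π * Real.log 2 - 3 ≤ rhoEnergy r := by
  have a := neg_one_le_mul_log h0
  have b := neg_one_le_mul_log (sub_pos.2 h1)
  have c := Real.log_nonneg (one_le_two : (1 : ℝ) ≤ 2)
  unfold rhoEnergy
  nlinarith

lemma quadU_congr {v w : ℂ → ℝ} (h : ∀ z ∈ cdisc, v z = w z) : quadU v = quadU w := by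
  unfold quadU
  rw [circInt_congr fun z hz => h z (bdry_subset_cdisc hz)]
  congr 2
  refine setIntegral_congr_fun measurableSet_ball fun z hz => ?_
  simp only [fderivWithin_congr (fun z hz => h z hz) (h z (odisc_subset_cdisc hz))]

lemma volU_congr {v w : ℂ → ℝ} (h : ∀ z ∈ cdisc, v z = w z) : volU v = volU w :=
  setIntegral_congr_fun measurableSet_ball fun z hz => by
    simp only [h z (odisc_subset_cdisc hz)]

lemma lenU_congr {v w : ℂ → ℝ} (h : ∀ z ∈ cdisc, v z = w z) : lenU v = lenU w :=
  circInt_congr fun z hz => by simp only [h z (bdry_subset_cdisc hz)]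

lemma flowEnergy_congr {v w : ℂ → ℝ} (f j : ℂ → ℝ) (r : ℝ) (h : ∀ z ∈ cdisc, v z = w z) :
    flowEnergy f j v r = flowEnergy f j w r := by
  unfold flowEnergy
  have e : ∫ z in odisc, f z * Real.exp (2 * v z) = ∫ z in odisc, f z * Real.exp (2 * w z) :=
    setIntegral_congr_fun measurableSet_ball fun z hz => by
      simp only [h z (odisc_subset_cdisc hz)]
  rw [quadU_congr h, e, circInt_congr (φ := fun z => j z * Real.exp (v z)) fun z hz => by
    rw [h z (bdry_subset_cdisc hz)]]

section Flow
variable {T : ℝ≥0∞} {u : ℂ → ℝ → ℝ} {ρ : ℝ → ℝ} {f j : ℂ → ℝ} {t : ℝ}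
  (h : IsFlow f j T u ρ) (hf : ContinuousOn f cdisc) (hfpos : ∀ z ∈ cdisc, 0 < f z)
  (hj : ContinuousOn j bdry) (hjpos : ∀ z ∈ bdry, 0 < j z) (ht : t ∈ flowDom T)
include h hf hfpos hj hjpos ht

lemma IsFlow.hasDerivAt_rho (h0 : 0 < t) :
    HasDerivAt ρ (Real.log (∫ z in odisc, f z * Real.exp (2 * u z t)) -
      2 * Real.log (circInt fun z => j z * Real.exp (u z t)) -
      (Real.log (ρ t) - 2 * Real.log (π - ρ t) - Real.log 2)) t := by
  have hA := h.weighted_vol_pos hf hfpos ht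
  have hL := h.weighted_len_pos hj hjpos ht
  obtain ⟨hr0, hr1⟩ := h.2.2.1 t ht
  have hd : DifferentiableAt ℝ ρ t :=
    (h.2.1.differentiableOn (by simp)).differentiableAt (flowDom_mem_nhds ht h0)
  have hp : 0 < π - ρ t := sub_pos.2 hr1
  refine hd.hasDerivAt.congr_deriv ?_
  rw [h.2.2.2.2.2 t ht h0]
  unfold alphaC betaC ballInt
  rw [Real.log_div (by positivity) (by positivity), Real.log_pow, Real.log_div (by positivity)
    (by positivity), Real.log_div (by positivity) (by positivity),
    Real.log_mul (by positivity) (by positivity), Real.log_mul (by positivity) (by positivity)]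
  push_cast
  ring

lemma IsFlow.exists_hasDerivAt_energy (h0 : 0 < t) : ∃ d ≤ 0,
    HasDerivAt (fun t => flowEnergy f j (fun w => u w t) (ρ t)) d t := by
  have hA := h.weighted_vol_pos hf hfpos ht
  have hL := h.weighted_len_pos hj hjpos ht
  obtain ⟨hr0, hr1⟩ := h.2.2.1 t ht
  obtain ⟨D, hD, hQ⟩ := h.exists_hasDerivAt_quadU hf hj ht h0
  have hr := h.hasDerivAt_rho hf hfpos hj hjpos ht h0
  have hA' := (hasDerivAt_weighted_vol h.1 hf ht h0).log hA.ne'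
  have hL' := (hasDerivAt_weighted_len h.1 hj ht h0).log hL.ne'
  have hg := (hasDerivAt_rhoEnergy hr0 hr1).comp t hr
  have hE := ((hQ.sub (hr.mul hA')).sub (((hr.const_sub π).const_mul 2).mul hL')).add hg
  set d := Real.log (∫ z in odisc, f z * Real.exp (2 * u z t)) -
      2 * Real.log (circInt fun z => j z * Real.exp (u z t)) -
      (Real.log (ρ t) - 2 * Real.log (π - ρ t) - Real.log 2) with hd
  refine ⟨-D - d ^ 2, by nlinarith [sq_nonneg d], hE.congr_deriv ?_⟩
  unfold alphaC betaC ballInt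
  generalize Real.log (∫ z in odisc, f z * Real.exp (2 * u z t)) = lA at *
  generalize Real.log (circInt fun z => j z * Real.exp (u z t)) = lL at *
  rw [hd]
  ring

omit ht in
lemma IsFlow.continuousOn_energy :
    ContinuousOn (fun t => flowEnergy f j (fun w => u w t) (ρ t)) (flowDom T) := by
  have hr := h.2.1.continuousOn
  have hA := (continuousOn_weighted_vol h.1 hf).log fun t ht =>
    (h.weighted_vol_pos hf hfpos ht).ne'
  have hL := (continuousOn_weighted_len h.1 hj).log fun t ht =>
    (h.weighted_len_pos hj hjpos ht).ne'
  have hg : ContinuousOn (fun t => rhoEnergy (ρ t)) (flowDom T) := fun t ht =>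
    (hasDerivAt_rhoEnergy (h.2.2.1 t ht).1 (h.2.2.1 t ht).2).continuousAt.comp_continuousWithinAt
      (hr t ht)
  exact (((continuousOn_quadU h.1).sub (hr.mul hA)).sub
    ((continuousOn_const.mul (continuousOn_const.sub hr)).mul hL)).add hg

lemma IsFlow.energy_le :
    flowEnergy f j (fun w => u w t) (ρ t) ≤ flowEnergy f j (fun w => u w 0) (ρ 0) := by
  have hd : ∀ s ∈ interior (flowDom T), ∃ d ≤ 0,
      HasDerivAt (fun t => flowEnergy f j (fun w => u w t) (ρ t)) d s := fun s hs =>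
    h.exists_hasDerivAt_energy hf hfpos hj hjpos (interior_subset hs)
      (pos_of_mem_interior_flowDom hs)
  have hanti : AntitoneOn (fun t => flowEnergy f j (fun w => u w t) (ρ t)) (flowDom T) := by
    refine antitoneOn_of_deriv_nonpos convex_flowDom
      (h.continuousOn_energy hf hfpos hj hjpos) (fun s hs => ?_) fun s hs => ?_
    · obtain ⟨d, -, hd⟩ := hd s hs
      exact hd.differentiableAt.differentiableWithinAt
    · obtain ⟨d, hd0, hd⟩ := hd s hs
      rw [hd.deriv]; exact hd0
  exact hanti (flowDom_of_le ht le_rfl ht.1) ht ht.1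

lemma IsFlow.vol_add_len_eq : 1 / 2 * volU (fun w => u w t) + lenU (fun w => u w t) =
    1 / 2 * volU (fun w => u w 0) + lenU (fun w => u w 0) := by
  have hd : ∀ s ∈ interior (flowDom T),
      HasDerivAt (fun t => 1 / 2 * volU (fun w => u w t) + lenU (fun w => u w t)) 0 s :=
    fun s hs => h.hasDerivAt_vol_add_len hf hfpos hj hjpos (interior_subset hs)
      (pos_of_mem_interior_flowDom hs)
  have hc : ContinuousOn (fun t => 1 / 2 * volU (fun w => u w t) + lenU (fun w => u w t))
      (flowDom T) := by
    have h1 := continuousOn_weighted_vol h.1 (f := fun _ => 1) continuousOn_const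
    have h2 := continuousOn_weighted_len h.1 (j := fun _ => 1) continuousOn_const
    simp only [one_mul] at h1 h2
    exact (continuousOn_const.mul h1).add h2
  have h0 := flowDom_of_le ht le_rfl ht.1
  have hanti := antitoneOn_of_deriv_nonpos convex_flowDom hc
    (fun s hs => (hd s hs).differentiableAt.differentiableWithinAt)
    (fun s hs => (hd s hs).deriv.le)
  have hmono := monotoneOn_of_deriv_nonneg convex_flowDom hc
    (fun s hs => (hd s hs).differentiableAt.differentiableWithinAt)
    (fun s hs => (hd s hs).deriv.ge)
  exact le_antisymm (hanti h0 ht ht.1) (hmono h0 ht ht.1)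

end Flow

lemma IsCompact.exists_pos_bounds {K : Set ℂ} (hK : IsCompact K) {f : ℂ → ℝ}
    (hf : ContinuousOn f K) (hpos : ∀ z ∈ K, 0 < f z) :
    ∃ m M : ℝ, 0 < m ∧ 0 < M ∧ ∀ z ∈ K, m ≤ f z ∧ f z ≤ M := by
  rcases K.eq_empty_or_nonempty with rfl | hne
  · exact ⟨1, 1, one_pos, one_pos, by simp⟩
  · obtain ⟨x, hx, hmin⟩ := hK.exists_isMinOn hne hf
    obtain ⟨y, hy, hmax⟩ := hK.exists_isMaxOn hne hf
    exact ⟨f x, f y, hpos x hx, hpos y hy, fun z hz => ⟨hmin hz, hmax hz⟩⟩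

lemma abs_log_sub_log_le {m M x y : ℝ} (hm : 0 < m) (hM : 0 < M) (hx : 0 < x)
    (h1 : m * x ≤ y) (h2 : y ≤ M * x) :
    |Real.log y - Real.log x| ≤ |Real.log m| + |Real.log M| := by
  have hy : 0 < y := (mul_pos hm hx).trans_le h1
  have a := Real.log_le_log (mul_pos hm hx) h1
  have b := Real.log_le_log hy h2
  rw [Real.log_mul hm.ne' hx.ne'] at a
  rw [Real.log_mul hM.ne' hx.ne'] at b
  rw [abs_le]
  constructor <;>
  linarith [neg_abs_le (Real.log m), le_abs_self (Real.log M), abs_nonneg (Real.log m),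
    abs_nonneg (Real.log M)]

lemma exists_log_weighted_vol {f : ℂ → ℝ} (hf : ContinuousOn f cdisc)
    (hfpos : ∀ z ∈ cdisc, 0 < f z) : ∃ c : ℝ, ∀ w : ℂ → ℝ, ContinuousOn w cdisc →
      |Real.log (∫ z in odisc, f z * Real.exp (2 * w z)) - Real.log (volU w)| ≤ c := by
  obtain ⟨m, M, hm, hM, hb⟩ := isCompact_cdisc.exists_pos_bounds hf hfpos
  refine ⟨_, fun w hw => abs_log_sub_log_le hm hM (volU_pos hw) ?_ ?_⟩
  all_goals
    have he : ContinuousOn (fun z => Real.exp (2 * w z)) cdisc :=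
      Real.continuous_exp.comp_continuousOn (continuousOn_const.mul hw)
    rw [volU, ← integral_const_mul]
    refine setIntegral_mono_on (integrableOn_odisc (by fun_prop)) (integrableOn_odisc (by fun_prop))
      measurableSet_ball fun z hz => ?_
    have := hb z (odisc_subset_cdisc hz)
    have := Real.exp_pos (2 * w z)
    gcongr
    first | exact (hb z (odisc_subset_cdisc hz)).1 | exact (hb z (odisc_subset_cdisc hz)).2

lemma circInt_mono_bdry {φ χ : ℂ → ℝ} (hφ : ContinuousOn φ bdry) (hχ : ContinuousOn χ bdry)
    (h : ∀ z ∈ bdry, φ z ≤ χ z) : circInt φ ≤ circInt χ :=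
  intervalIntegral.integral_mono Real.two_pi_pos.le
    ((continuous_comp_bpt hφ).intervalIntegrable _ _)
    ((continuous_comp_bpt hχ).intervalIntegrable _ _) fun θ => h _ (bpt_mem_bdry θ)

lemma exists_log_weighted_len {j : ℂ → ℝ} (hj : ContinuousOn j bdry)
    (hjpos : ∀ z ∈ bdry, 0 < j z) : ∃ c : ℝ, ∀ w : ℂ → ℝ, ContinuousOn w cdisc →
      |Real.log (circInt fun z => j z * Real.exp (w z)) - Real.log (lenU w)| ≤ c := by
  obtain ⟨m, M, hm, hM, hb⟩ := isCompact_bdry.exists_pos_bounds hj hjpos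
  refine ⟨_, fun w hw => abs_log_sub_log_le hm hM (lenU_pos hw) ?_ ?_⟩
  all_goals
    have he : ContinuousOn (fun z => Real.exp (w z)) bdry :=
      Real.continuous_exp.comp_continuousOn (hw.mono bdry_subset_cdisc)
    rw [lenU, ← circInt_const_mul]
    refine circInt_mono_bdry (by fun_prop) (by fun_prop) fun z hz => ?_
    have := Real.exp_pos (w z)
    gcongr
    first | exact (hb z hz).1 | exact (hb z hz).2

/-- Area and length are bounded away from zero once their combination is fixed and the Dirichlet
energy is bounded above. -/
lemma exists_log_bounds (K : ℝ) {M : ℝ} (hM : 0 < M) : ∃ B : ℝ, ∀ w : ℂ → ℝ,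
    ContDiffOn ℝ (⊤ : ℕ∞) w cdisc → 1 / 2 * volU w + lenU w = M → quadU w ≤ K →
      |Real.log (volU w)| ≤ B ∧ |Real.log (lenU w)| ≤ B := by
  obtain ⟨C₁, hC₁⟩ := exists_log_lenU_le
  obtain ⟨C₂, hC₂⟩ := exists_log_volU_le
  refine ⟨4 * (|Real.log M| + |Real.log (2 * M)| + |Real.log (M / 2)| + |C₁| + |C₂| +
    |K / (4 * π)| + |4 / (5 * π) * K|), fun w hw hwM hwK => ?_⟩
  have hV := volU_pos hw.continuousOn
  have hL := lenU_pos hw.continuousOn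
  have h1 := hC₁ w hw
  have h2 := hC₂ w hw
  have hpi := Real.pi_pos
  have q1 : quadU w / (4 * π) ≤ K / (4 * π) := by gcongr
  have q2 : 4 / (5 * π) * quadU w ≤ 4 / (5 * π) * K := by gcongr
  have u1 : Real.log (volU w) ≤ Real.log (2 * M) := Real.log_le_log hV (by linarith)
  have u2 : Real.log (lenU w) ≤ Real.log M := Real.log_le_log hL (by linarith)
  have key : Real.log (M / 2) ≤ Real.log (lenU w) ∨ Real.log M ≤ Real.log (volU w) := by
    rcases le_total (M / 2) (lenU w) with h | h
    · exact Or.inl (Real.log_le_log (by positivity) h)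
    · exact Or.inr (Real.log_le_log hM (by linarith))
  have a1 := abs_le.1 (le_refl |Real.log M|)
  have a2 := abs_le.1 (le_refl |Real.log (2 * M)|)
  have a3 := abs_le.1 (le_refl |Real.log (M / 2)|)
  have a4 := abs_le.1 (le_refl |C₁|)
  have a5 := abs_le.1 (le_refl |C₂|)
  have a6 := abs_le.1 (le_refl |K / (4 * π)|)
  have a7 := abs_le.1 (le_refl |4 / (5 * π) * K|)
  rw [abs_le, abs_le]
  rcases key with h | h <;> refine ⟨⟨?_, ?_⟩, ?_, ?_⟩ <;> linarith

/-- A function that is nondecreasing wherever it is below `m` stays above `m`. -/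
lemma le_of_deriv_nonneg_below {φ : ℝ → ℝ} {t m : ℝ} (ht : 0 ≤ t) (hc : ContinuousOn φ (Icc 0 t))
    (hd : ∀ s ∈ Ioo 0 t, φ s < m → ∃ d ≥ 0, HasDerivAt φ d s) (h0 : m ≤ φ 0) : m ≤ φ t := by
  by_contra! hlt
  have hS : IsCompact (Icc 0 t ∩ φ ⁻¹' Ici m) :=
    isCompact_Icc.of_isClosed_subset (hc.preimage_isClosed_of_isClosed isClosed_Icc isClosed_Ici)
      inter_subset_left
  obtain ⟨s, hs, hmax⟩ := hS.exists_isGreatest ⟨0, ⟨le_rfl, ht⟩, h0⟩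
  have hbelow : ∀ r ∈ Ioo s t, ∃ d ≥ 0, HasDerivAt φ d r := fun r hr =>
    hd r ⟨hs.1.1.trans_lt hr.1, hr.2⟩ (not_le.1 fun hle =>
      hr.1.not_ge (hmax ⟨⟨hs.1.1.trans hr.1.le, hr.2.le⟩, hle⟩))
  have hmono : MonotoneOn φ (Icc s t) := by
    refine monotoneOn_of_deriv_nonneg (convex_Icc s t) (hc.mono (Icc_subset_Icc_left hs.1.1))
      (fun r hr => ?_) fun r hr => ?_
    · rw [interior_Icc] at hr
      obtain ⟨d, -, h⟩ := hbelow r hr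
      exact h.differentiableAt.differentiableWithinAt
    · rw [interior_Icc] at hr
      obtain ⟨d, h0, h⟩ := hbelow r hr
      rw [h.deriv]; exact h0
  have h1 : φ s ≤ φ t := hmono ⟨le_rfl, hs.1.2⟩ ⟨hs.1.2, le_rfl⟩ hs.1.2
  have h2 : m ≤ φ s := hs.2
  linarith

/-- The logarithmic term driving `ρ` is bounded along the flow. -/
lemma exists_flow_log_bound {f j u₀ : ℂ → ℝ} (hf : ContinuousOn f cdisc)
    (hfpos : ∀ z ∈ cdisc, 0 < f z) (hj : ContinuousOn j bdry) (hjpos : ∀ z ∈ bdry, 0 < j z)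
    (hu₀ : ContDiffOn ℝ (⊤ : ℕ∞) u₀ cdisc) (ρ₀ : ℝ) :
    ∃ H : ℝ, 0 ≤ H ∧ ∀ (T : ℝ≥0∞) (u : ℂ → ℝ → ℝ) (ρ : ℝ → ℝ), IsFlow f j T u ρ →
      (∀ z ∈ cdisc, u z 0 = u₀ z) → ρ 0 = ρ₀ → ∀ t ∈ flowDom T,
      |Real.log (∫ z in odisc, f z * Real.exp (2 * u z t)) -
        2 * Real.log (circInt fun z => j z * Real.exp (u z t)) + Real.log 2| ≤ H := by
  obtain ⟨c, hc⟩ := exists_log_weighted_vol hf hfpos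
  obtain ⟨c', hc'⟩ := exists_log_weighted_len hj hjpos
  have hM : 0 < 1 / 2 * volU u₀ + lenU u₀ := by
    have := volU_pos hu₀.continuousOn
    have := lenU_pos hu₀.continuousOn
    positivity
  set M := 1 / 2 * volU u₀ + lenU u₀ with hMdef
  set a := |Real.log (2 * M)| + |c| with ha
  set b := |Real.log M| + |c'| with hb
  obtain ⟨B, hB⟩ := exists_log_bounds
    (flowEnergy f j u₀ ρ₀ + π * a + 2 * π * b + π * Real.log 2 + 3) hM
  refine ⟨|B + c + 2 * (B + c') + Real.log 2|, abs_nonneg _, fun T u ρ h h0 hρ t ht => ?_⟩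
  have hsm := contDiffOn_slice h.1 ht
  have hV := volU_pos hsm.continuousOn
  have hL := lenU_pos hsm.continuousOn
  have hcons := h.vol_add_len_eq hf hfpos hj hjpos ht
  rw [volU_congr h0, lenU_congr h0, ← hMdef] at hcons
  have hen := h.energy_le hf hfpos hj hjpos ht
  rw [flowEnergy_congr f j _ h0, hρ] at hen
  obtain ⟨hr0, hr1⟩ := h.2.2.1 t ht
  have hg := le_rhoEnergy hr0 hr1
  have v1 := abs_le.1 (hc _ hsm.continuousOn)
  have l1 := abs_le.1 (hc' _ hsm.continuousOn)
  have u1 : Real.log (volU fun w => u w t) ≤ Real.log (2 * M) := Real.log_le_log hV (by linarith)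
  have u2 : Real.log (lenU fun w => u w t) ≤ Real.log M := Real.log_le_log hL (by linarith)
  have hK : (quadU fun w => u w t) ≤
      flowEnergy f j u₀ ρ₀ + π * a + 2 * π * b + π * Real.log 2 + 3 := by
    have hA : Real.log (∫ z in odisc, f z * Real.exp (2 * u z t)) ≤ a := by
      linarith [le_abs_self (Real.log (2 * M)), le_abs_self c]
    have hB : Real.log (circInt fun z => j z * Real.exp (u z t)) ≤ b := by
      linarith [le_abs_self (Real.log M), le_abs_self c']
    have ha0 : 0 ≤ a := by positivity
    have hb0 : 0 ≤ b := by positivity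
    have e1 : ρ t * Real.log (∫ z in odisc, f z * Real.exp (2 * u z t)) ≤ π * a :=
      (mul_le_mul_of_nonneg_left hA hr0.le).trans (mul_le_mul_of_nonneg_right hr1.le ha0)
    have e2 : 2 * (π - ρ t) * Real.log (circInt fun z => j z * Real.exp (u z t)) ≤ 2 * π * b :=
      (mul_le_mul_of_nonneg_left hB (by linarith)).trans
        (mul_le_mul_of_nonneg_right (by linarith) hb0)
    unfold flowEnergy at hen ⊢
    linarith
  obtain ⟨b1, b2⟩ := hB _ hsm hcons hK
  rw [abs_le] at b1 b2
  refine le_trans ?_ (le_abs_self _)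
  have := Real.log_nonneg (one_le_two : (1 : ℝ) ≤ 2)
  rw [abs_le]
  constructor <;> linarith

/-- Uniform bounds `0 < ρ₁ ≤ ρ(t) ≤ ρ₂ < π` along the flow, independent of `T`. -/
theorem flow_rho_bounds (f j : ℂ → ℝ)
    (hf : ContDiffOn ℝ (⊤ : ℕ∞) f cdisc) (hfpos : ∀ z ∈ cdisc, 0 < f z)
    (hj : ContDiffOn ℝ (⊤ : ℕ∞) j bdry) (hjpos : ∀ z ∈ bdry, 0 < j z)
    (u₀ : ℂ → ℝ) (hu₀ : ContDiffOn ℝ (⊤ : ℕ∞) u₀ cdisc)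
    (ρ₀ : ℝ) (hρ₀ : ρ₀ ∈ Set.Ioo 0 Real.pi) :
    ∃ ρ₁ ρ₂ : ℝ, 0 < ρ₁ ∧ ρ₁ ≤ ρ₂ ∧ ρ₂ < Real.pi ∧
      ∀ (T : ℝ≥0∞), 0 < T → ∀ (u : ℂ → ℝ → ℝ) (ρ : ℝ → ℝ), IsFlow f j T u ρ →
        (∀ z ∈ cdisc, u z 0 = u₀ z) → ρ 0 = ρ₀ →
        ∀ t : ℝ, 0 < t → ENNReal.ofReal t < T → ρ₁ ≤ ρ t ∧ ρ t ≤ ρ₂ := by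
  obtain ⟨H, hH0, hH⟩ := exists_flow_log_bound hf.continuousOn hfpos hj.continuousOn hjpos hu₀ ρ₀
  have hr1 : Real.exp (-H) ≤ 1 := Real.exp_le_one_iff.2 (by linarith)
  have hpi := Real.pi_gt_three
  refine ⟨min ρ₀ (Real.exp (-H)), max ρ₀ (π - Real.exp (-H)), lt_min hρ₀.1 (Real.exp_pos _),
    (min_le_left _ _).trans (le_max_left _ _),
    max_lt hρ₀.2 (by linarith [Real.exp_pos (-H)]), ?_⟩
  intro T _ u ρ h h0 hρ t ht htT
  have htD : t ∈ flowDom T := ⟨ht.le, htT⟩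
  have hcont : ContinuousOn ρ (Icc 0 t) :=
    h.2.1.continuousOn.mono fun s hs => flowDom_of_le htD hs.1 hs.2
  have hder : ∀ s ∈ Ioo 0 t, ∃ X : ℝ, |X| ≤ H ∧
      HasDerivAt ρ (X + 2 * Real.log (π - ρ s) - Real.log (ρ s)) s := by
    intro s hs
    have hsD := flowDom_of_le htD hs.1.le hs.2.le
    exact ⟨_, hH T u ρ h h0 hρ s hsD,
      (h.hasDerivAt_rho hf.continuousOn hfpos hj.continuousOn hjpos hsD hs.1).congr_deriv (by ring)⟩
  have hρpos : ∀ s ∈ Ioo 0 t, ρ s ∈ Ioo 0 π := fun s hs =>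
    h.2.2.1 s (flowDom_of_le htD hs.1.le hs.2.le)
  constructor
  · refine le_of_deriv_nonneg_below ht.le hcont (fun s hs hlt => ?_) (hρ ▸ min_le_left _ _)
    obtain ⟨X, hX, hd⟩ := hder s hs
    refine ⟨_, ?_, hd⟩
    have hle : ρ s < Real.exp (-H) := hlt.trans_le (min_le_right _ _)
    have h1 : Real.log (ρ s) ≤ -H := by
      rw [← Real.log_exp (-H)]; exact Real.log_le_log (hρpos s hs).1 hle.le
    have h2 : 0 ≤ Real.log (π - ρ s) := Real.log_nonneg (by linarith)
    linarith [(abs_le.1 hX).1]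
  · have := le_of_deriv_nonneg_below (φ := fun s => -ρ s) (m := -max ρ₀ (π - Real.exp (-H))) ht.le
      hcont.neg (fun s hs hlt => ?_) (by simp [hρ])
    · simpa using this
    obtain ⟨X, hX, hd⟩ := hder s hs
    refine ⟨_, ?_, hd.neg⟩
    have hle : π - Real.exp (-H) < ρ s := (le_max_right _ _).trans_lt (neg_lt_neg_iff.1 hlt)
    have hp := (hρpos s hs).2
    have h1 : Real.log (π - ρ s) ≤ -H := by
      rw [← Real.log_exp (-H)]; exact Real.log_le_log (by linarith) (by linarith)
    have h2 : 0 ≤ Real.log (ρ s) := Real.log_nonneg (by linarith)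
    linarith [(abs_le.1 hX).2]
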